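/- Let H, f₁, …, f_n be multipliers of the Dirichlet space 𝒟. Then H belongs to the radical of the ideal generated by f₁, …, f_n in ℳ(𝒟) if and only if there exist a constant C₀ < ∞ and a positive integer m such that |H(z)|^m ≤ C₀ ∑_{j=1}^n |f_j(z)|² for all z in the open unit disk 𝔻. -/

import Mathlib

open Metric MeasureTheory Complex

/-- Taylor coefficient at 0. -/
noncomputable def dirCoeff (f : ℂ → ℂ) (n : ℕ) : ℂ :=
  iteratedDeriv n f 0 / (n.factorial : ℂ)

/-- Membership in the Dirichlet space. -/
def MemDirichlet (f : ℂ → ℂ) : Prop :=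
  DifferentiableOn ℂ f (ball (0:ℂ) 1) ∧
  Summable (fun n : ℕ => ((n : ℝ) + 1) * ‖dirCoeff f n‖ ^ 2)

/-- Squared Dirichlet norm. -/
noncomputable def dirNormSq (f : ℂ → ℂ) : ℝ :=
  ∑' n : ℕ, ((n : ℝ) + 1) * ‖dirCoeff f n‖ ^ 2

/-- Multiplier of the Dirichlet space. -/
def IsMultiplier (φ : ℂ → ℂ) : Prop :=
  DifferentiableOn ℂ φ (ball (0:ℂ) 1) ∧
  ∀ f, MemDirichlet f → MemDirichlet (fun z => φ z * f z)

/-- Operator norm of the multiplication operator. -/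
noncomputable def multNorm (φ : ℂ → ℂ) : ℝ :=
  sInf {C : ℝ | 0 ≤ C ∧ ∀ f, MemDirichlet f →
    dirNormSq (fun z => φ z * f z) ≤ C ^ 2 * dirNormSq f}

/-- The column operator of `F` has norm at most `C`. -/
def ColNormLE (F : ℕ → ℂ → ℂ) (C : ℝ) : Prop :=
  ∀ h, MemDirichlet h →
    Summable (fun j : ℕ => dirNormSq (fun z => F j z * h z)) ∧
    (∑' j : ℕ, dirNormSq (fun z => F j z * h z)) ≤ C ^ 2 * dirNormSq h

namespace DirichletRadical

open PowerSeries

/-! ### Truncated Dirichlet forms on power series -/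

/-- The squared Dirichlet norm of the `L`-th Taylor polynomial. -/
noncomputable def dirPart (L : ℕ) (h : PowerSeries ℂ) : ℝ :=
  ∑ i ∈ Finset.range (L + 1), ((i : ℝ) + 1) * ‖coeff i h‖ ^ 2

/-- The form dual to `dirPart L` under the pairing `(h, x) ↦ coeff L (h * x)`. -/
noncomputable def dualPart (L : ℕ) (x : PowerSeries ℂ) : ℝ :=
  ∑ i ∈ Finset.range (L + 1), ‖coeff (L - i) x‖ ^ 2 / ((i : ℝ) + 1)

/-- `a` is the Taylor series of a multiplier of norm at most `M`. -/
def MulBd (a : PowerSeries ℂ) (M : ℝ) : Prop :=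
  0 ≤ M ∧ ∀ (L : ℕ) (h x : PowerSeries ℂ),
    ‖coeff L (a * h * x)‖ ≤ M * (√(dirPart L h) * √(dualPart L x))

lemma dirPart_nonneg (L : ℕ) (h : PowerSeries ℂ) : 0 ≤ dirPart L h :=
  Finset.sum_nonneg fun _ _ => by positivity

lemma dualPart_nonneg (L : ℕ) (h : PowerSeries ℂ) : 0 ≤ dualPart L h :=
  Finset.sum_nonneg fun _ _ => by positivity

lemma coeff_mul_range (L : ℕ) (h x : PowerSeries ℂ) :
    coeff L (h * x) = ∑ i ∈ Finset.range (L + 1), coeff i h * coeff (L - i) x := by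
  rw [PowerSeries.coeff_mul, Finset.Nat.sum_antidiagonal_eq_sum_range_succ_mk]

lemma norm_coeff_mul_le (L : ℕ) (h x : PowerSeries ℂ) :
    ‖coeff L (h * x)‖ ≤ √(dirPart L h) * √(dualPart L x) := by
  rw [coeff_mul_range]
  have key : ∀ i : ℕ, ‖coeff i h * coeff (L - i) x‖ =
      (√((i : ℝ) + 1) * ‖coeff i h‖) * (‖coeff (L - i) x‖ / √((i : ℝ) + 1)) := by
    intro i
    have : √((i : ℝ) + 1) ≠ 0 := by positivity
    rw [norm_mul]
    field_simp
  calc ‖∑ i ∈ Finset.range (L + 1), coeff i h * coeff (L - i) x‖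
      ≤ ∑ i ∈ Finset.range (L + 1), ‖coeff i h * coeff (L - i) x‖ := norm_sum_le _ _
    _ = ∑ i ∈ Finset.range (L + 1),
        (√((i : ℝ) + 1) * ‖coeff i h‖) * (‖coeff (L - i) x‖ / √((i : ℝ) + 1)) :=
        Finset.sum_congr rfl fun i _ => key i
    _ ≤ √(∑ i ∈ Finset.range (L + 1), (√((i : ℝ) + 1) * ‖coeff i h‖) ^ 2) *
        √(∑ i ∈ Finset.range (L + 1), (‖coeff (L - i) x‖ / √((i : ℝ) + 1)) ^ 2) :=
        Real.sum_mul_le_sqrt_mul_sqrt _ _ _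
    _ = √(dirPart L h) * √(dualPart L x) := by
        congr 2
        · refine Finset.sum_congr rfl fun i _ => ?_
          rw [mul_pow, Real.sq_sqrt (by positivity)]
        · refine Finset.sum_congr rfl fun i _ => ?_
          rw [div_pow, Real.sq_sqrt (by positivity)]

/-- Norming element for `dualPart`. -/
noncomputable def dualVec (L : ℕ) (x : PowerSeries ℂ) : PowerSeries ℂ :=
  PowerSeries.mk fun i => if i ≤ L then starRingEnd ℂ (coeff (L - i) x) / ((i : ℂ) + 1) else 0

lemma coeff_dualVec (L : ℕ) (x : PowerSeries ℂ) (i : ℕ) (hi : i ≤ L) :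
    coeff i (dualVec L x) = starRingEnd ℂ (coeff (L - i) x) / ((i : ℂ) + 1) := by
  simp [dualVec, hi]

lemma norm_natCast_add_one (i : ℕ) : ‖(i : ℂ) + 1‖ = (i : ℝ) + 1 := by
  rw [← Nat.cast_succ, Complex.norm_natCast, Nat.cast_succ]

lemma coeff_mul_dualVec (L : ℕ) (x : PowerSeries ℂ) :
    coeff L (dualVec L x * x) = (dualPart L x : ℂ) := by
  rw [coeff_mul_range, dualPart]
  push_cast
  refine Finset.sum_congr rfl fun i hi => ?_
  rw [coeff_dualVec _ _ _ (Finset.mem_range_succ_iff.mp hi), ← Complex.conj_mul']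
  ring

lemma dirPart_dualVec (L : ℕ) (x : PowerSeries ℂ) :
    dirPart L (dualVec L x) = dualPart L x := by
  refine Finset.sum_congr rfl fun i hi => ?_
  rw [coeff_dualVec _ _ _ (Finset.mem_range_succ_iff.mp hi), norm_div, norm_natCast_add_one,
    RCLike.norm_conj]
  have : (i : ℝ) + 1 ≠ 0 := by positivity
  field_simp

/-- Norming element for `dirPart`. -/
noncomputable def dirVec (L : ℕ) (h : PowerSeries ℂ) : PowerSeries ℂ :=
  PowerSeries.mk fun j => (((L - j : ℕ) : ℂ) + 1) * starRingEnd ℂ (coeff (L - j) h)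

lemma coeff_dirVec (L : ℕ) (h : PowerSeries ℂ) (i : ℕ) (hi : i ≤ L) :
    coeff (L - i) (dirVec L h) = ((i : ℂ) + 1) * starRingEnd ℂ (coeff i h) := by
  simp [dirVec, Nat.sub_sub_self hi]

lemma coeff_mul_dirVec (L : ℕ) (h : PowerSeries ℂ) :
    coeff L (h * dirVec L h) = (dirPart L h : ℂ) := by
  rw [coeff_mul_range, dirPart]
  push_cast
  refine Finset.sum_congr rfl fun i hi => ?_
  rw [coeff_dirVec _ _ _ (Finset.mem_range_succ_iff.mp hi), ← Complex.conj_mul']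
  ring

lemma dualPart_dirVec (L : ℕ) (h : PowerSeries ℂ) :
    dualPart L (dirVec L h) = dirPart L h := by
  refine Finset.sum_congr rfl fun i hi => ?_
  rw [coeff_dirVec _ _ _ (Finset.mem_range_succ_iff.mp hi), norm_mul, norm_natCast_add_one,
    RCLike.norm_conj]
  have : (i : ℝ) + 1 ≠ 0 := by positivity
  field_simp

lemma sqrt_le_of_le_mul_sqrt {a c : ℝ} (ha : 0 ≤ a) (hc : 0 ≤ c) (h : a ≤ c * √a) : √a ≤ c := by
  rcases ha.eq_or_lt with rfl | ha
  · simpa using hc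
  · have h1 : 0 < √a := Real.sqrt_pos.mpr ha
    have h2 : √a * √a = a := Real.mul_self_sqrt ha.le
    nlinarith

lemma MulBd.dual_le {a : PowerSeries ℂ} {M : ℝ} (h : MulBd a M) (L : ℕ) (x : PowerSeries ℂ) :
    √(dualPart L (a * x)) ≤ M * √(dualPart L x) := by
  refine sqrt_le_of_le_mul_sqrt (dualPart_nonneg _ _) (mul_nonneg h.1 (Real.sqrt_nonneg _)) ?_
  have := h.2 L (dualVec L (a * x)) x
  rw [mul_comm a, mul_assoc, coeff_mul_dualVec, Complex.norm_real, Real.norm_eq_abs,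
    dirPart_dualVec] at this
  calc _ ≤ _ := le_abs_self _
    _ ≤ _ := this
    _ = _ := by ring

lemma MulBd.dir_le {a : PowerSeries ℂ} {M : ℝ} (h : MulBd a M) (L : ℕ) (x : PowerSeries ℂ) :
    √(dirPart L (a * x)) ≤ M * √(dirPart L x) := by
  refine sqrt_le_of_le_mul_sqrt (dirPart_nonneg _ _) (mul_nonneg h.1 (Real.sqrt_nonneg _)) ?_
  have := h.2 L x (dirVec L (a * x))
  rw [coeff_mul_dirVec, Complex.norm_real, Real.norm_eq_abs, dualPart_dirVec] at this
  calc _ ≤ _ := le_abs_self _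
    _ ≤ _ := this
    _ = _ := by ring

lemma mulBd_of_dual_le {a : PowerSeries ℂ} {M : ℝ} (hM : 0 ≤ M)
    (h : ∀ L x, √(dualPart L (a * x)) ≤ M * √(dualPart L x)) : MulBd a M := by
  refine ⟨hM, fun L y x => ?_⟩
  rw [mul_comm a, mul_assoc]
  calc _ ≤ _ := norm_coeff_mul_le L y (a * x)
    _ ≤ √(dirPart L y) * (M * √(dualPart L x)) :=
      mul_le_mul_of_nonneg_left (h L x) (Real.sqrt_nonneg _)
    _ = _ := by ring

lemma mulBd_of_dir_le {a : PowerSeries ℂ} {M : ℝ} (hM : 0 ≤ M)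
    (h : ∀ L x, √(dirPart L (a * x)) ≤ M * √(dirPart L x)) : MulBd a M := by
  refine ⟨hM, fun L y x => ?_⟩
  calc _ ≤ _ := norm_coeff_mul_le L (a * y) x
    _ ≤ (M * √(dirPart L y)) * √(dualPart L x) :=
      mul_le_mul_of_nonneg_right (h L y) (Real.sqrt_nonneg _)
    _ = _ := by ring

lemma MulBd.mono {a : PowerSeries ℂ} {M N : ℝ} (h : MulBd a M) (hMN : M ≤ N) : MulBd a N :=
  ⟨h.1.trans hMN, fun L x y => (h.2 L x y).trans (by gcongr)⟩

lemma MulBd.mul {a b : PowerSeries ℂ} {M N : ℝ} (ha : MulBd a M) (hb : MulBd b N) :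
    MulBd (a * b) (M * N) := by
  refine mulBd_of_dual_le (mul_nonneg ha.1 hb.1) fun L x => ?_
  rw [mul_assoc, mul_assoc]
  exact (ha.dual_le L _).trans (mul_le_mul_of_nonneg_left (hb.dual_le L x) ha.1)

lemma mulBd_C (c : ℂ) : MulBd (PowerSeries.C c) ‖c‖ := by
  refine mulBd_of_dual_le (norm_nonneg _) fun L x => le_of_eq ?_
  have : dualPart L (PowerSeries.C c * x) = ‖c‖ ^ 2 * dualPart L x := by
    rw [dualPart, dualPart, Finset.mul_sum]
    refine Finset.sum_congr rfl fun i _ => ?_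
    rw [PowerSeries.coeff_C_mul, norm_mul]
    ring
  rw [this, Real.sqrt_mul (by positivity), Real.sqrt_sq (norm_nonneg _)]

lemma MulBd.pow {a : PowerSeries ℂ} {M : ℝ} (ha : MulBd a M) (n : ℕ) :
    MulBd (a ^ n) (M ^ n) := by
  induction n with
  | zero => simpa using mulBd_C 1
  | succ n ih => simpa [pow_succ] using ih.mul ha

lemma sqrt_dirPart_C (L : ℕ) (c : ℂ) : √(dirPart L (PowerSeries.C c)) = ‖c‖ := by
  have : dirPart L (PowerSeries.C c) = ‖c‖ ^ 2 := by
    rw [dirPart, Finset.sum_eq_single 0]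
    · simp
    · intro i _ hi
      simp [PowerSeries.coeff_C, hi]
    · simp
  rw [this, Real.sqrt_sq (norm_nonneg _)]

lemma norm_coeff_le_sqrt_dirPart (L : ℕ) (h : PowerSeries ℂ) : ‖coeff L h‖ ≤ √(dirPart L h) := by
  refine Real.le_sqrt_of_sq_le ?_
  calc ‖coeff L h‖ ^ 2 ≤ ((L : ℝ) + 1) * ‖coeff L h‖ ^ 2 := by
        have : (0 : ℝ) ≤ L := by positivity
        nlinarith [sq_nonneg ‖coeff L h‖]
    _ ≤ dirPart L h := Finset.single_le_sum (f := fun i : ℕ => ((i : ℝ) + 1) * ‖coeff i h‖ ^ 2)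
        (fun _ _ => by positivity) (Finset.self_mem_range_succ L)

lemma MulBd.norm_coeff_le {a : PowerSeries ℂ} {M : ℝ} (ha : MulBd a M) (n : ℕ) :
    ‖coeff n a‖ ≤ M := by
  have h1 := norm_coeff_le_sqrt_dirPart n a
  have h2 := ha.dir_le n (PowerSeries.C 1)
  rw [sqrt_dirPart_C] at h2
  simpa using h1.trans (by simpa using h2)

/-! ### Evaluation of power series in the disk -/

/-- The sum of a power series at a point. -/
noncomputable def val (a : PowerSeries ℂ) (z : ℂ) : ℂ := ∑' n, coeff n a * z ^ n

lemma MulBd.summable {a : PowerSeries ℂ} {M : ℝ} (ha : MulBd a M) {z : ℂ} (hz : ‖z‖ < 1) :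
    Summable fun n => ‖coeff n a * z ^ n‖ := by
  refine Summable.of_nonneg_of_le (fun _ => norm_nonneg _) (fun n => ?_)
    ((summable_geometric_of_lt_one (norm_nonneg z) hz).mul_left M)
  rw [norm_mul, norm_pow]
  gcongr
  exact ha.norm_coeff_le n

lemma val_mul {a b : PowerSeries ℂ} {z : ℂ} (ha : Summable fun n => ‖coeff n a * z ^ n‖)
    (hb : Summable fun n => ‖coeff n b * z ^ n‖) : val (a * b) z = val a z * val b z := by
  rw [val, val, val, tsum_mul_tsum_eq_tsum_sum_antidiagonal_of_summable_norm ha hb]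
  refine tsum_congr fun n => ?_
  rw [PowerSeries.coeff_mul, Finset.sum_mul]
  refine Finset.sum_congr rfl fun p hp => ?_
  rw [← Finset.HasAntidiagonal.mem_antidiagonal.mp hp]
  ring

lemma summable_mul {a b : PowerSeries ℂ} {z : ℂ} (ha : Summable fun n => ‖coeff n a * z ^ n‖)
    (hb : Summable fun n => ‖coeff n b * z ^ n‖) :
    Summable fun n => ‖coeff n (a * b) * z ^ n‖ := by
  refine (summable_norm_sum_mul_antidiagonal_of_summable_norm ha hb).congr fun n => ?_
  rw [PowerSeries.coeff_mul, Finset.sum_mul]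
  congr 1
  refine Finset.sum_congr rfl fun p hp => ?_
  rw [← Finset.HasAntidiagonal.mem_antidiagonal.mp hp]
  ring

lemma val_one (z : ℂ) : val 1 z = 1 := by
  rw [val, tsum_eq_single 0] <;> simp +contextual [PowerSeries.coeff_one]

lemma MulBd.val_pow {a : PowerSeries ℂ} {M : ℝ} (ha : MulBd a M) {z : ℂ} (hz : ‖z‖ < 1) (n : ℕ) :
    val (a ^ n) z = val a z ^ n := by
  induction n with
  | zero => simp [val_one]
  | succ n ih => rw [pow_succ, pow_succ, val_mul ((ha.pow n).summable hz) (ha.summable hz), ih]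

lemma MulBd.norm_val_le' {a : PowerSeries ℂ} {M : ℝ} (ha : MulBd a M) {z : ℂ} (hz : ‖z‖ < 1) :
    ‖val a z‖ ≤ M * (1 - ‖z‖)⁻¹ := by
  have h2 : Summable fun n => M * ‖z‖ ^ n :=
    (summable_geometric_of_lt_one (norm_nonneg z) hz).mul_left M
  calc ‖val a z‖ ≤ ∑' n, ‖coeff n a * z ^ n‖ := norm_tsum_le_tsum_norm (ha.summable hz)
    _ ≤ ∑' n, M * ‖z‖ ^ n := by
        refine (ha.summable hz).tsum_le_tsum (fun n => ?_) h2
        rw [norm_mul, norm_pow]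
        gcongr
        exact ha.norm_coeff_le n
    _ = M * (1 - ‖z‖)⁻¹ := by rw [tsum_mul_left, tsum_geometric_of_lt_one (norm_nonneg z) hz]

lemma le_of_pow_le_const_mul_pow {x M c : ℝ} (hM : 0 ≤ M)
    (h : ∀ n : ℕ, x ^ n ≤ M ^ n * c) : x ≤ M := by
  by_contra! hlt
  have hx : 0 < x := hM.trans_lt hlt
  rcases hM.eq_or_lt with rfl | hM
  · have := h 1
    simp at this
    linarith
  · have h1 : 1 < x / M := (one_lt_div hM).mpr hlt
    obtain ⟨n, hn⟩ := pow_unbounded_of_one_lt c h1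
    rw [div_pow, lt_div_iff₀ (by positivity)] at hn
    linarith [h n]

/-- Multipliers are bounded by their multiplier norm. -/
lemma MulBd.norm_val_le {a : PowerSeries ℂ} {M : ℝ} (ha : MulBd a M) {z : ℂ} (hz : ‖z‖ < 1) :
    ‖val a z‖ ≤ M := by
  refine le_of_pow_le_const_mul_pow (c := (1 - ‖z‖)⁻¹) ha.1 fun n => ?_
  rw [← norm_pow, ← ha.val_pow hz]
  exact (ha.pow n).norm_val_le' hz

end DirichletRadical

namespace DirichletRadical

open PowerSeries

/-! ### The complete Pick property of the Dirichlet kernel -/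

/-- The Dirichlet kernel `∑ xⁿ / (n + 1)`. -/
noncomputable def dirKernel : PowerSeries ℝ := PowerSeries.mk fun n => ((n : ℝ) + 1)⁻¹

/-- The coefficients of `1 - 1 / k`, where `k` is the Dirichlet kernel. -/
noncomputable def pickCoeff (n : ℕ) : ℝ := coeff n (1 - dirKernel⁻¹)

lemma pickCoeff_zero : pickCoeff 0 = 0 := by
  simp [pickCoeff, dirKernel]

lemma sum_pickCoeff {n : ℕ} (hn : n ≠ 0) :
    ∑ t ∈ Finset.range (n + 1), pickCoeff t * (((n - t : ℕ) : ℝ) + 1)⁻¹ = ((n : ℝ) + 1)⁻¹ := by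
  have h0 : constantCoeff dirKernel ≠ 0 := by simp [dirKernel]
  have h1 : (1 - dirKernel⁻¹) * dirKernel = dirKernel - 1 := by
    rw [sub_mul, PowerSeries.inv_mul_cancel _ h0, one_mul]
  have h2 := congrArg (coeff n) h1
  rw [PowerSeries.coeff_mul, Finset.Nat.sum_antidiagonal_eq_sum_range_succ_mk] at h2
  simpa [dirKernel, PowerSeries.coeff_one, hn, pickCoeff] using h2

lemma pickCoeff_nonneg (n : ℕ) : 0 ≤ pickCoeff n := by
  induction n using Nat.strong_induction_on with
  | _ n ih =>
    rcases n with _ | n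
    · rw [pickCoeff_zero]
    rcases n with _ | n
    · have := sum_pickCoeff one_ne_zero
      rw [Finset.sum_range_succ, Finset.sum_range_one, pickCoeff_zero] at this
      norm_num at this
      simp [this]
    · have h1 := sum_pickCoeff (n := n + 1 + 1) (by omega)
      have h2 := sum_pickCoeff (n := n + 1) (by omega)
      rw [Finset.sum_range_succ] at h1
      simp only [Nat.sub_self, Nat.cast_zero, zero_add, inv_one, mul_one] at h1
      have h3 : ∑ t ∈ Finset.range (n + 1 + 1),
          pickCoeff t * (((n + 1 + 1 - t : ℕ) : ℝ) + 1)⁻¹ ≤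
          ∑ t ∈ Finset.range (n + 1 + 1), pickCoeff t * (((n + 1 - t : ℕ) : ℝ) + 1)⁻¹ *
            (((n : ℝ) + 1 + 1) / ((n : ℝ) + 1 + 1 + 1)) := by
        refine Finset.sum_le_sum fun t ht => ?_
        have ht' : t ≤ n + 1 := Finset.mem_range_succ_iff.mp ht
        rw [mul_assoc]
        refine mul_le_mul_of_nonneg_left ?_ (ih t (by omega))
        obtain ⟨s, hs⟩ := Nat.exists_eq_add_of_le ht'
        have e1 : n + 1 - t = s := by omega
        have e2 : n + 1 + 1 - t = s + 1 := by omega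
        have e3 : (n : ℝ) + 1 = t + s := by exact_mod_cast hs
        rw [e1, e2, e3]
        push_cast
        rw [inv_mul_eq_div, div_div, inv_eq_one_div, div_le_div_iff₀ (by positivity) (by positivity)]
        have : (0 : ℝ) ≤ t := by positivity
        nlinarith
      rw [← Finset.sum_mul, h2] at h3
      push_cast at h1 h3
      have h4 : ((n : ℝ) + 1 + 1)⁻¹ * (((n : ℝ) + 1 + 1) / ((n : ℝ) + 1 + 1 + 1)) =
          ((n : ℝ) + 1 + 1 + 1)⁻¹ := by
        field_simp
      linarith

lemma dualPart_eq_add_sum (L : ℕ) (y : PowerSeries ℂ) :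
    dualPart L y = ‖coeff L y‖ ^ 2 +
      ∑ t ∈ Finset.range (L + 1), pickCoeff t * dualPart L (X ^ t * y) := by
  have h1 : ∀ t ∈ Finset.range (L + 1), pickCoeff t * dualPart L (X ^ t * y) =
      ∑ j ∈ Finset.range (L + 1), if t ≤ j then
        pickCoeff t * (((j - t : ℕ) : ℝ) + 1)⁻¹ * ‖coeff (L - j) y‖ ^ 2 else 0 := by
    intro t ht
    have ht' : t ≤ L := Finset.mem_range_succ_iff.mp ht
    rw [dualPart, Finset.mul_sum, ← Finset.sum_filter]
    have : ∀ i ∈ Finset.range (L + 1),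
        pickCoeff t * (‖coeff (L - i) (X ^ t * y)‖ ^ 2 / ((i : ℝ) + 1)) =
        if i + t ≤ L then pickCoeff t * ((i : ℝ) + 1)⁻¹ * ‖coeff (L - (i + t)) y‖ ^ 2 else 0 := by
      intro i hi
      have hi' : i ≤ L := Finset.mem_range_succ_iff.mp hi
      rw [PowerSeries.coeff_X_pow_mul']
      by_cases h : i + t ≤ L
      · rw [if_pos (by omega), if_pos h, Nat.sub_sub, div_eq_mul_inv]
        ring
      · rw [if_neg (by omega), if_neg h]
        simp
    rw [Finset.sum_congr rfl this, ← Finset.sum_filter]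
    refine Finset.sum_nbij' (fun i => i + t) (fun j => j - t) ?_ ?_ ?_ ?_ ?_
    · intro i; simp only [Finset.mem_filter, Finset.mem_range]; omega
    · intro i; simp only [Finset.mem_filter, Finset.mem_range]; omega
    · intro i; simp only [Finset.mem_filter, Finset.mem_range]; omega
    · intro i; simp only [Finset.mem_filter, Finset.mem_range]; omega
    · intro i _
      rw [Nat.add_sub_cancel]
  rw [Finset.sum_congr rfl h1, Finset.sum_comm]
  have h2 : ∀ j ∈ Finset.range (L + 1), (∑ t ∈ Finset.range (L + 1), if t ≤ j then
        pickCoeff t * (((j - t : ℕ) : ℝ) + 1)⁻¹ * ‖coeff (L - j) y‖ ^ 2 else 0) =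
      if j = 0 then 0 else ((j : ℝ) + 1)⁻¹ * ‖coeff (L - j) y‖ ^ 2 := by
    intro j hj
    have hj' : j ≤ L := Finset.mem_range_succ_iff.mp hj
    rw [← Finset.sum_filter]
    have : {t ∈ Finset.range (L + 1) | t ≤ j} = Finset.range (j + 1) := by
      ext t; simp only [Finset.mem_filter, Finset.mem_range]; omega
    rw [this, ← Finset.sum_mul]
    split_ifs with h0
    · subst h0
      simp [pickCoeff_zero]
    · rw [sum_pickCoeff h0]
  rw [Finset.sum_congr rfl h2, Finset.sum_range_succ', dualPart, Finset.sum_range_succ']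
  simp [div_eq_inv_mul, add_comm]

/-! ### Contractions between Euclidean spaces -/

lemma exists_contraction {V Y₁ Y₂ : Type*} [AddCommGroup V] [Module ℂ V]
    [NormedAddCommGroup Y₁] [InnerProductSpace ℂ Y₁] [FiniteDimensional ℂ Y₁]
    [NormedAddCommGroup Y₂] [InnerProductSpace ℂ Y₂]
    (P : V →ₗ[ℂ] Y₁) (Q : V →ₗ[ℂ] Y₂) (h : ∀ v, ‖Q v‖ ≤ ‖P v‖) :
    ∃ K : Y₁ →L[ℂ] Y₂, (∀ v, K (P v) = Q v) ∧ ∀ y, ‖K y‖ ≤ ‖y‖ := by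
  obtain ⟨g, hg⟩ := P.rangeRestrict.exists_rightInverse_of_surjective P.range_rangeRestrict
  have hg' : ∀ s : LinearMap.range P, P (g s) = s := fun s =>
    congrArg Subtype.val (LinearMap.congr_fun hg s)
  let S := LinearMap.range P
  let K₀ : Y₁ →ₗ[ℂ] Y₂ := (Q ∘ₗ g) ∘ₗ (S.orthogonalProjectionOnto : Y₁ →ₗ[ℂ] S)
  refine ⟨LinearMap.toContinuousLinearMap K₀, fun v => ?_, fun y => ?_⟩
  · have h1 : S.orthogonalProjectionOnto (P v) = ⟨P v, LinearMap.mem_range_self P v⟩ :=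
      Submodule.orthogonalProjectionOnto_mem_subspace_eq_self (K := S) ⟨P v, _⟩
    have h2 : ‖Q (g ⟨P v, LinearMap.mem_range_self P v⟩ - v)‖ ≤ 0 := by
      refine (h _).trans ?_
      rw [map_sub, hg', sub_self, norm_zero]
    rw [norm_le_zero_iff, map_sub, sub_eq_zero] at h2
    change Q (g (S.orthogonalProjectionOnto (P v))) = Q v
    rw [h1, h2]
  · change ‖Q (g (S.orthogonalProjectionOnto y))‖ ≤ ‖y‖
    refine (h _).trans ?_
    rw [hg']
    exact S.norm_orthogonalProjectionOnto_apply_le y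

lemma exists_defect {V Y₁ Y₂ : Type*} [AddCommGroup V] [Module ℂ V]
    [NormedAddCommGroup Y₁] [InnerProductSpace ℂ Y₁] [FiniteDimensional ℂ Y₁]
    [NormedAddCommGroup Y₂] [InnerProductSpace ℂ Y₂] [FiniteDimensional ℂ Y₂]
    (P : V →ₗ[ℂ] Y₁) (Q : V →ₗ[ℂ] Y₂) (h : ∀ v, ‖Q v‖ ≤ ‖P v‖) :
    ∃ E : V →ₗ[ℂ] Y₁, ∀ v, ‖P v‖ ^ 2 = ‖Q v‖ ^ 2 + ‖E v‖ ^ 2 := by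
  have : CompleteSpace Y₁ := FiniteDimensional.complete ℂ Y₁
  have : CompleteSpace Y₂ := FiniteDimensional.complete ℂ Y₂
  obtain ⟨K, hK, hK1⟩ := exists_contraction P Q h
  set T : Y₁ →L[ℂ] Y₁ := 1 - ContinuousLinearMap.adjoint K ∘L K with hT
  have key : ∀ y, inner ℂ (T y) y = ((‖y‖ ^ 2 - ‖K y‖ ^ 2 : ℝ) : ℂ) := by
    intro y
    rw [hT, sub_apply, inner_sub_left, one_apply_eq_self,
      ContinuousLinearMap.comp_apply, ContinuousLinearMap.adjoint_inner_left,
      inner_self_eq_norm_sq_to_K, inner_self_eq_norm_sq_to_K]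
    push_cast
    rfl
  have hpos : 0 ≤ T := by
    rw [ContinuousLinearMap.nonneg_iff_isPositive, ContinuousLinearMap.isPositive_iff_complex]
    intro y
    rw [key y]
    refine ⟨rfl, ?_⟩
    change 0 ≤ ‖y‖ ^ 2 - ‖K y‖ ^ 2
    have := pow_le_pow_left₀ (norm_nonneg _) (hK1 y) 2
    linarith
  obtain ⟨D, hD⟩ := CStarAlgebra.nonneg_iff_eq_star_mul_self.mp hpos
  refine ⟨(D : Y₁ →ₗ[ℂ] Y₁) ∘ₗ P, fun v => ?_⟩
  have h1 := key (P v)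
  rw [hD, ContinuousLinearMap.star_eq_adjoint, ContinuousLinearMap.mul_def,
    ContinuousLinearMap.comp_apply, ContinuousLinearMap.adjoint_inner_left, inner_self_eq_norm_sq_to_K, hK] at h1
  have h2 : ‖D (P v)‖ ^ 2 = ‖P v‖ ^ 2 - ‖Q v‖ ^ 2 := Complex.ofReal_injective (by
    rw [← h1]; push_cast; rfl)
  change _ = _ + ‖D (P v)‖ ^ 2
  linarith

end DirichletRadical

namespace DirichletRadical

open PowerSeries

/-! ### The Toeplitz corona theorem for the Dirichlet space -/

/-- Pairing two linear maps into the Hilbert sum of their codomains. -/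
noncomputable def hProd {V Y₁ Y₂ : Type*} [AddCommGroup V] [Module ℂ V]
    [NormedAddCommGroup Y₁] [InnerProductSpace ℂ Y₁]
    [NormedAddCommGroup Y₂] [InnerProductSpace ℂ Y₂]
    (A : V →ₗ[ℂ] Y₁) (B : V →ₗ[ℂ] Y₂) : V →ₗ[ℂ] WithLp 2 (Y₁ × Y₂) :=
  ((WithLp.linearEquiv 2 ℂ (Y₁ × Y₂)).symm : (Y₁ × Y₂) →ₗ[ℂ] WithLp 2 (Y₁ × Y₂)) ∘ₗ A.prod B

/-- A finite family of linear maps, combined into the Hilbert sum of the codomains. -/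
noncomputable def hPi {ι V Y : Type*} [Fintype ι] [AddCommGroup V] [Module ℂ V]
    [NormedAddCommGroup Y] [InnerProductSpace ℂ Y]
    (A : ι → V →ₗ[ℂ] Y) : V →ₗ[ℂ] PiLp 2 (fun _ : ι => Y) :=
  ((WithLp.linearEquiv 2 ℂ (ι → Y)).symm : (ι → Y) →ₗ[ℂ] PiLp 2 (fun _ : ι => Y)) ∘ₗ
    LinearMap.pi A

section

variable {ι V Y Y₁ Y₂ : Type*} [Fintype ι] [AddCommGroup V] [Module ℂ V]
  [NormedAddCommGroup Y] [InnerProductSpace ℂ Y]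
  [NormedAddCommGroup Y₁] [InnerProductSpace ℂ Y₁]
  [NormedAddCommGroup Y₂] [InnerProductSpace ℂ Y₂]

lemma hProd_apply (A : V →ₗ[ℂ] Y₁) (B : V →ₗ[ℂ] Y₂) (v : V) :
    hProd A B v = WithLp.toLp 2 (A v, B v) := rfl

lemma hPi_apply (A : ι → V →ₗ[ℂ] Y) (v : V) :
    hPi A v = WithLp.toLp 2 (fun i => A i v) := rfl

lemma norm_hProd_sq (A : V →ₗ[ℂ] Y₁) (B : V →ₗ[ℂ] Y₂) (v : V) :
    ‖hProd A B v‖ ^ 2 = ‖A v‖ ^ 2 + ‖B v‖ ^ 2 := by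
  rw [hProd_apply, WithLp.prod_norm_sq_eq_of_L2]
  rfl

lemma norm_hPi_sq (A : ι → V →ₗ[ℂ] Y) (v : V) : ‖hPi A v‖ ^ 2 = ∑ i, ‖A i v‖ ^ 2 := by
  rw [hPi_apply, PiLp.norm_sq_eq_of_L2]

end

/-- The linear map realising the square root of `dualPart L` as a Euclidean norm. -/
noncomputable def dualMap (L : ℕ) : PowerSeries ℂ →ₗ[ℂ] EuclideanSpace ℂ (Fin (L + 1)) :=
  hPi fun i => ((√((i : ℝ) + 1) : ℂ)⁻¹) • coeff (L - i)

lemma norm_dualMap_sq (L : ℕ) (x : PowerSeries ℂ) : ‖dualMap L x‖ ^ 2 = dualPart L x := by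
  rw [dualMap, norm_hPi_sq, dualPart, Finset.sum_range]
  refine Finset.sum_congr rfl fun i _ => ?_
  rw [LinearMap.smul_apply, norm_smul, norm_inv, Complex.norm_real, mul_pow, inv_pow,
    Real.norm_eq_abs, sq_abs, Real.sq_sqrt (by positivity), inv_mul_eq_div]

lemma dualPart_X_pow_mul (L k : ℕ) (hk : k ≤ L) (x : PowerSeries ℂ) :
    dualPart L (X ^ k * x) = dualPart (L - k) x := by
  rw [dualPart, dualPart]
  symm
  refine Finset.sum_subset_zero_on_sdiff (Finset.range_subset_range.mpr (by omega))
    (fun i hi => ?_) (fun i hi => ?_)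
  · simp only [Finset.mem_sdiff, Finset.mem_range] at hi
    rw [PowerSeries.coeff_X_pow_mul', if_neg (by omega)]
    simp
  · simp only [Finset.mem_range] at hi
    rw [PowerSeries.coeff_X_pow_mul', if_pos (by omega)]
    congr 5
    omega

lemma dualPart_X_pow_mul_of_lt (L k : ℕ) (hk : L < k) (x : PowerSeries ℂ) :
    dualPart L (X ^ k * x) = 0 := by
  rw [dualPart]
  refine Finset.sum_eq_zero fun i _ => ?_
  rw [PowerSeries.coeff_X_pow_mul', if_neg (by omega)]
  simp

section Transfer

variable {n : ℕ} {K : Type*} [NormedAddCommGroup K] [InnerProductSpace ℂ K] (L : ℕ)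

/-- Multiplication of a tuple of power series by `X ^ t`. -/
noncomputable def shiftTuple (n t : ℕ) : (Fin n → PowerSeries ℂ) →ₗ[ℂ] (Fin n → PowerSeries ℂ) :=
  LinearMap.pi fun l => LinearMap.mulLeft ℂ (X ^ t) ∘ₗ LinearMap.proj l

lemma shiftTuple_apply (t : ℕ) (y : Fin n → PowerSeries ℂ) (l : Fin n) :
    shiftTuple n t y l = X ^ t * y l := rfl

lemma shiftTuple_shiftTuple (s t : ℕ) (y : Fin n → PowerSeries ℂ) :
    shiftTuple n s (shiftTuple n t y) = shiftTuple n (t + s) y := by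
  funext l
  simp only [shiftTuple_apply]
  ring

/-- The input of the transfer function realisation. -/
noncomputable def transferIn (Γ : (Fin n → PowerSeries ℂ) →ₗ[ℂ] K) :
    (Fin n → PowerSeries ℂ) →ₗ[ℂ]
      WithLp 2 (EuclideanSpace ℂ (Fin n) × PiLp 2 (fun _ : Fin (L + 1) => K)) :=
  hProd (hPi fun l => coeff L ∘ₗ LinearMap.proj l)
    (hPi fun t : Fin (L + 1) => ((√(pickCoeff t) : ℝ) : ℂ) • (Γ ∘ₗ shiftTuple n t))

lemma transferIn_congr {Γ Γ' : (Fin n → PowerSeries ℂ) →ₗ[ℂ] K} {y : Fin n → PowerSeries ℂ}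
    (h : ∀ t, 0 < t → Γ (shiftTuple n t y) = Γ' (shiftTuple n t y)) :
    transferIn L Γ y = transferIn L Γ' y := by
  have : ∀ t : Fin (L + 1), ((√(pickCoeff t) : ℝ) : ℂ) • Γ (shiftTuple n t y) =
      ((√(pickCoeff t) : ℝ) : ℂ) • Γ' (shiftTuple n t y) := by
    intro t
    rcases Nat.eq_zero_or_pos (t : ℕ) with h0 | h0
    · rw [h0, pickCoeff_zero]; simp
    · rw [h _ h0]
  simp only [transferIn, hProd_apply, hPi_apply, LinearMap.smul_apply, LinearMap.comp_apply, this]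

lemma transferIn_eq_zero {Γ : (Fin n → PowerSeries ℂ) →ₗ[ℂ] K} {y : Fin n → PowerSeries ℂ}
    {k : ℕ} (hk : L < k) (h : ∀ j, L < j → Γ (shiftTuple n j y) = 0) :
    transferIn L Γ (shiftTuple n k y) = 0 := by
  have h1 : ∀ t : Fin (L + 1), Γ (shiftTuple n t (shiftTuple n k y)) = 0 := by
    intro t
    rw [shiftTuple_shiftTuple]
    exact h _ (by omega)
  have h2 : ∀ l, coeff L (shiftTuple n k y l) = 0 := by
    intro l
    rw [shiftTuple_apply, PowerSeries.coeff_X_pow_mul', if_neg (by omega)]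
  rw [← norm_eq_zero, ← sq_eq_zero_iff, transferIn, norm_hProd_sq, norm_hPi_sq, norm_hPi_sq]
  simp [h1, h2]

lemma norm_transferIn_sq (Γ : (Fin n → PowerSeries ℂ) →ₗ[ℂ] K) (y : Fin n → PowerSeries ℂ) :
    ‖transferIn L Γ y‖ ^ 2 = ∑ l, ‖coeff L (y l)‖ ^ 2 +
      ∑ t ∈ Finset.range (L + 1), pickCoeff t * ‖Γ (shiftTuple n t y)‖ ^ 2 := by
  rw [transferIn, norm_hProd_sq, norm_hPi_sq, norm_hPi_sq, Finset.sum_range]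
  congr 1
  refine Finset.sum_congr rfl fun t _ => ?_
  rw [LinearMap.smul_apply, norm_smul, Complex.norm_real, mul_pow, Real.norm_eq_abs, sq_abs,
    Real.sq_sqrt (pickCoeff_nonneg _)]
  rfl

variable (V : WithLp 2 (EuclideanSpace ℂ (Fin n) × PiLp 2 (fun _ : Fin (L + 1) => K)) →ₗ[ℂ]
  WithLp 2 (ℂ × K))

/-- The second component of a Hilbert sum, as a linear map. -/
noncomputable def hSnd : WithLp 2 (ℂ × K) →ₗ[ℂ] K :=
  LinearMap.snd ℂ ℂ K ∘ₗ (WithLp.linearEquiv 2 ℂ (ℂ × K) : WithLp 2 (ℂ × K) →ₗ[ℂ] ℂ × K)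

/-- The first component of a Hilbert sum, as a linear map. -/
noncomputable def hFst : WithLp 2 (ℂ × K) →ₗ[ℂ] ℂ :=
  LinearMap.fst ℂ ℂ K ∘ₗ (WithLp.linearEquiv 2 ℂ (ℂ × K) : WithLp 2 (ℂ × K) →ₗ[ℂ] ℂ × K)

/-- Iterates converging to the state of the transfer function realisation. -/
noncomputable def stateIter : ℕ → (Fin n → PowerSeries ℂ) →ₗ[ℂ] K
  | 0 => 0
  | k + 1 => hSnd ∘ₗ V ∘ₗ transferIn L (stateIter k)

lemma stateIter_shift_eq_zero (y : Fin n → PowerSeries ℂ) (k : ℕ) :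
    ∀ j, L < j → stateIter L V k (shiftTuple n j y) = 0 := by
  induction k with
  | zero => intro j _; rfl
  | succ k ih =>
    intro j hj
    change hSnd (V (transferIn L (stateIter L V k) _)) = 0
    rw [transferIn_eq_zero L hj ih, map_zero, map_zero]

lemma stateIter_succ_shift (y : Fin n → PowerSeries ℂ) (k : ℕ) :
    ∀ j, L < j + k → stateIter L V (k + 1) (shiftTuple n j y) =
      stateIter L V k (shiftTuple n j y) := by
  induction k with
  | zero => intro j hj; rw [stateIter_shift_eq_zero L V y _ j hj]; rfl
  | succ k ih =>
    intro j hj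
    change hSnd (V (transferIn L (stateIter L V (k + 1)) _)) =
      hSnd (V (transferIn L (stateIter L V k) _))
    rw [transferIn_congr L (Γ' := stateIter L V k)]
    intro t ht
    rw [shiftTuple_shiftTuple]
    exact ih _ (by omega)

lemma shiftTuple_zero (y : Fin n → PowerSeries ℂ) : shiftTuple n 0 y = y := by
  funext l
  simp [shiftTuple_apply]

/-- The state of the transfer function realisation with colligation `V`. -/
noncomputable def state : (Fin n → PowerSeries ℂ) →ₗ[ℂ] K := stateIter L V (L + 1)

/-- The output of the transfer function realisation with colligation `V`. -/
noncomputable def transferOut : (Fin n → PowerSeries ℂ) →ₗ[ℂ] ℂ :=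
  hFst (K := K) ∘ₗ V ∘ₗ transferIn L (state L V)

lemma state_shift_eq_zero (y : Fin n → PowerSeries ℂ) (j : ℕ) (hj : L < j) :
    state L V (shiftTuple n j y) = 0 :=
  stateIter_shift_eq_zero L V y _ j hj

lemma state_eq (y : Fin n → PowerSeries ℂ) :
    state L V y = hSnd (V (transferIn L (state L V) y)) := by
  have := stateIter_succ_shift L V y (L + 1) 0 (by omega)
  rw [shiftTuple_zero] at this
  exact this.symm

lemma output_shift_eq_zero (y : Fin n → PowerSeries ℂ) (j : ℕ) (hj : L < j) :
    transferOut L V (shiftTuple n j y) = 0 := by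
  change hFst (V (transferIn L (state L V) _)) = 0
  rw [transferIn_eq_zero L hj (state_shift_eq_zero L V y), map_zero, map_zero]

lemma realisation_eq (y : Fin n → PowerSeries ℂ) :
    V (transferIn L (state L V) y) = WithLp.toLp 2 (transferOut L V y, state L V y) := by
  rw [state_eq]
  rfl

/-- The multiplier symbols read off from the output functional. -/
noncomputable def symbolOf (l : Fin n) : PowerSeries ℂ :=
  PowerSeries.mk fun s => transferOut L V (Pi.single l (X ^ (L - s)))

lemma output_eq (y : Fin n → PowerSeries ℂ) :
    transferOut L V y = coeff L (∑ l, symbolOf L V l * y l) := by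
  have h1 : ∀ (l : Fin n) (x : PowerSeries ℂ),
      transferOut L V (Pi.single l x) = coeff L (symbolOf L V l * x) := by
    intro l x
    have hx : x = ∑ j ∈ Finset.range (L + 1), coeff j x • X ^ j +
        X ^ (L + 1) * PowerSeries.mk fun i => coeff (i + (L + 1)) x := by
      ext m
      rw [map_add, map_sum, PowerSeries.coeff_X_pow_mul']
      simp only [map_smul, PowerSeries.coeff_X_pow, smul_eq_mul, mul_ite, mul_one, mul_zero,
        Finset.sum_ite_eq, Finset.mem_range, PowerSeries.coeff_mk]
      by_cases h : m < L + 1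
      · rw [if_pos h, if_neg (by omega), add_zero]
      · rw [if_neg h, if_pos (by omega), zero_add, Nat.sub_add_cancel (by omega)]
    have h2 : transferOut L V (Pi.single l (X ^ (L + 1) *
        PowerSeries.mk fun i => coeff (i + (L + 1)) x)) = 0 := by
      rw [← output_shift_eq_zero L V (Pi.single l (PowerSeries.mk fun i => coeff (i + (L + 1)) x))
        (L + 1) (by omega)]
      congr 1
      funext l'
      rw [shiftTuple_apply]
      by_cases h : l' = l
      · subst h; simp
      · simp [h]
    calc transferOut L V (Pi.single l x)
        = transferOut L V (LinearMap.single ℂ (fun _ : Fin n => PowerSeries ℂ) l x) := rfl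
      _ = ∑ j ∈ Finset.range (L + 1), coeff j x * transferOut L V (Pi.single l (X ^ j)) := by
          conv_lhs => rw [hx]
          rw [map_add, map_add, map_sum, map_sum]
          simp only [map_smul, LinearMap.coe_single, smul_eq_mul]
          rw [h2, add_zero]
      _ = coeff L (symbolOf L V l * x) := by
          rw [mul_comm, coeff_mul_range]
          refine Finset.sum_congr rfl fun j hj => ?_
          rw [symbolOf, PowerSeries.coeff_mk, Nat.sub_sub_self (Finset.mem_range_succ_iff.mp hj)]
  calc transferOut L V y = transferOut L V (∑ l, Pi.single l (y l)) := by rw [Finset.univ_sum_single]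
    _ = _ := by rw [map_sum, map_sum]; exact Finset.sum_congr rfl fun l _ => h1 l _

lemma symbol_energy (hV : ∀ y, ‖V y‖ ≤ ‖y‖) (y : Fin n → PowerSeries ℂ) (m : ℕ) :
    ∀ k, L < k + m → dualPart L (∑ l, symbolOf L V l * shiftTuple n k y l) +
      ‖state L V (shiftTuple n k y)‖ ^ 2 ≤ ∑ l, dualPart L (shiftTuple n k y l) := by
  have hsum : ∀ (t : ℕ) (y : Fin n → PowerSeries ℂ), X ^ t * ∑ l, symbolOf L V l * y l =
      ∑ l, symbolOf L V l * shiftTuple n t y l := by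
    intro t y
    rw [Finset.mul_sum]
    refine Finset.sum_congr rfl fun l _ => ?_
    rw [shiftTuple_apply]
    ring
  induction m with
  | zero =>
    intro k hk
    rw [state_shift_eq_zero L V y k hk, ← hsum, dualPart_X_pow_mul_of_lt L k hk]
    simpa using Finset.sum_nonneg fun l _ => dualPart_nonneg L _
  | succ m ih =>
    intro k hk
    set z := shiftTuple n k y with hz
    have h1 : ‖transferOut L V z‖ ^ 2 + ‖state L V z‖ ^ 2 ≤ ∑ l, ‖coeff L (z l)‖ ^ 2 +
        ∑ t ∈ Finset.range (L + 1), pickCoeff t * ‖state L V (shiftTuple n t z)‖ ^ 2 := by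
      rw [← norm_transferIn_sq]
      have := pow_le_pow_left₀ (norm_nonneg _) (hV (transferIn L (state L V) z)) 2
      rwa [realisation_eq, WithLp.prod_norm_sq_eq_of_L2] at this
    rw [dualPart_eq_add_sum, ← output_eq]
    simp only [hsum]
    have h2 : ∑ l, dualPart L (z l) = ∑ l, ‖coeff L (z l)‖ ^ 2 +
        ∑ t ∈ Finset.range (L + 1), pickCoeff t * ∑ l, dualPart L (shiftTuple n t z l) := by
      simp only [Finset.mul_sum]
      rw [Finset.sum_comm, ← Finset.sum_add_distrib]
      exact Finset.sum_congr rfl fun l _ => dualPart_eq_add_sum L (z l)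
    have h3 : ∑ t ∈ Finset.range (L + 1), pickCoeff t *
          dualPart L (∑ l, symbolOf L V l * shiftTuple n t z l) +
        ∑ t ∈ Finset.range (L + 1), pickCoeff t * ‖state L V (shiftTuple n t z)‖ ^ 2 ≤
        ∑ t ∈ Finset.range (L + 1), pickCoeff t * ∑ l, dualPart L (shiftTuple n t z l) := by
      rw [← Finset.sum_add_distrib]
      refine Finset.sum_le_sum fun t _ => ?_
      rcases Nat.eq_zero_or_pos t with rfl | ht
      · simp [pickCoeff_zero]
      · rw [← mul_add]
        refine mul_le_mul_of_nonneg_left ?_ (pickCoeff_nonneg t)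
        rw [hz, shiftTuple_shiftTuple]
        exact ih _ (by omega)
    linarith

end Transfer

lemma exists_symbols_level {n : ℕ} (L : ℕ) (f : Fin n → PowerSeries ℂ) (Φ : PowerSeries ℂ)
    (h : ∀ x, dualPart L (Φ * x) ≤ ∑ l, dualPart L (f l * x)) :
    ∃ g : Fin n → PowerSeries ℂ, (∀ s ≤ L, coeff s (∑ l, f l * g l) = coeff s Φ) ∧
      ∀ l, ∀ L' ≤ L, ∀ y, dualPart L' (g l * y) ≤ dualPart L' y := by
  let P : PowerSeries ℂ →ₗ[ℂ] PiLp 2 (fun _ : Fin n => EuclideanSpace ℂ (Fin (L + 1))) :=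
    hPi fun l => dualMap L ∘ₗ LinearMap.mulLeft ℂ (f l)
  have hP : ∀ x, ‖P x‖ ^ 2 = ∑ l, dualPart L (f l * x) := by
    intro x
    rw [norm_hPi_sq]
    exact Finset.sum_congr rfl fun l _ => norm_dualMap_sq L _
  let Q : PowerSeries ℂ →ₗ[ℂ] EuclideanSpace ℂ (Fin (L + 1)) :=
    dualMap L ∘ₗ LinearMap.mulLeft ℂ Φ
  have hQ : ∀ x, ‖Q x‖ ^ 2 = dualPart L (Φ * x) := fun x => norm_dualMap_sq L _
  obtain ⟨E, hE⟩ := exists_defect P Q fun v =>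
    le_of_sq_le_sq (by rw [hP, hQ]; exact h v) (norm_nonneg _)
  simp only [hP, hQ] at hE
  let tup : PowerSeries ℂ →ₗ[ℂ] (Fin n → PowerSeries ℂ) :=
    LinearMap.pi fun l => LinearMap.mulLeft ℂ (f l)
  let P' : PowerSeries ℂ →ₗ[ℂ] WithLp 2 (EuclideanSpace ℂ (Fin n) ×
      PiLp 2 (fun _ : Fin (L + 1) => PiLp 2 (fun _ : Fin n => EuclideanSpace ℂ (Fin (L + 1))))) :=
    hProd (hPi fun l => coeff L ∘ₗ LinearMap.mulLeft ℂ (f l))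
      (hPi fun t : Fin (L + 1) =>
        ((√(pickCoeff t) : ℝ) : ℂ) • (E ∘ₗ LinearMap.mulLeft ℂ (X ^ (t : ℕ))))
  let Q' := hProd (coeff L ∘ₗ LinearMap.mulLeft ℂ Φ) E
  have hPQ : ∀ x, ‖Q' x‖ ≤ ‖P' x‖ := by
    intro x
    refine le_of_sq_le_sq (le_of_eq ?_) (norm_nonneg _)
    rw [norm_hProd_sq, norm_hProd_sq, norm_hPi_sq, norm_hPi_sq]
    have h1 : ∀ t : Fin (L + 1), ‖(((√(pickCoeff t) : ℝ) : ℂ) •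
        (E ∘ₗ LinearMap.mulLeft ℂ (X ^ (t : ℕ)))) x‖ ^ 2 = pickCoeff t * ‖E (X ^ (t : ℕ) * x)‖ ^ 2 := by
      intro t
      rw [LinearMap.smul_apply, norm_smul, Complex.norm_real, mul_pow, Real.norm_eq_abs, sq_abs,
        Real.sq_sqrt (pickCoeff_nonneg _)]
      rfl
    simp only [h1, LinearMap.comp_apply, LinearMap.mulLeft_apply]
    rw [← Finset.sum_range fun t => pickCoeff t * ‖E (X ^ t * x)‖ ^ 2]
    have h2 := hE x
    rw [dualPart_eq_add_sum] at h2
    simp only [fun l => dualPart_eq_add_sum L (f l * x)] at h2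
    rw [Finset.sum_add_distrib, Finset.sum_comm] at h2
    simp only [← Finset.mul_sum] at h2
    have h3 : ∀ t, ∑ l, dualPart L (X ^ t * (f l * x)) =
        dualPart L (X ^ t * (Φ * x)) + ‖E (X ^ t * x)‖ ^ 2 := by
      intro t
      rw [mul_left_comm, ← hE]
      exact Finset.sum_congr rfl fun l _ => by rw [mul_left_comm]
    simp only [h3, mul_add, Finset.sum_add_distrib] at h2
    linarith
  obtain ⟨V₀, hV, hV1⟩ := exists_contraction P' Q' hPQ
  let V := V₀.toLinearMap
  replace hV : ∀ v, V (P' v) = Q' v := hV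
  replace hV1 : ∀ y, ‖V y‖ ≤ ‖y‖ := hV1
  have hmatch : ∀ (x : PowerSeries ℂ) (m k : ℕ), L < k + m →
      state L V (tup (X ^ k * x)) = E (X ^ k * x) ∧
      transferOut L V (tup (X ^ k * x)) = coeff L (Φ * (X ^ k * x)) := by
    intro x m
    have htup : ∀ k x, tup (X ^ k * x) = shiftTuple n k (tup x) := by
      intro k x
      funext l
      exact mul_left_comm _ _ _
    induction m with
    | zero =>
      intro k hk
      rw [htup, state_shift_eq_zero L V _ k hk, output_shift_eq_zero L V _ k hk]
      constructor
      · symm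
        rw [← norm_eq_zero, ← sq_eq_zero_iff]
        have := hE (X ^ k * x)
        rw [mul_left_comm, dualPart_X_pow_mul_of_lt L k hk] at this
        simp only [fun l => mul_left_comm (f l), dualPart_X_pow_mul_of_lt L k hk] at this
        simpa using this.symm
      · rw [mul_left_comm, PowerSeries.coeff_X_pow_mul', if_neg (by omega)]
    | succ m ih =>
      intro k hk
      have h1 : transferIn L (state L V) (tup (X ^ k * x)) = P' (X ^ k * x) := by
        have h2 : ∀ t : Fin (L + 1),
            ((√(pickCoeff t) : ℝ) : ℂ) • state L V (shiftTuple n t (tup (X ^ k * x))) =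
            ((√(pickCoeff t) : ℝ) : ℂ) • E (X ^ (t : ℕ) * (X ^ k * x)) := by
          intro t
          rcases Nat.eq_zero_or_pos (t : ℕ) with h0 | h0
          · rw [h0, pickCoeff_zero]; simp
          · rw [← htup, ← mul_assoc, ← pow_add, (ih _ (by omega)).1]
        simp only [P', transferIn, hProd_apply, hPi_apply, LinearMap.smul_apply,
          LinearMap.comp_apply, h2]
        rfl
      have h3 := realisation_eq L V (tup (X ^ k * x))
      rw [h1, hV] at h3
      have h4 := congrArg WithLp.ofLp h3
      exact ⟨(congrArg Prod.snd h4).symm, (congrArg Prod.fst h4).symm⟩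
  refine ⟨symbolOf L V, fun s hs => ?_, fun l L' hL' y => ?_⟩
  · have h1 := (hmatch 1 (L + 1) (L - s) (by omega)).2
    rw [output_eq, mul_one] at h1
    have h2 : ∑ l, symbolOf L V l * tup (X ^ (L - s)) l =
        X ^ (L - s) * ∑ l, f l * symbolOf L V l := by
      rw [Finset.mul_sum]
      refine Finset.sum_congr rfl fun l _ => ?_
      change _ * (f l * X ^ (L - s)) = _
      ring
    rw [h2, mul_comm Φ, PowerSeries.coeff_X_pow_mul', PowerSeries.coeff_X_pow_mul',
      if_pos (by omega), if_pos (by omega), Nat.sub_sub_self hs] at h1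
    exact h1
  · have h1 := symbol_energy L V hV1 (Pi.single l (X ^ (L - L') * y)) (L + 1) 0 (by omega)
    rw [shiftTuple_zero, Finset.sum_eq_single l, Finset.sum_eq_single l] at h1
    · rw [Pi.single_eq_same, mul_left_comm, dualPart_X_pow_mul _ _ (by omega),
        dualPart_X_pow_mul _ _ (by omega), Nat.sub_sub_self hL'] at h1
      have := sq_nonneg ‖state L V (Pi.single l (X ^ (L - L') * y))‖
      linarith
    · intro b _ hb
      simp [hb, dualPart]
    · simp
    · intro b _ hb
      simp [hb]
    · simp

end DirichletRadical

namespace DirichletRadical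

open PowerSeries

/-! ### Coefficientwise limits -/

/-- Coefficientwise convergence of power series along a filter. -/
def CoeffTendsto {ι : Type*} (u : ι → PowerSeries ℂ) (F : Filter ι) (a : PowerSeries ℂ) : Prop :=
  ∀ s, Filter.Tendsto (fun i => coeff s (u i)) F (nhds (coeff s a))

lemma CoeffTendsto.const {ι : Type*} {F : Filter ι} (a : PowerSeries ℂ) :
    CoeffTendsto (fun _ => a) F a := fun _ => tendsto_const_nhds

lemma CoeffTendsto.mul {ι : Type*} {u v : ι → PowerSeries ℂ} {F : Filter ι} {a b : PowerSeries ℂ}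
    (hu : CoeffTendsto u F a) (hv : CoeffTendsto v F b) :
    CoeffTendsto (fun i => u i * v i) F (a * b) := by
  intro s
  simp only [PowerSeries.coeff_mul]
  exact tendsto_finsetSum _ fun p _ => (hu p.1).mul (hv p.2)

lemma CoeffTendsto.pow {ι : Type*} {u : ι → PowerSeries ℂ} {F : Filter ι} {a : PowerSeries ℂ}
    (hu : CoeffTendsto u F a) (n : ℕ) : CoeffTendsto (fun i => u i ^ n) F (a ^ n) := by
  induction n with
  | zero => simpa using CoeffTendsto.const 1
  | succ n ih => simpa only [pow_succ] using ih.mul hu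

lemma CoeffTendsto.sum {ι κ : Type*} {u : κ → ι → PowerSeries ℂ} {F : Filter ι}
    {a : κ → PowerSeries ℂ} (S : Finset κ) (hu : ∀ k, CoeffTendsto (u k) F (a k)) :
    CoeffTendsto (fun i => ∑ k ∈ S, u k i) F (∑ k ∈ S, a k) := by
  intro s
  simp only [map_sum]
  exact tendsto_finsetSum _ fun k _ => hu k s

lemma CoeffTendsto.dualPart {ι : Type*} {u : ι → PowerSeries ℂ} {F : Filter ι}
    {a : PowerSeries ℂ} (hu : CoeffTendsto u F a) (L : ℕ) :
    Filter.Tendsto (fun i => dualPart L (u i)) F (nhds (dualPart L a)) :=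
  tendsto_finsetSum _ fun _ _ => ((hu _).norm.pow 2).div_const _

lemma CoeffTendsto.unique {ι : Type*} {u : ι → PowerSeries ℂ} {F : Filter ι} [F.NeBot]
    {a b : PowerSeries ℂ} (ha : CoeffTendsto u F a) (hb : CoeffTendsto u F b) : a = b :=
  PowerSeries.ext fun s => tendsto_nhds_unique (ha s) (hb s)

lemma dualPart_C_mul (L : ℕ) (c : ℂ) (x : PowerSeries ℂ) :
    dualPart L (PowerSeries.C c * x) = ‖c‖ ^ 2 * dualPart L x := by
  rw [dualPart, dualPart, Finset.mul_sum]
  refine Finset.sum_congr rfl fun i _ => ?_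
  rw [PowerSeries.coeff_C_mul, norm_mul]
  ring

lemma dualPart_one_le (L : ℕ) : dualPart L 1 ≤ 1 := by
  rw [dualPart, Finset.sum_eq_single L]
  · simp only [Nat.sub_self, PowerSeries.coeff_zero_one, norm_one, one_pow]
    rw [div_le_one (by positivity)]
    linarith [(Nat.cast_nonneg L : (0 : ℝ) ≤ L)]
  · intro i hi hne
    have : L - i ≠ 0 := by
      have := Finset.mem_range_succ_iff.mp hi
      omega
    simp [PowerSeries.coeff_one, this]
  · simp

lemma norm_coeff_sq_le_dualPart (L : ℕ) (x : PowerSeries ℂ) : ‖coeff L x‖ ^ 2 ≤ dualPart L x := by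
  have := Finset.single_le_sum (f := fun i : ℕ => ‖coeff (L - i) x‖ ^ 2 / ((i : ℝ) + 1))
    (fun _ _ => by positivity) (Finset.mem_range.mpr L.succ_pos)
  simpa [dualPart] using this

/-- The Toeplitz corona theorem for the Dirichlet space. -/
theorem exists_symbols {n : ℕ} (f : Fin n → PowerSeries ℂ) (Φ : PowerSeries ℂ)
    (h : ∀ L x, dualPart L (Φ * x) ≤ ∑ l, dualPart L (f l * x)) :
    ∃ g : Fin n → PowerSeries ℂ, ∑ l, f l * g l = Φ ∧ ∀ l, MulBd (g l) 1 := by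
  choose g hg hg1 using fun L => exists_symbols_level L f Φ (h L)
  have hbd : ∀ l s L, s ≤ L → coeff s (g L l) ∈ closedBall (0 : ℂ) 1 := by
    intro l s L hs
    rw [mem_closedBall_zero_iff, ← abs_norm, ← sq_le_one_iff_abs_le_one]
    have := hg1 L l s hs 1
    rw [mul_one] at this
    exact (norm_coeff_sq_le_dualPart s _).trans (this.trans (dualPart_one_le s))
  have hge : ∀ s : ℕ, ∀ᶠ L in (Filter.hyperfilter ℕ : Filter ℕ), s ≤ L := fun s =>
    Nat.hyperfilter_le_atTop (Filter.eventually_ge_atTop s)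
  have hlim : ∀ l s, ∃ c : ℂ, Filter.Tendsto (fun L => coeff s (g L l))
      (Filter.hyperfilter ℕ : Filter ℕ) (nhds c) := by
    intro l s
    obtain ⟨c, -, hc⟩ := (isCompact_closedBall (0 : ℂ) 1).ultrafilter_le_nhds
      ((Filter.hyperfilter ℕ).map fun L => coeff s (g L l))
      (Filter.tendsto_principal.mpr ((hge s).mono fun L hL => hbd l s L hL))
    exact ⟨c, hc⟩
  choose c hc using hlim
  have hG : ∀ l, CoeffTendsto (fun L => g L l) (Filter.hyperfilter ℕ : Filter ℕ)
      (PowerSeries.mk (c l)) := fun l s => by simpa using hc l s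
  refine ⟨fun l => PowerSeries.mk (c l), ?_, fun l => ?_⟩
  · refine (CoeffTendsto.sum Finset.univ fun l => (CoeffTendsto.const (f l)).mul (hG l)).unique ?_
    intro s
    refine tendsto_const_nhds.congr' ?_
    filter_upwards [hge s] with L hL using (hg L s hL).symm
  · refine mulBd_of_dual_le zero_le_one fun L x => ?_
    rw [one_mul]
    refine Real.sqrt_le_sqrt (le_of_tendsto (((hG l).mul (CoeffTendsto.const x)).dualPart L) ?_)
    filter_upwards [hge L] with N hN using hg1 N l L hN x

lemma exists_symbols_of_const {n : ℕ} (f : Fin n → PowerSeries ℂ) (Φ : PowerSeries ℂ) (c : ℝ)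
    (h : ∀ L x, dualPart L (Φ * x) ≤ c ^ 2 * ∑ l, dualPart L (f l * x)) :
    ∃ g : Fin n → PowerSeries ℂ, ∑ l, f l * g l = Φ ∧ ∀ l, ∃ M, MulBd (g l) M := by
  obtain ⟨g, hg, hg1⟩ := exists_symbols (fun l => PowerSeries.C (c : ℂ) * f l) Φ fun L x => by
    refine (h L x).trans_eq ?_
    rw [Finset.mul_sum]
    refine Finset.sum_congr rfl fun l _ => ?_
    rw [mul_assoc, dualPart_C_mul, Complex.norm_real, Real.norm_eq_abs, sq_abs]
  refine ⟨fun l => PowerSeries.C (c : ℂ) * g l, ?_, fun l => ⟨_, (mulBd_C _).mul (hg1 l)⟩⟩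
  rw [← hg]
  exact Finset.sum_congr rfl fun l _ => by ring

end DirichletRadical

namespace DirichletRadical

open PowerSeries

/-! ### Schur multipliers and polynomial approximation -/

/-- Coefficientwise multiplication of a power series by a real sequence. -/
noncomputable def hadamard (c : ℕ → ℝ) (a : PowerSeries ℂ) : PowerSeries ℂ :=
  PowerSeries.mk fun k => (c k : ℂ) * coeff k a

lemma coeff_hadamard (c : ℕ → ℝ) (a : PowerSeries ℂ) (k : ℕ) :
    coeff k (hadamard c a) = (c k : ℂ) * coeff k a := by
  rw [hadamard, PowerSeries.coeff_mk]

lemma sum_dirPart_hadamard {L N : ℕ} (v : ℕ → ℕ → ℝ)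
    (hv : ∀ i ≤ L, ∑ s ∈ Finset.range N, v i s * v i s = 1) (h : PowerSeries ℂ) :
    ∑ s ∈ Finset.range N, dirPart L (hadamard (fun i => v i s) h) = dirPart L h := by
  simp only [dirPart, coeff_hadamard]
  rw [Finset.sum_comm]
  refine Finset.sum_congr rfl fun i hi => ?_
  rw [← mul_one (_ * ‖coeff i h‖ ^ 2), ← hv i (Finset.mem_range_succ_iff.mp hi), Finset.mul_sum]
  refine Finset.sum_congr rfl fun s _ => ?_
  rw [norm_mul, Complex.norm_real, mul_pow, Real.norm_eq_abs, sq_abs]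
  ring

lemma sum_dualPart_hadamard {L N : ℕ} (v : ℕ → ℕ → ℝ)
    (hv : ∀ i ≤ L, ∑ s ∈ Finset.range N, v i s * v i s = 1) (x : PowerSeries ℂ) :
    ∑ s ∈ Finset.range N, dualPart L (hadamard (fun j => v (L - j) s) x) = dualPart L x := by
  simp only [dualPart, coeff_hadamard]
  rw [Finset.sum_comm]
  refine Finset.sum_congr rfl fun i hi => ?_
  have hi' := Finset.mem_range_succ_iff.mp hi
  rw [← mul_one (‖coeff (L - i) x‖ ^ 2 / _), ← hv i hi', Finset.mul_sum]
  refine Finset.sum_congr rfl fun s _ => ?_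
  rw [norm_mul, Complex.norm_real, mul_pow, Real.norm_eq_abs, sq_abs, Nat.sub_sub_self hi']
  ring

lemma coeff_hadamard_mul_mul {L N : ℕ} (c : ℕ → ℝ) (v : ℕ → ℕ → ℝ)
    (hv : ∀ i k, i + k ≤ L → ∑ s ∈ Finset.range N, v i s * v (i + k) s = c k)
    (a h x : PowerSeries ℂ) :
    coeff L (hadamard c a * h * x) = ∑ s ∈ Finset.range N,
      coeff L (a * hadamard (fun i => v i s) h * hadamard (fun j => v (L - j) s) x) := by
  simp only [PowerSeries.coeff_mul, coeff_hadamard, Finset.sum_mul]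
  rw [Finset.sum_comm]
  refine Finset.sum_congr rfl fun p hp => ?_
  rw [Finset.sum_comm]
  refine Finset.sum_congr rfl fun q hq => ?_
  have h1 := Finset.HasAntidiagonal.mem_antidiagonal.mp hp
  have h2 := Finset.HasAntidiagonal.mem_antidiagonal.mp hq
  have h3 : L - p.2 = q.2 + q.1 := by omega
  rw [← hv q.2 q.1 (by omega), h3]
  push_cast
  rw [Finset.sum_mul, Finset.sum_mul, Finset.sum_mul]
  refine Finset.sum_congr rfl fun s _ => ?_
  ring

lemma MulBd.hadamard {a : PowerSeries ℂ} {M : ℝ} (ha : MulBd a M) (c : ℕ → ℝ) (hc : c 0 = 1)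
    (hv : ∀ L, ∃ (N : ℕ) (v : ℕ → ℕ → ℝ), ∀ i k, i + k ≤ L →
      ∑ s ∈ Finset.range N, v i s * v (i + k) s = c k) : MulBd (hadamard c a) M := by
  refine ⟨ha.1, fun L h x => ?_⟩
  obtain ⟨N, v, hv⟩ := hv L
  have hv1 : ∀ i ≤ L, ∑ s ∈ Finset.range N, v i s * v i s = 1 := fun i hi => by
    simpa [hc] using hv i 0 (by omega)
  rw [coeff_hadamard_mul_mul c v hv]
  calc _ ≤ ∑ s ∈ Finset.range N, M * (√(dirPart L (DirichletRadical.hadamard (fun i => v i s) h)) *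
        √(dualPart L (DirichletRadical.hadamard (fun j => v (L - j) s) x))) :=
      norm_sum_le_of_le _ fun s _ => ha.2 L _ _
    _ ≤ M * (√(dirPart L h) * √(dualPart L x)) := by
      rw [← Finset.mul_sum]
      refine mul_le_mul_of_nonneg_left ?_ ha.1
      rw [← sum_dirPart_hadamard v hv1 h, ← sum_dualPart_hadamard v hv1 x]
      exact Real.sum_sqrt_mul_sqrt_le _ (fun _ => dirPart_nonneg _ _) fun _ => dualPart_nonneg _ _

lemma MulBd.hadamard_pow {a : PowerSeries ℂ} {M : ℝ} (ha : MulBd a M) {r : ℝ}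
    (hr0 : 0 ≤ r) (hr1 : r ≤ 1) : MulBd (DirichletRadical.hadamard (fun k => r ^ k) a) M := by
  refine ha.hadamard _ (pow_zero r) fun L => ⟨L + 1, fun i s =>
    if s = 0 then r ^ i else if s ≤ i then √(1 - r ^ 2) * r ^ (i - s) else 0, fun i k hik => ?_⟩
  rw [Finset.sum_range_succ']
  simp only [Nat.add_eq_zero_iff, one_ne_zero, and_false, if_false, if_true]
  have hsq : √(1 - r ^ 2) * √(1 - r ^ 2) = 1 - r ^ 2 := Real.mul_self_sqrt (by nlinarith)
  have h1 : ∑ s ∈ Finset.range L, (if s + 1 ≤ i then √(1 - r ^ 2) * r ^ (i - (s + 1)) else 0) *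
      (if s + 1 ≤ i + k then √(1 - r ^ 2) * r ^ (i + k - (s + 1)) else 0) =
      ∑ s ∈ Finset.range i, (1 - r ^ 2) * r ^ k * (r ^ 2) ^ (i - 1 - s) := by
    symm
    refine Finset.sum_subset_zero_on_sdiff (Finset.range_subset_range.mpr (by omega))
      (fun s hs => ?_) (fun s hs => ?_)
    · simp only [Finset.mem_sdiff, Finset.mem_range] at hs
      rw [if_neg (by omega), zero_mul]
    · simp only [Finset.mem_range] at hs
      rw [if_pos (by omega), if_pos (by omega)]
      have e1 : i - (s + 1) = i - 1 - s := by omega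
      have e2 : i + k - (s + 1) = (i - 1 - s) + k := by omega
      rw [e1, e2, mul_mul_mul_comm, hsq]
      ring
  rw [h1, ← Finset.mul_sum, Finset.sum_range_reflect (fun s => (r ^ 2) ^ s) i, mul_right_comm,
    mul_neg_geom_sum]
  ring

lemma MulBd.hadamard_fejer {a : PowerSeries ℂ} {M : ℝ} (ha : MulBd a M) (K : ℕ) :
    MulBd (DirichletRadical.hadamard (fun k => ((K + 1 - k : ℕ) : ℝ) / (K + 1)) a) M := by
  have hK : (K : ℝ) + 1 ≠ 0 := by positivity
  refine ha.hadamard _ (by simp [hK]) fun L => ⟨L + K + 1, fun i s =>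
    if s ∈ Finset.Icc i (i + K) then (√((K : ℝ) + 1))⁻¹ else 0, fun i k hik => ?_⟩
  have h1 : ∀ s ∈ Finset.range (L + K + 1), (if s ∈ Finset.Icc i (i + K) then
      (√((K : ℝ) + 1))⁻¹ else 0) *
      (if s ∈ Finset.Icc (i + k) (i + k + K) then (√((K : ℝ) + 1))⁻¹ else 0) =
      if s ∈ Finset.Icc (i + k) (i + K) then ((K : ℝ) + 1)⁻¹ else 0 := by
    intro s _
    simp only [Finset.mem_Icc]
    split_ifs <;> first
      | omega
      | simp
      | rw [← mul_inv, Real.mul_self_sqrt (by positivity)]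
  rw [Finset.sum_congr rfl h1, ← Finset.sum_filter, Finset.sum_const, nsmul_eq_mul, div_eq_mul_inv]
  congr 2
  rw [Finset.filter_mem_eq_inter, Finset.inter_eq_right.mpr, Nat.card_Icc]
  · omega
  · intro s
    simp only [Finset.mem_Icc, Finset.mem_range]
    omega

/-- Fejér means of the dilation by `r` of a power series. -/
noncomputable def approx (r : ℝ) (K : ℕ) (a : PowerSeries ℂ) : Polynomial ℂ :=
  PowerSeries.trunc (K + 1)
    (hadamard (fun k => ((K + 1 - k : ℕ) : ℝ) / (K + 1)) (hadamard (fun k => r ^ k) a))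

lemma coeff_approx (r : ℝ) (K : ℕ) (a : PowerSeries ℂ) (k : ℕ) :
    (approx r K a).coeff k = (((K + 1 - k : ℕ) : ℝ) / (K + 1) : ℝ) * ((r ^ k : ℝ) * coeff k a) := by
  rw [approx, PowerSeries.coeff_trunc, coeff_hadamard, coeff_hadamard]
  split_ifs with h
  · rfl
  · have : K + 1 - k = 0 := by omega
    simp [this]

lemma coe_approx (r : ℝ) (K : ℕ) (a : PowerSeries ℂ) : (approx r K a : PowerSeries ℂ) =
    hadamard (fun k => ((K + 1 - k : ℕ) : ℝ) / (K + 1)) (hadamard (fun k => r ^ k) a) := by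
  ext k
  rw [Polynomial.coeff_coe, coeff_approx, coeff_hadamard, coeff_hadamard]

lemma MulBd.approx {a : PowerSeries ℂ} {M : ℝ} (ha : MulBd a M) {r : ℝ}
    (hr0 : 0 ≤ r) (hr1 : r ≤ 1) (K : ℕ) : MulBd (approx r K a : PowerSeries ℂ) M := by
  rw [coe_approx]
  exact (ha.hadamard_pow hr0 hr1).hadamard_fejer K

lemma norm_eval_approx_sub_val_le {a : PowerSeries ℂ} {M : ℝ} (ha : MulBd a M) {r : ℝ}
    (hr0 : 0 ≤ r) (hr1 : r < 1) (K : ℕ) {z : ℂ} (hz : ‖z‖ ≤ 1) :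
    ‖(approx r K a).eval z - val a (r * z)‖ ≤ M * (∑' k : ℕ, (k : ℝ) * r ^ k) / (K + 1) := by
  have hrz : ‖(r : ℂ) * z‖ < 1 := by
    rw [norm_mul, Complex.norm_real, Real.norm_of_nonneg hr0]
    nlinarith [norm_nonneg z]
  have hs1 : Summable fun k : ℕ => (approx r K a).coeff k * z ^ k :=
    summable_of_hasFiniteSupport (((approx r K a).support.finite_toSet).subset fun k hk => by
      simp only [Function.mem_support, ne_eq, mul_eq_zero, not_or] at hk
      simpa using hk.1)
  have h1 : (approx r K a).eval z = ∑' k, (approx r K a).coeff k * z ^ k := by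
    rw [Polynomial.eval_eq_sum, Polynomial.sum, tsum_eq_sum]
    intro k hk
    rw [Polynomial.notMem_support_iff.mp hk, zero_mul]
  have hs3 : Summable fun k : ℕ => (k : ℝ) * r ^ k := by
    simpa using summable_pow_mul_geometric_of_norm_lt_one 1 (r := r)
      (by rwa [Real.norm_of_nonneg hr0])
  rw [h1, val, ← hs1.tsum_sub (ha.summable hrz).of_norm, mul_div_right_comm, ← tsum_mul_left]
  refine tsum_of_norm_bounded (hs3.mul_left _).hasSum fun k => ?_
  have hK : (0 : ℝ) < (K : ℝ) + 1 := by positivity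
  have h2 : (approx r K a).coeff k * z ^ k - coeff k a * (r * z) ^ k =
      ((((K + 1 - k : ℕ) : ℝ) / (K + 1) - 1 : ℝ) : ℂ) * ((r ^ k : ℝ) : ℂ) * coeff k a * z ^ k := by
    rw [coeff_approx]
    push_cast
    ring
  have h3 : |((K + 1 - k : ℕ) : ℝ) / (K + 1) - 1| ≤ k / (K + 1) := by
    have h4 : (K : ℝ) + 1 - k ≤ ((K + 1 - k : ℕ) : ℝ) := by
      have : K + 1 ≤ (K + 1 - k) + k := by omega
      have : (K : ℝ) + 1 ≤ ((K + 1 - k : ℕ) : ℝ) + k := by exact_mod_cast this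
      linarith
    have h5 : ((K + 1 - k : ℕ) : ℝ) ≤ (K : ℝ) + 1 := by exact_mod_cast Nat.sub_le _ _
    rw [abs_le]
    constructor
    · rw [neg_le_sub_iff_le_add, ← add_div, le_div_iff₀ hK]
      linarith
    · rw [sub_le_iff_le_add, div_le_iff₀ hK]
      have : (0 : ℝ) ≤ k / (K + 1) := by positivity
      nlinarith
  rw [h2, norm_mul, norm_mul, norm_mul, Complex.norm_real, Complex.norm_real, Real.norm_eq_abs,
    Real.norm_of_nonneg (pow_nonneg hr0 k), norm_pow]
  calc _ ≤ (k : ℝ) / (K + 1) * r ^ k * M * 1 := by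
        have : 0 ≤ M := ha.1
        gcongr
        · exact ha.norm_coeff_le k
        · exact pow_le_one₀ (norm_nonneg z) hz
    _ = _ := by ring

end DirichletRadical

namespace DirichletRadical

/-! ### Polynomials in `z` and its conjugate on the unit disc -/

/-- Polynomials in two variables, standing for `z` and its conjugate. -/
abbrev BiPoly : Type := MvPolynomial (Fin 2) ℂ

/-- The variable `z`. -/
noncomputable abbrev bz : BiPoly := MvPolynomial.X 0

/-- The variable standing for the conjugate of `z`. -/
noncomputable abbrev bw : BiPoly := MvPolynomial.X 1

/-- The Wirtinger derivative `∂`. -/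
noncomputable abbrev dz : Derivation ℂ BiPoly BiPoly := MvPolynomial.pderiv 0

/-- The Wirtinger derivative `∂̄`. -/
noncomputable abbrev dw : Derivation ℂ BiPoly BiPoly := MvPolynomial.pderiv 1

/-- Formal complex conjugation. -/
noncomputable def cj : BiPoly →+* BiPoly :=
  MvPolynomial.eval₂Hom (MvPolynomial.C.comp (starRingEnd ℂ)) ![bw, bz]

/-- The holomorphic polynomial attached to a one-variable polynomial. -/
noncomputable def hol : Polynomial ℂ →ₐ[ℂ] BiPoly := Polynomial.aeval bz

/-- The defining function `1 - |z|²` of the disc. -/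
noncomputable def rho : BiPoly := 1 - bz * bw

@[simp] lemma cj_bz : cj bz = bw := by simp [cj]

@[simp] lemma cj_bw : cj bw = bz := by simp [cj]

@[simp] lemma cj_C (c : ℂ) : cj (MvPolynomial.C c) = MvPolynomial.C (starRingEnd ℂ c) := by
  simp [cj]

@[simp] lemma cj_cj (p : BiPoly) : cj (cj p) = p := by
  induction p using MvPolynomial.induction_on with
  | C a => simp
  | add p q hp hq => simp [hp, hq]
  | mul_X p i hp =>
    rw [map_mul, map_mul, hp]
    fin_cases i
    · exact congrArg (p * ·) (by simp)
    · exact congrArg (p * ·) (by simp)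

@[simp] lemma cj_rho : cj rho = rho := by
  simp [rho, mul_comm]

lemma dz_cj (p : BiPoly) : dz (cj p) = cj (dw p) := by
  induction p using MvPolynomial.induction_on with
  | C a => simp
  | add p q hp hq => simp [hp, hq]
  | mul_X p i hp =>
    rw [map_mul, Derivation.leibniz, hp]
    fin_cases i
    · simp [MvPolynomial.pderiv_X, mul_comm]
    · simp [MvPolynomial.pderiv_X, mul_comm]

lemma dw_cj (p : BiPoly) : dw (cj p) = cj (dz p) := by
  rw [← cj_cj (dw (cj p)), ← dz_cj, cj_cj]

lemma dz_dw (p : BiPoly) : dz (dw p) = dw (dz p) := by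
  induction p using MvPolynomial.induction_on with
  | C a => simp
  | add p q hp hq => simp [hp, hq]
  | mul_X p i hp =>
    fin_cases i
    · simp [MvPolynomial.pderiv_X, hp, add_comm]
    · simp [MvPolynomial.pderiv_X, hp, add_comm]

lemma dw_hol (p : Polynomial ℂ) : dw (hol p) = 0 := by
  rw [hol, Derivation.map_aeval]
  simp

lemma dz_hol (p : Polynomial ℂ) : dz (hol p) = hol (Polynomial.derivative p) := by
  rw [hol, Derivation.map_aeval]
  simp

lemma dz_cj_hol (p : Polynomial ℂ) : dz (cj (hol p)) = 0 := by
  rw [dz_cj, dw_hol, map_zero]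

lemma dw_cj_hol (p : Polynomial ℂ) :
    dw (cj (hol p)) = cj (hol (Polynomial.derivative p)) := by
  rw [dw_cj, dz_hol]

lemma dw_rho : dw rho = -bz := by
  simp [rho, MvPolynomial.pderiv_X]

lemma BiPoly.induction {P : BiPoly → Prop} (p : BiPoly)
    (hadd : ∀ p q, P p → P q → P (p + q))
    (hmono : ∀ (c : ℂ) (a b : ℕ), P (MvPolynomial.C c * (bz ^ a * bw ^ b))) : P p := by
  induction p using MvPolynomial.induction_on' with
  | add p q hp hq => exact hadd p q hp hq
  | monomial m c =>
    have := hmono c (m 0) (m 1)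
    rwa [← Fin.prod_univ_two (fun i => (MvPolynomial.X i : BiPoly) ^ m i),
      ← Finsupp.prod_fintype m (fun i k => (MvPolynomial.X i : BiPoly) ^ k) (by simp),
      ← MvPolynomial.monomial_eq] at this

lemma exists_hol_of_dw_eq_zero (p : BiPoly) (hp : dw p = 0) : ∃ g, hol g = p := by
  have key : ∀ p : BiPoly, ∃ g q, p = hol g + bw * q ∧ (dw p = 0 → q = 0) := by
    intro p
    have h1 : ∃ g q, p = hol g + bw * q := by
      induction p using BiPoly.induction with
      | hadd p q hp hq =>
        obtain ⟨g, r, rfl⟩ := hp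
        obtain ⟨g', r', rfl⟩ := hq
        exact ⟨g + g', r + r', by rw [map_add]; ring⟩
      | hmono c a b =>
        rcases b with _ | b
        · exact ⟨Polynomial.C c * Polynomial.X ^ a, 0, by simp [hol, MvPolynomial.algebraMap_eq]⟩
        · exact ⟨0, MvPolynomial.C c * (bz ^ a * bw ^ b), by rw [map_zero]; ring⟩
    obtain ⟨g, q, h⟩ := h1
    refine ⟨g, q, h, fun h0 => ?_⟩
    rw [h, map_add, dw_hol, zero_add] at h0
    ext m
    have h2 := congrArg (MvPolynomial.coeff m) h0
    rw [MvPolynomial.coeff_pderiv, add_comm, MvPolynomial.coeff_X_mul] at h2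
    have h3 : ((m 1 : ℂ) + 1) ≠ 0 := by exact_mod_cast Nat.succ_ne_zero (m 1)
    simpa [h3] using h2
  obtain ⟨g, q, h, hq⟩ := key p
  exact ⟨g, by rw [h, hq hp, mul_zero, add_zero]⟩

/-- Solving the `∂̄` equation for polynomial data. -/
lemma exists_dbar_solution (u : BiPoly) : ∃ (v : BiPoly) (A : Polynomial ℂ),
    A.coeff 0 = 0 ∧ dw (rho * v) + cj (hol (Polynomial.derivative A)) = u := by
  induction u using BiPoly.induction with
  | hadd p q hp hq =>
    obtain ⟨v, A, hA, rfl⟩ := hp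
    obtain ⟨v', A', hA', rfl⟩ := hq
    refine ⟨v + v', A + A', by simp [hA, hA'], ?_⟩
    rw [mul_add]
    simp only [map_add]
    ring
  | hmono c a b =>
    have hb : ((b : ℂ) + 1) ≠ 0 := by exact_mod_cast Nat.succ_ne_zero b
    have hgeom : ∀ k : ℕ, rho * -(∑ i ∈ Finset.range k, (bz * bw) ^ i) = (bz * bw) ^ k - 1 := by
      intro k
      have := mul_neg_geom_sum (bz * bw) k
      rw [rho, mul_neg, this]
      ring
    have hc : MvPolynomial.C (c / ((b : ℂ) + 1)) * ((b : BiPoly) + 1) = MvPolynomial.C c := by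
      have : ((b : BiPoly) + 1) = MvPolynomial.C ((b : ℂ) + 1) := by simp
      rw [this, ← map_mul, div_mul_cancel₀ _ hb]
    by_cases h : b + 1 ≤ a
    · obtain ⟨d, rfl⟩ := Nat.exists_eq_add_of_le' h
      refine ⟨MvPolynomial.C (c / ((b : ℂ) + 1)) * bz ^ d *
        -(∑ i ∈ Finset.range (b + 1), (bz * bw) ^ i), 0, by simp, ?_⟩
      rw [mul_left_comm, hgeom]
      have : MvPolynomial.C (c / ((b : ℂ) + 1)) * bz ^ d * ((bz * bw) ^ (b + 1) - 1) =
          MvPolynomial.C (c / ((b : ℂ) + 1)) * (bz ^ (d + (b + 1)) * bw ^ (b + 1) - bz ^ d) := by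
        ring
      rw [this, MvPolynomial.pderiv_C_mul, map_sub, Derivation.leibniz, MvPolynomial.pderiv_pow]
      simp
      rw [← hc]
      ring
    · obtain ⟨d, rfl⟩ := Nat.exists_eq_add_of_le (by omega : a ≤ b)
      refine ⟨MvPolynomial.C (c / (((a + d : ℕ) : ℂ) + 1)) * bw ^ (d + 1) *
        -(∑ i ∈ Finset.range a, (bz * bw) ^ i),
        Polynomial.C (starRingEnd ℂ (c / (((a + d : ℕ) : ℂ) + 1))) * Polynomial.X ^ (d + 1),
        by simp, ?_⟩
      rw [mul_left_comm, hgeom, ← dw_cj_hol, ← map_add dw]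
      have : MvPolynomial.C (c / (((a + d : ℕ) : ℂ) + 1)) * bw ^ (d + 1) * ((bz * bw) ^ a - 1) +
          cj (hol (Polynomial.C (starRingEnd ℂ (c / (((a + d : ℕ) : ℂ) + 1))) *
            Polynomial.X ^ (d + 1))) =
          MvPolynomial.C (c / (((a + d : ℕ) : ℂ) + 1)) * (bz ^ a * bw ^ (a + d + 1)) := by
        rw [hol, map_mul, map_pow, Polynomial.aeval_X, Polynomial.aeval_C,
          MvPolynomial.algebraMap_eq, map_mul, map_pow, cj_bz, cj_C, Complex.conj_conj]
        ring
      rw [this, MvPolynomial.pderiv_C_mul, Derivation.leibniz, MvPolynomial.pderiv_pow,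
        MvPolynomial.pderiv_pow]
      rw [← hc]
      simp
      ring

end DirichletRadical

namespace DirichletRadical

/-! ### The Bergman space norm of polynomials in `z` and its conjugate -/

/-- Polar coordinates `(|z|², arg z)` on the closed disc. -/
abbrev Polar : Type := unitInterval × UnitAddCircle

/-- Normalised area measure in polar coordinates. -/
noncomputable abbrev area : Measure Polar :=
  (volume : Measure unitInterval).prod AddCircle.haarAddCircle

/-- The point of the disc with given polar coordinates. -/
noncomputable def polarPt : C(Polar, ℂ) where
  toFun ω := (Real.sqrt ω.1 : ℂ) * fourier 1 ω.2
  continuous_toFun := by fun_prop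

/-- Evaluation of a polynomial in `z` and its conjugate. -/
noncomputable def bev (z : ℂ) : BiPoly →ₐ[ℂ] ℂ := MvPolynomial.aeval ![z, starRingEnd ℂ z]

/-- Polynomials in `z` and its conjugate as continuous functions on the disc. -/
noncomputable def evC : BiPoly →ₐ[ℂ] C(Polar, ℂ) := MvPolynomial.aeval ![polarPt, star polarPt]

@[simp] lemma bev_bz (z : ℂ) : bev z bz = z := by simp [bev]

@[simp] lemma bev_bw (z : ℂ) : bev z bw = starRingEnd ℂ z := by simp [bev]

@[simp] lemma bev_cj (z : ℂ) (p : BiPoly) : bev z (cj p) = starRingEnd ℂ (bev z p) := by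
  induction p using MvPolynomial.induction_on with
  | C a => simp
  | add p q hp hq => simp [hp, hq]
  | mul_X p i hp =>
    rw [map_mul, map_mul, hp, map_mul, map_mul]
    congr 1
    fin_cases i
    · simp
    · simp

@[simp] lemma bev_hol (z : ℂ) (f : Polynomial ℂ) : bev z (hol f) = f.eval z := by
  rw [hol, ← Polynomial.aeval_algHom_apply, bev_bz, Polynomial.coe_aeval_eq_eval]

lemma bev_rho (z : ℂ) : bev z rho = ((1 - ‖z‖ ^ 2 : ℝ) : ℂ) := by
  simp [rho, Complex.mul_conj, Complex.normSq_eq_norm_sq]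

lemma norm_polarPt_le (ω : Polar) : ‖polarPt ω‖ ≤ 1 := by
  have h1 : ‖polarPt ω‖ = Real.sqrt ω.1 := by
    simp only [polarPt, ContinuousMap.coe_mk, norm_mul, Complex.norm_real,
      Real.norm_of_nonneg (Real.sqrt_nonneg _), fourier_apply, Circle.norm_coe, mul_one]
  rw [h1]
  exact Real.sqrt_le_one.mpr ω.1.2.2

lemma evC_apply (p : BiPoly) (ω : Polar) : evC p ω = bev (polarPt ω) p := by
  induction p using MvPolynomial.induction_on with
  | C a => simp [evC]
  | add p q hp hq => simp [hp, hq]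
  | mul_X p i hp =>
    rw [map_mul, ContinuousMap.mul_apply, hp, map_mul]
    congr 1
    fin_cases i
    · simp [evC]
    · simp [evC]

lemma integrable_continuous (F : C(Polar, ℂ)) : Integrable (fun ω => F ω) area :=
  (BoundedContinuousFunction.mkOfCompact F).integrable area

/-- Integration of a polynomial over the disc. -/
noncomputable def mean : BiPoly →ₗ[ℂ] ℂ where
  toFun p := ∫ ω, evC p ω ∂area
  map_add' p q := by
    simp only [map_add, ContinuousMap.add_apply]
    exact integral_add (integrable_continuous _) (integrable_continuous _)
  map_smul' c p := by
    simp only [map_smul, ContinuousMap.smul_apply]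
    exact integral_smul c _

lemma mean_cj (p : BiPoly) : mean (cj p) = starRingEnd ℂ (mean p) := by
  change ∫ ω, evC (cj p) ω ∂area = starRingEnd ℂ (∫ ω, evC p ω ∂area)
  rw [← integral_conj]
  simp only [evC_apply, bev_cj]

lemma integral_fourier_eq (n : ℤ) :
    ∫ θ : UnitAddCircle, fourier n θ ∂AddCircle.haarAddCircle = if n = 0 then 1 else 0 := by
  split_ifs with h
  · simp [h]
  · exact integral_eq_zero_of_add_right_eq_neg (μ := AddCircle.haarAddCircle)
      (fourier_add_half_inv_index h one_pos)

lemma mean_monomial (c : ℂ) (a b : ℕ) :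
    mean (MvPolynomial.C c * (bz ^ a * bw ^ b)) = if a = b then c / ((a : ℂ) + 1) else 0 := by
  have h1 : ∀ ω : Polar, evC (MvPolynomial.C c * (bz ^ a * bw ^ b)) ω =
      (c * ((Real.sqrt ω.1 ^ (a + b) : ℝ) : ℂ)) * fourier ((a : ℤ) - b) ω.2 := by
    intro ω
    rw [evC_apply]
    have hf : ∀ (k : ℕ), (fourier 1 ω.2 : ℂ) ^ k = fourier (k : ℤ) ω.2 := by
      intro k
      simp [fourier_apply, AddCircle.toCircle_nsmul]
    rw [sub_eq_add_neg, fourier_add, fourier_neg, ← hf, ← hf]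
    simp [polarPt, pow_add]
    ring
  change ∫ ω, evC (MvPolynomial.C c * (bz ^ a * bw ^ b)) ω ∂area = _
  simp_rw [h1]
  rw [integral_prod_mul (fun s : unitInterval => c * ((Real.sqrt s ^ (a + b) : ℝ) : ℂ))
    (fun θ : UnitAddCircle => (fourier ((a : ℤ) - b) θ : ℂ)), integral_fourier_eq]
  by_cases h : a = b
  · subst h
    rw [if_pos (by simp), if_pos rfl, mul_one, integral_const_mul, integral_complex_ofReal,
      div_eq_mul_inv]
    congr 1
    have h2 : ∀ s : unitInterval, Real.sqrt s ^ (a + a) = (fun x : ℝ => x ^ a) s := by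
      intro s
      rw [← two_mul, pow_mul, Real.sq_sqrt s.2.1]
    simp_rw [h2]
    rw [integral_subtype measurableSet_Icc (fun x : ℝ => x ^ a), integral_Icc_eq_integral_Ioc,
      ← intervalIntegral.integral_of_le zero_le_one, integral_pow]
    simp
  · rw [if_neg (by omega), if_neg h, mul_zero]

lemma mean_dw_rho_mul (p : BiPoly) : mean (dw (rho * p)) = 0 := by
  induction p using BiPoly.induction with
  | hadd p q hp hq => rw [mul_add, map_add, map_add, hp, hq, add_zero]
  | hmono c a b =>
    have h1 : rho * (MvPolynomial.C c * (bz ^ a * bw ^ b)) =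
        MvPolynomial.C c * (bz ^ a * bw ^ b) - MvPolynomial.C c * (bz ^ (a + 1) * bw ^ (b + 1)) := by
      rw [rho]; ring
    have h2 : ∀ a b : ℕ, dw (MvPolynomial.C c * (bz ^ a * bw ^ b)) =
        MvPolynomial.C (c * b) * (bz ^ a * bw ^ (b - 1)) := by
      intro a b
      rw [MvPolynomial.pderiv_C_mul, Derivation.leibniz, MvPolynomial.pderiv_pow,
        MvPolynomial.pderiv_pow]
      simp
      ring
    rw [h1, map_sub, h2, h2, map_sub, mean_monomial, mean_monomial]
    rcases b with _ | b
    · simp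
    · by_cases h : a = b
      · subst h
        have h3 : ((a : ℂ) + 1) ≠ 0 := by exact_mod_cast Nat.succ_ne_zero a
        have h4 : ((a : ℂ) + 1 + 1) ≠ 0 := by exact_mod_cast Nat.succ_ne_zero (a + 1)
        simp
        field_simp
        simp
      · rw [if_neg (by simpa using h), if_neg (by simpa using h), sub_zero]

lemma mean_dz_rho_mul (p : BiPoly) : mean (dz (rho * p)) = 0 := by
  have := mean_cj (dz (rho * p))
  rw [← dw_cj, map_mul, cj_rho, mean_dw_rho_mul] at this
  exact (map_eq_zero (starRingEnd ℂ)).mp this.symm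

/-- A polynomial in `z` and its conjugate as an element of `L²` of the disc. -/
noncomputable def toL2 : BiPoly →ₗ[ℂ] Lp ℂ 2 area :=
  (ContinuousMap.toLp 2 area ℂ : C(Polar, ℂ) →L[ℂ] Lp ℂ 2 area).toLinearMap ∘ₗ evC.toLinearMap

/-- The `L²` norm over the disc. -/
noncomputable def nrm (p : BiPoly) : ℝ := ‖toL2 p‖

lemma nrm_nonneg (p : BiPoly) : 0 ≤ nrm p := norm_nonneg _

lemma nrm_add_le (p q : BiPoly) : nrm (p + q) ≤ nrm p + nrm q := by
  rw [nrm, map_add]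
  exact norm_add_le _ _

lemma nrm_sub_le (p q : BiPoly) : nrm (p - q) ≤ nrm p + nrm q := by
  rw [nrm, map_sub]
  exact norm_sub_le _ _

lemma nrm_sum_le {ι : Type*} (s : Finset ι) (p : ι → BiPoly) :
    nrm (∑ i ∈ s, p i) ≤ ∑ i ∈ s, nrm (p i) := by
  rw [nrm, map_sum]
  exact norm_sum_le _ _

lemma inner_toL2 (p q : BiPoly) : inner ℂ (toL2 p) (toL2 q) = mean (q * cj p) := by
  refine (ContinuousMap.inner_toLp area (evC p) (evC q)).trans ?_
  change _ = ∫ ω, evC (q * cj p) ω ∂area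
  simp only [map_mul, ContinuousMap.mul_apply, evC_apply, bev_cj]

lemma nrm_sq (p : BiPoly) : ((nrm p ^ 2 : ℝ) : ℂ) = mean (p * cj p) := by
  rw [← inner_toL2, inner_self_eq_norm_sq_to_K, nrm]
  norm_cast

lemma norm_mean_mul_cj_le (p q : BiPoly) : ‖mean (p * cj q)‖ ≤ nrm p * nrm q := by
  rw [← inner_toL2, mul_comm]
  exact norm_inner_le_norm _ _

lemma nrm_cj (p : BiPoly) : nrm (cj p) = nrm p := by
  have h : nrm (cj p) ^ 2 = nrm p ^ 2 := by
    have := nrm_sq (cj p)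
    rw [cj_cj, mul_comm, ← nrm_sq] at this
    exact_mod_cast this
  exact (sq_eq_sq₀ (nrm_nonneg _) (nrm_nonneg _)).mp h

lemma nrm_le_sum {ι : Type*} (s : Finset ι) (p : BiPoly) (q : ι → BiPoly) (c : ℝ) (hc : 0 ≤ c)
    (h : ∀ z : ℂ, ‖z‖ ≤ 1 → ‖bev z p‖ ≤ c * ∑ i ∈ s, ‖bev z (q i)‖) :
    nrm p ≤ c * ∑ i ∈ s, nrm (q i) := by
  let T : C(Polar, ℂ) →L[ℂ] Lp ℂ 2 area := ContinuousMap.toLp 2 area ℂ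
  let R : ι → C(Polar, ℂ) := fun i =>
    ⟨fun ω => ((‖evC (q i) ω‖ : ℝ) : ℂ), by fun_prop⟩
  have hmono : ∀ (F G : C(Polar, ℂ)) (c : ℝ), (∀ ω, ‖F ω‖ ≤ c * ‖G ω‖) → ‖T F‖ ≤ c * ‖T G‖ := by
    intro F G c hFG
    refine Lp.norm_le_mul_norm_of_ae_le_mul ?_
    filter_upwards [ContinuousMap.coeFn_toLp (p := 2) (𝕜 := ℂ) area F,
      ContinuousMap.coeFn_toLp (p := 2) (𝕜 := ℂ) area G] with ω h1 h2
    rw [h1, h2]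
    exact hFG ω
  have h1 : ‖T (evC p)‖ ≤ c * ‖T (∑ i ∈ s, R i)‖ := by
    refine hmono _ _ _ fun ω => ?_
    have h2 : (∑ i ∈ s, R i) ω = ((∑ i ∈ s, ‖evC (q i) ω‖ : ℝ) : ℂ) := by
      rw [ContinuousMap.sum_apply]
      simp [R]
    rw [h2, Complex.norm_real, Real.norm_of_nonneg (Finset.sum_nonneg fun _ _ => norm_nonneg _)]
    simp only [evC_apply]
    exact h _ (norm_polarPt_le ω)
  have h3 : ‖T (∑ i ∈ s, R i)‖ ≤ ∑ i ∈ s, nrm (q i) := by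
    rw [map_sum]
    refine (norm_sum_le _ _).trans (Finset.sum_le_sum fun i _ => ?_)
    refine (hmono (R i) (evC (q i)) 1 fun ω => ?_).trans_eq (one_mul _)
    simp [R]
  exact h1.trans (mul_le_mul_of_nonneg_left h3 hc)

lemma nrm_le (p q : BiPoly) (c : ℝ) (hc : 0 ≤ c)
    (h : ∀ z : ℂ, ‖z‖ ≤ 1 → ‖bev z p‖ ≤ c * ‖bev z q‖) : nrm p ≤ c * nrm q := by
  simpa using nrm_le_sum (Finset.univ : Finset Unit) p (fun _ => q) c hc (by simpa using h)

end DirichletRadical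

namespace DirichletRadical

open PowerSeries

lemma le_of_sq_le_sq {a b : ℝ} (h : a ^ 2 ≤ b ^ 2) (hb : 0 ≤ b) : a ≤ b :=
  (le_abs_self a).trans (abs_le_of_sq_le_sq h hb)

/-! ### Consequences of the divergence theorem -/

lemma dz_rho : dz rho = -bw := by
  simp [rho, MvPolynomial.pderiv_X]

lemma nrm_mul_le_of_bev_le (g p : BiPoly) (c : ℝ) (hc : 0 ≤ c)
    (h : ∀ z : ℂ, ‖z‖ ≤ 1 → ‖bev z g‖ ≤ c) : nrm (g * p) ≤ c * nrm p := by
  refine nrm_le _ _ c hc fun z hz => ?_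
  rw [map_mul, norm_mul]
  exact mul_le_mul_of_nonneg_right (h z hz) (norm_nonneg _)

lemma nrm_dz_rho_mul (v : BiPoly) : nrm (dz (rho * v)) = nrm (dw (rho * v)) := by
  set W := rho * v with hW
  have h1 : mean (dz W * dw (cj W)) = -mean (W * dz (dw (cj W))) := by
    have := mean_dz_rho_mul (v * dw (cj W))
    rw [← mul_assoc, ← hW, Derivation.leibniz, map_add, smul_eq_mul, smul_eq_mul,
      mul_comm (dw (cj W))] at this
    linear_combination this
  have h2 : mean (dw W * dz (cj W)) = -mean (W * dw (dz (cj W))) := by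
    have := mean_dw_rho_mul (v * dz (cj W))
    rw [← mul_assoc, ← hW, Derivation.leibniz, map_add, smul_eq_mul, smul_eq_mul,
      mul_comm (dz (cj W))] at this
    linear_combination this
  have h3 : ((nrm (dz W) ^ 2 : ℝ) : ℂ) = ((nrm (dw W) ^ 2 : ℝ) : ℂ) := by
    rw [nrm_sq, nrm_sq, ← dw_cj, ← dz_cj, h1, h2, dz_dw]
  exact (sq_eq_sq₀ (nrm_nonneg _) (nrm_nonneg _)).mp (by exact_mod_cast h3)

lemma nrm_sq_dw_rho_mul_add (v : BiPoly) (B : Polynomial ℂ) :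
    nrm (dw (rho * v) + cj (hol B)) ^ 2 = nrm (dw (rho * v)) ^ 2 + nrm (hol B) ^ 2 := by
  have h : inner ℂ (toL2 (dw (rho * v))) (toL2 (cj (hol B))) = 0 := by
    rw [inner_toL2, ← map_mul, mean_cj]
    have := mean_dw_rho_mul (v * hol B)
    rw [← mul_assoc, Derivation.leibniz, dw_hol, smul_zero, zero_add, smul_eq_mul] at this
    rw [this, map_zero]
  rw [← nrm_cj (hol B), nrm, map_add, norm_add_sq (𝕜 := ℂ), h, nrm, nrm]
  simp

lemma nrm_le_two_mul_nrm_dw (v : BiPoly) : nrm v ≤ 2 * nrm (dw (rho * v)) := by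
  have h1 : v * cj v = dw (rho * (bw * v * cj v)) -
      (dw (rho * v) * cj (bz * v) + (bw * v) * cj (dz (rho * v))) := by
    simp only [Derivation.leibniz, dw_rho, dz_rho, dw_cj, map_add, map_mul, map_neg, smul_eq_mul,
      cj_rho, cj_bz, cj_bw, MvPolynomial.pderiv_X_self]
    rw [rho]
    ring
  have h2 : nrm (bz * v) ≤ nrm v := by
    simpa using nrm_mul_le_of_bev_le bz v 1 zero_le_one (by simp)
  have h3 : nrm (bw * v) ≤ nrm v := by
    simpa using nrm_mul_le_of_bev_le bw v 1 zero_le_one (by simp)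
  have h4 : nrm v ^ 2 ≤ nrm (dw (rho * v)) * nrm v + nrm v * nrm (dw (rho * v)) := by
    have h5 : nrm v ^ 2 = ‖((nrm v ^ 2 : ℝ) : ℂ)‖ := by
      rw [Complex.norm_real, Real.norm_of_nonneg (sq_nonneg _)]
    rw [h5, nrm_sq, h1, map_sub, mean_dw_rho_mul, zero_sub, norm_neg, map_add]
    refine (norm_add_le _ _).trans (add_le_add ?_ ?_)
    · exact (norm_mean_mul_cj_le _ _).trans (mul_le_mul_of_nonneg_left h2 (nrm_nonneg _))
    · refine (norm_mean_mul_cj_le _ _).trans ?_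
      rw [nrm_dz_rho_mul]
      exact mul_le_mul_of_nonneg_right h3 (nrm_nonneg _)
  rcases (nrm_nonneg v).eq_or_lt with h | h
  · rw [← h]
    exact mul_nonneg zero_le_two (nrm_nonneg _)
  · nlinarith

/-! ### The Dirichlet norm of a polynomial -/

/-- The norm of a polynomial in the Dirichlet space. -/
noncomputable def dirNorm (h : Polynomial ℂ) : ℝ := √(dirPart h.natDegree (h : PowerSeries ℂ))

lemma dirNorm_nonneg (h : Polynomial ℂ) : 0 ≤ dirNorm h := Real.sqrt_nonneg _

lemma dirPart_coe_of_le {h : Polynomial ℂ} {L : ℕ} (hL : h.natDegree ≤ L) :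
    dirPart L (h : PowerSeries ℂ) = dirPart h.natDegree (h : PowerSeries ℂ) := by
  refine (Finset.sum_subset (Finset.range_mono (by omega)) fun i _ hi => ?_).symm
  rw [Polynomial.coeff_coe, Polynomial.coeff_eq_zero_of_natDegree_lt (by simpa using hi)]
  simp

lemma dirNorm_eq {h : Polynomial ℂ} {L : ℕ} (hL : h.natDegree ≤ L) :
    dirNorm h = √(dirPart L (h : PowerSeries ℂ)) := by
  rw [dirPart_coe_of_le hL, dirNorm]

lemma sqrt_dirPart_le_dirNorm (h : Polynomial ℂ) (L : ℕ) :
    √(dirPart L (h : PowerSeries ℂ)) ≤ dirNorm h := by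
  rw [dirNorm_eq (le_max_right L h.natDegree)]
  exact Real.sqrt_le_sqrt (Finset.sum_le_sum_of_subset_of_nonneg
    (Finset.range_mono (by omega)) fun _ _ _ => by positivity)

lemma dirNorm_sq {h : Polynomial ℂ} {L : ℕ} (hL : h.natDegree ≤ L) :
    dirNorm h ^ 2 = ∑ i ∈ Finset.range (L + 1), ((i : ℝ) + 1) * ‖h.coeff i‖ ^ 2 := by
  rw [dirNorm_eq hL, Real.sq_sqrt (dirPart_nonneg _ _), dirPart]
  simp only [Polynomial.coeff_coe]

lemma nrm_hol_sq {h : Polynomial ℂ} {L : ℕ} (hL : h.natDegree ≤ L) :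
    nrm (hol h) ^ 2 = ∑ i ∈ Finset.range (L + 1), ‖h.coeff i‖ ^ 2 / ((i : ℝ) + 1) := by
  have h1 : hol h = ∑ i ∈ Finset.range (L + 1), MvPolynomial.C (h.coeff i) * bz ^ i := by
    conv_lhs => rw [h.as_sum_range' (L + 1) (by omega)]
    rw [map_sum]
    refine Finset.sum_congr rfl fun i _ => ?_
    rw [hol, Polynomial.aeval_monomial, MvPolynomial.algebraMap_eq]
  have h2 : ((nrm (hol h) ^ 2 : ℝ) : ℂ) =
      ((∑ i ∈ Finset.range (L + 1), ‖h.coeff i‖ ^ 2 / ((i : ℝ) + 1) : ℝ) : ℂ) := by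
    rw [nrm_sq, h1, map_sum, Finset.sum_mul_sum, map_sum]
    push_cast
    refine Finset.sum_congr rfl fun i hi => ?_
    have h3 : ∀ j, MvPolynomial.C (h.coeff i) * bz ^ i * cj (MvPolynomial.C (h.coeff j) * bz ^ j) =
        MvPolynomial.C (h.coeff i * starRingEnd ℂ (h.coeff j)) * (bz ^ i * bw ^ j) := by
      intro j
      rw [map_mul, map_pow, cj_bz, cj_C, map_mul]
      ring
    rw [map_sum]
    simp only [h3, mean_monomial]
    rw [Finset.sum_ite_eq, if_pos hi, Complex.mul_conj, Complex.normSq_eq_norm_sq]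
    push_cast
    rfl
  exact_mod_cast h2

lemma nrm_hol_derivative_sq {h : Polynomial ℂ} {L : ℕ} (hL : h.natDegree ≤ L) :
    nrm (hol (Polynomial.derivative h)) ^ 2 =
      ∑ i ∈ Finset.range (L + 1), (i : ℝ) * ‖h.coeff i‖ ^ 2 := by
  have h0 := h.natDegree_derivative_le
  rw [nrm_hol_sq (L := L) (by omega)]
  have h1 : ∑ i ∈ Finset.range (L + 2), (i : ℝ) * ‖h.coeff i‖ ^ 2 =
      ∑ i ∈ Finset.range (L + 1), (i : ℝ) * ‖h.coeff i‖ ^ 2 := by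
    rw [Finset.sum_range_succ, Polynomial.coeff_eq_zero_of_natDegree_lt (by omega : _ < L + 1)]
    simp
  rw [← h1, Finset.sum_range_succ' _ (L + 1)]
  simp only [Nat.cast_zero, zero_mul, add_zero]
  refine Finset.sum_congr rfl fun i _ => ?_
  have h2 : ‖(i : ℂ) + 1‖ = (i : ℝ) + 1 := by exact_mod_cast Complex.norm_natCast (i + 1)
  have h3 : (i : ℝ) + 1 ≠ 0 := by positivity
  rw [Polynomial.coeff_derivative, norm_mul, h2]
  push_cast
  field_simp

lemma nrm_hol_le (h : Polynomial ℂ) : nrm (hol h) ≤ dirNorm h := by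
  rw [← sq_le_sq₀ (nrm_nonneg _) (dirNorm_nonneg _), nrm_hol_sq le_rfl, dirNorm_sq le_rfl]
  refine Finset.sum_le_sum fun i _ => ?_
  have h1 : (1 : ℝ) ≤ (i : ℝ) + 1 := by linarith [(Nat.cast_nonneg i : (0 : ℝ) ≤ i)]
  calc _ ≤ ‖h.coeff i‖ ^ 2 := div_le_self (sq_nonneg _) h1
    _ ≤ _ := le_mul_of_one_le_left (sq_nonneg _) h1

lemma nrm_hol_derivative_le (h : Polynomial ℂ) :
    nrm (hol (Polynomial.derivative h)) ≤ dirNorm h := by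
  rw [← sq_le_sq₀ (nrm_nonneg _) (dirNorm_nonneg _), nrm_hol_derivative_sq le_rfl,
    dirNorm_sq le_rfl]
  exact Finset.sum_le_sum fun i _ => mul_le_mul_of_nonneg_right (by linarith) (sq_nonneg _)

lemma dirNorm_le_of_coeff_zero (A : Polynomial ℂ) (hA : A.coeff 0 = 0) :
    dirNorm A ≤ 2 * nrm (hol (Polynomial.derivative A)) := by
  rw [← sq_le_sq₀ (dirNorm_nonneg _) (mul_nonneg zero_le_two (nrm_nonneg _)), mul_pow,
    nrm_hol_derivative_sq le_rfl, dirNorm_sq le_rfl, Finset.mul_sum]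
  refine Finset.sum_le_sum fun i _ => ?_
  rcases i with _ | i
  · simp [hA]
  · rw [← mul_assoc]
    refine mul_le_mul_of_nonneg_right ?_ (sq_nonneg _)
    push_cast
    linarith [(Nat.cast_nonneg i : (0 : ℝ) ≤ i)]

lemma dirNorm_le (g : Polynomial ℂ) :
    dirNorm g ≤ nrm (hol g) + 2 * nrm (hol (Polynomial.derivative g)) := by
  have h2 : dirNorm g ^ 2 ≤ nrm (hol g) ^ 2 + 2 * nrm (hol (Polynomial.derivative g)) ^ 2 := by
    rw [nrm_hol_sq le_rfl, nrm_hol_derivative_sq le_rfl, dirNorm_sq le_rfl, Finset.mul_sum,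
      ← Finset.sum_add_distrib]
    refine Finset.sum_le_sum fun i _ => ?_
    rcases i with _ | i
    · simp
    · refine le_add_of_nonneg_of_le (by positivity) ?_
      rw [← mul_assoc]
      refine mul_le_mul_of_nonneg_right ?_ (sq_nonneg _)
      push_cast
      linarith [(Nat.cast_nonneg i : (0 : ℝ) ≤ i)]
  refine le_of_sq_le_sq ?_
    (add_nonneg (nrm_nonneg _) (mul_nonneg zero_le_two (nrm_nonneg _)))
  nlinarith [nrm_nonneg (hol g), nrm_nonneg (hol (Polynomial.derivative g))]

/-! ### Polynomial multipliers -/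

lemma val_coe (f : Polynomial ℂ) (z : ℂ) : val (f : PowerSeries ℂ) z = f.eval z := by
  rw [val, tsum_eq_sum (s := Finset.range (f.natDegree + 1)), Polynomial.eval_eq_sum_range]
  · simp
  · intro i hi
    rw [Polynomial.coeff_coe, Polynomial.coeff_eq_zero_of_natDegree_lt (by simpa using hi), zero_mul]

lemma norm_eval_le_of_mulBd {f : Polynomial ℂ} {M : ℝ} (hf : MulBd (f : PowerSeries ℂ) M)
    {z : ℂ} (hz : ‖z‖ ≤ 1) : ‖f.eval z‖ ≤ M := by
  have h1 : closure (Metric.ball (0 : ℂ) 1) ⊆ {z | ‖f.eval z‖ ≤ M} := by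
    refine closure_minimal (fun w hw => ?_) (isClosed_le (by fun_prop) continuous_const)
    change ‖f.eval w‖ ≤ M
    rw [← val_coe]
    exact hf.norm_val_le (by simpa using hw)
  rw [closure_ball _ one_ne_zero] at h1
  exact h1 (by simpa using hz)

lemma norm_rho_mul_derivative_le {f : Polynomial ℂ} {M : ℝ}
    (hf : MulBd (f : PowerSeries ℂ) M) {z : ℂ} (hz : ‖z‖ ≤ 1) :
    ‖bev z (hol (Polynomial.derivative f) * rho)‖ ≤ 2 * M := by
  rw [map_mul, bev_hol, bev_rho, norm_mul, Complex.norm_real]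
  rcases hz.lt_or_eq with hz | hz
  · have h1 : 0 < 1 - ‖z‖ := by linarith
    have h2 : ‖deriv (fun w => f.eval w) z‖ ≤ M / (1 - ‖z‖) := by
      refine Complex.norm_deriv_le_of_forall_mem_sphere_norm_le h1
        f.differentiable.diffContOnCl fun w hw => ?_
      refine norm_eval_le_of_mulBd hf ?_
      have h3 : ‖w - z‖ = 1 - ‖z‖ := by simpa [dist_eq_norm] using hw
      calc ‖w‖ = ‖(w - z) + z‖ := by rw [sub_add_cancel]
        _ ≤ ‖w - z‖ + ‖z‖ := norm_add_le _ _
        _ = 1 := by rw [h3]; ring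
    rw [Polynomial.deriv] at h2
    have h4 : 0 ≤ 1 - ‖z‖ ^ 2 := by nlinarith [norm_nonneg z]
    rw [Real.norm_of_nonneg h4]
    calc _ ≤ M / (1 - ‖z‖) * (1 - ‖z‖ ^ 2) := mul_le_mul_of_nonneg_right h2 h4
      _ = M * (1 + ‖z‖) := by field_simp; ring
      _ ≤ 2 * M := by nlinarith [hf.1]
  · rw [hz]
    simpa using hf.1

lemma dirNorm_mul_le {f : Polynomial ℂ} {M : ℝ} (hf : MulBd (f : PowerSeries ℂ) M)
    (h : Polynomial ℂ) : dirNorm (f * h) ≤ M * dirNorm h := by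
  rw [dirNorm, Polynomial.coe_mul]
  exact (hf.dir_le _ _).trans (mul_le_mul_of_nonneg_left (sqrt_dirPart_le_dirNorm _ _) hf.1)

lemma nrm_derivative_mul_le {f : Polynomial ℂ} {M : ℝ} (hf : MulBd (f : PowerSeries ℂ) M)
    (h : Polynomial ℂ) :
    nrm (hol (Polynomial.derivative f) * hol h) ≤ 2 * M * dirNorm h := by
  have h1 : hol (Polynomial.derivative f) * hol h = hol (Polynomial.derivative (f * h)) -
      hol f * hol (Polynomial.derivative h) := by
    rw [Polynomial.derivative_mul, map_add, map_mul, map_mul]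
    ring
  rw [h1]
  refine (nrm_sub_le _ _).trans ?_
  have h2 : nrm (hol (Polynomial.derivative (f * h))) ≤ M * dirNorm h :=
    (nrm_hol_derivative_le _).trans (dirNorm_mul_le hf h)
  have h3 : nrm (hol f * hol (Polynomial.derivative h)) ≤ M * dirNorm h :=
    (nrm_mul_le_of_bev_le _ _ M hf.1 fun z hz => by
      rw [bev_hol]; exact norm_eval_le_of_mulBd hf hz).trans
      (mul_le_mul_of_nonneg_left (nrm_hol_derivative_le h) hf.1)
  linarith

/-- Solution of the `∂̄` equation with estimates. -/
lemma exists_dbar (u : BiPoly) : ∃ b : BiPoly, dw b = u ∧ nrm (dz b) ≤ nrm u ∧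
    nrm b ≤ 4 * nrm u ∧ ∀ (f : Polynomial ℂ) (M : ℝ), MulBd (f : PowerSeries ℂ) M →
      nrm (hol (Polynomial.derivative f) * b) ≤ 8 * M * nrm u := by
  obtain ⟨v, A, hA, hu⟩ := exists_dbar_solution u
  have h1 := nrm_sq_dw_rho_mul_add v (Polynomial.derivative A)
  rw [hu] at h1
  have h2 : nrm (dw (rho * v)) ≤ nrm u :=
    le_of_sq_le_sq (by nlinarith [nrm_nonneg (hol (Polynomial.derivative A))]) (nrm_nonneg _)
  have h3 : nrm (hol (Polynomial.derivative A)) ≤ nrm u :=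
    le_of_sq_le_sq (by nlinarith [nrm_nonneg (dw (rho * v))]) (nrm_nonneg _)
  have h4 : nrm v ≤ 2 * nrm u := (nrm_le_two_mul_nrm_dw v).trans (by linarith)
  have h5 : dirNorm A ≤ 2 * nrm u := (dirNorm_le_of_coeff_zero A hA).trans (by linarith)
  refine ⟨rho * v + cj (hol A), ?_, ?_, ?_, ?_⟩
  · rw [map_add, dw_cj_hol, hu]
  · rw [map_add, dz_cj_hol, add_zero, nrm_dz_rho_mul]
    exact h2
  · refine (nrm_add_le _ _).trans ?_
    have h6 : nrm (rho * v) ≤ 1 * nrm v := by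
      refine nrm_mul_le_of_bev_le _ _ 1 zero_le_one fun z hz => ?_
      rw [bev_rho, Complex.norm_real, Real.norm_of_nonneg] <;> nlinarith [norm_nonneg z]
    have h7 := nrm_hol_le A
    rw [nrm_cj]
    linarith
  · intro f M hf
    rw [mul_add, ← mul_assoc]
    refine (nrm_add_le _ _).trans ?_
    have h6 : nrm (hol (Polynomial.derivative f) * rho * v) ≤ 2 * M * nrm v :=
      nrm_mul_le_of_bev_le _ _ _ (by linarith [hf.1]) fun z hz => norm_rho_mul_derivative_le hf hz
    have h7 : nrm (hol (Polynomial.derivative f) * cj (hol A)) ≤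
        1 * nrm (hol (Polynomial.derivative f) * hol A) := by
      refine nrm_le _ _ 1 zero_le_one fun z _ => ?_
      simp
    have h8 := nrm_derivative_mul_le hf A
    nlinarith [mul_le_mul_of_nonneg_left h4 hf.1, mul_le_mul_of_nonneg_left h5 hf.1]

end DirichletRadical

namespace DirichletRadical

open PowerSeries

/-! ### Polynomial approximation of the reciprocal -/

lemma exists_poly_reciprocal {δ T ε : ℝ} (hδ : 0 < δ) (hε : 0 < ε) :
    ∃ q : Polynomial ℝ, ∀ t, δ ≤ t → t ≤ T →
      |1 - t * q.eval t| ≤ ε ∧ |q.eval t + t * q.derivative.eval t| ≤ ε := by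
  by_cases hT : δ ≤ T
  swap
  · exact ⟨0, fun t h1 h2 => absurd (h1.trans h2) hT⟩
  have hT0 : 0 < T := hδ.trans_le hT
  have hr0 : 0 ≤ 1 - δ / T := by rw [sub_nonneg]; exact div_le_one_of_le₀ hT hT0.le
  have hr1 : 1 - δ / T < 1 := by linarith [div_pos hδ hT0]
  obtain ⟨N, hN1, hN2⟩ : ∃ N : ℕ, (1 - δ / T) ^ (N + 1) ≤ ε ∧
      ((N : ℝ) + 1) * (1 - δ / T) ^ N / T ≤ ε := by
    have h1 := (tendsto_pow_atTop_nhds_zero_of_lt_one hr0 hr1).comp (Filter.tendsto_add_atTop_nat 1)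
    have h2 := ((tendsto_self_mul_const_pow_of_lt_one hr0 hr1).add
      (tendsto_pow_atTop_nhds_zero_of_lt_one hr0 hr1)).div_const T
    rw [add_zero, zero_div] at h2
    obtain ⟨N, h3, h4⟩ := ((h1.eventually (gt_mem_nhds hε)).and
      (h2.eventually (gt_mem_nhds hε))).exists
    exact ⟨N, h3.le, by rw [add_mul, one_mul]; exact h4.le⟩
  let y : Polynomial ℝ := 1 - Polynomial.C T⁻¹ * Polynomial.X
  let q : Polynomial ℝ := Polynomial.C T⁻¹ * ∑ i ∈ Finset.range (N + 1), y ^ i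
  have hq : Polynomial.X * q = 1 - y ^ (N + 1) := by
    have h1 := mul_neg_geom_sum y (N + 1)
    rw [← h1]
    simp only [q, y]
    ring
  have hq' : q + Polynomial.X * Polynomial.derivative q =
      Polynomial.C (((N : ℝ) + 1) * T⁻¹) * y ^ N := by
    have h1 := congrArg Polynomial.derivative hq
    simp only [Polynomial.derivative_mul, Polynomial.derivative_X, one_mul,
      Polynomial.derivative_sub, Polynomial.derivative_one, Polynomial.derivative_pow_succ, y,
      Polynomial.derivative_C, zero_mul, zero_add, mul_one] at h1
    rw [h1]
    simp only [y, Polynomial.C_mul]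
    ring
  refine ⟨q, fun t ht1 ht2 => ?_⟩
  have hy : y.eval t = 1 - t / T := by simp [y]; ring
  have hy0 : 0 ≤ 1 - t / T := by rw [sub_nonneg]; exact div_le_one_of_le₀ ht2 hT0.le
  have hy1 : 1 - t / T ≤ 1 - δ / T := by
    have := div_le_div_of_nonneg_right ht1 hT0.le
    linarith
  have e1 := congrArg (Polynomial.eval t) hq
  have e2 := congrArg (Polynomial.eval t) hq'
  simp only [Polynomial.eval_mul, Polynomial.eval_X, Polynomial.eval_sub, Polynomial.eval_one,
    Polynomial.eval_pow, hy, Polynomial.eval_add, Polynomial.eval_C] at e1 e2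
  rw [e1, e2, sub_sub_cancel, abs_of_nonneg (by positivity), abs_of_nonneg (by positivity)]
  constructor
  · exact (pow_le_pow_left₀ hy0 hy1 _).trans hN1
  · refine le_trans ?_ hN2
    rw [mul_right_comm, ← div_eq_mul_inv]
    exact div_le_div_of_nonneg_right
      (mul_le_mul_of_nonneg_left (pow_le_pow_left₀ hy0 hy1 N) (by positivity)) hT0.le

variable {n : ℕ}

/-- The polynomial standing for `∑ |f l|²`. -/
noncomputable def sumSq (f : Fin n → Polynomial ℂ) : BiPoly := ∑ l, hol (f l) * cj (hol (f l))

lemma bev_sumSq (f : Fin n → Polynomial ℂ) (z : ℂ) :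
    bev z (sumSq f) = ((∑ l, ‖(f l).eval z‖ ^ 2 : ℝ) : ℂ) := by
  rw [sumSq, map_sum]
  push_cast
  refine Finset.sum_congr rfl fun l _ => ?_
  rw [map_mul, bev_cj, bev_hol, Complex.mul_conj, Complex.normSq_eq_norm_sq]
  push_cast
  rfl

lemma cj_sumSq (f : Fin n → Polynomial ℂ) : cj (sumSq f) = sumSq f := by
  simp [sumSq, mul_comm]

lemma dz_sumSq (f : Fin n → Polynomial ℂ) :
    dz (sumSq f) = ∑ l, hol (Polynomial.derivative (f l)) * cj (hol (f l)) := by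
  rw [sumSq, map_sum]
  refine Finset.sum_congr rfl fun l _ => ?_
  rw [Derivation.leibniz, dz_cj_hol, dz_hol, smul_zero, zero_add, smul_eq_mul, mul_comm]

lemma norm_bev_dw_sumSq (f : Fin n → Polynomial ℂ) (z : ℂ) :
    ‖bev z (dw (sumSq f))‖ = ‖bev z (dz (sumSq f))‖ := by
  rw [← cj_sumSq, dw_cj, bev_cj, cj_sumSq, RCLike.norm_conj]

lemma norm_bev_dz_sumSq_mul_le (f : Fin n → Polynomial ℂ) (z : ℂ) (a b : ℝ)
    (ha : 0 ≤ a) (hab : ∀ l, a * ‖(f l).eval z‖ ≤ b) :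
    a * ‖bev z (dz (sumSq f))‖ ≤ b * ∑ l, ‖(Polynomial.derivative (f l)).eval z‖ := by
  rw [dz_sumSq, map_sum, Finset.mul_sum]
  refine (mul_le_mul_of_nonneg_left (norm_sum_le _ _) ha).trans ?_
  rw [Finset.mul_sum]
  refine Finset.sum_le_sum fun l _ => ?_
  rw [map_mul, bev_cj, bev_hol, bev_hol, norm_mul, RCLike.norm_conj]
  calc _ = a * ‖(f l).eval z‖ * ‖(Polynomial.derivative (f l)).eval z‖ := by ring
    _ ≤ _ := mul_le_mul_of_nonneg_right (hab l) (norm_nonneg _)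

lemma exists_reciprocal_sumSq (f : Fin n → Polynomial ℂ) {M δ ε : ℝ}
    (hf : ∀ l, MulBd (f l : PowerSeries ℂ) M) (hδ : 0 < δ)
    (hδt : ∀ z : ℂ, ‖z‖ ≤ 1 → δ ≤ ∑ l, ‖(f l).eval z‖ ^ 2) (hε : 0 < ε) (hε1 : ε ≤ 1) :
    ∃ Q Q₁ : BiPoly, dz Q = Q₁ * dz (sumSq f) ∧ dw Q = Q₁ * dw (sumSq f) ∧
      ∀ z : ℂ, ‖z‖ ≤ 1 → ‖bev z (1 - sumSq f * Q)‖ ≤ ε ∧ ‖bev z (Q + sumSq f * Q₁)‖ ≤ ε ∧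
        (∑ l, ‖(f l).eval z‖ ^ 2) * ‖bev z Q‖ ≤ 2 ∧
        (∑ l, ‖(f l).eval z‖ ^ 2) ^ 2 * ‖bev z Q₁‖ ≤ 3 := by
  set T : ℝ := n * M ^ 2 + 1 with hT
  have hT0 : 0 < T := by positivity
  obtain ⟨q, hq⟩ := exists_poly_reciprocal (T := T) hδ (lt_min hε (inv_pos.mpr hT0))
  have hbev : ∀ (p : Polynomial ℝ) (z : ℂ), bev z (Polynomial.aeval (sumSq f)
      (p.map (algebraMap ℝ ℂ))) = ((p.eval (∑ l, ‖(f l).eval z‖ ^ 2) : ℝ) : ℂ) := by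
    intro p z
    rw [← Polynomial.aeval_algHom_apply, bev_sumSq, Polynomial.aeval_map_algebraMap]
    exact Polynomial.aeval_algebraMap_apply ℂ (∑ l, ‖(f l).eval z‖ ^ 2) p
  refine ⟨Polynomial.aeval (sumSq f) (q.map (algebraMap ℝ ℂ)),
    Polynomial.aeval (sumSq f) ((Polynomial.derivative q).map (algebraMap ℝ ℂ)), ?_, ?_,
    fun z hz => ?_⟩
  · rw [Derivation.map_aeval, Polynomial.derivative_map, smul_eq_mul]
  · rw [Derivation.map_aeval, Polynomial.derivative_map, smul_eq_mul]
  have htT : ∑ l, ‖(f l).eval z‖ ^ 2 ≤ T := by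
    have : ∑ l, ‖(f l).eval z‖ ^ 2 ≤ ∑ _l : Fin n, M ^ 2 :=
      Finset.sum_le_sum fun l _ =>
        pow_le_pow_left₀ (norm_nonneg _) (norm_eval_le_of_mulBd (hf l) hz) 2
    rw [Finset.sum_const, Finset.card_univ, Fintype.card_fin, nsmul_eq_mul] at this
    linarith
  have htδ := hδt z hz
  simp only [map_sub, map_add, map_mul, map_one, hbev, bev_sumSq]
  set t := ∑ l, ‖(f l).eval z‖ ^ 2 with ht
  have ht0 : 0 < t := hδ.trans_le htδ
  obtain ⟨h1, h2⟩ := hq t htδ htT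
  have h3 : t * |q.eval t| ≤ 2 := by
    have := abs_sub_abs_le_abs_sub (t * q.eval t) 1
    rw [abs_sub_comm _ (1 : ℝ), abs_one, abs_mul, abs_of_pos ht0] at this
    linarith [min_le_left ε T⁻¹]
  have h4 : t * |q.eval t + t * q.derivative.eval t| ≤ 1 := by
    calc _ ≤ T * T⁻¹ := mul_le_mul htT (h2.trans (min_le_right _ _)) (abs_nonneg _) hT0.le
      _ = 1 := mul_inv_cancel₀ hT0.ne'
  refine ⟨?_, ?_, ?_, ?_⟩
  · norm_cast
    exact h1.trans (min_le_left _ _)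
  · norm_cast
    exact h2.trans (min_le_left _ _)
  · rw [Complex.norm_real]
    exact h3
  · rw [Complex.norm_real, Real.norm_eq_abs]
    have h5 : t ^ 2 * q.derivative.eval t =
        t * (q.eval t + t * q.derivative.eval t) - t * q.eval t := by ring
    calc t ^ 2 * |q.derivative.eval t| = |t ^ 2 * q.derivative.eval t| := by
          rw [abs_mul, abs_of_nonneg (sq_nonneg t)]
      _ ≤ |t * (q.eval t + t * q.derivative.eval t)| + |t * q.eval t| := by
          rw [h5]; exact abs_sub _ _
      _ ≤ 1 + 2 := by
          rw [abs_mul, abs_mul, abs_of_pos ht0]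
          exact add_le_add h4 h3
      _ = 3 := by norm_num

end DirichletRadical

namespace DirichletRadical

open PowerSeries

/-! ### Approximate division in the Dirichlet space -/

lemma norm_bev_mul_quotient_le {n : ℕ} (f : Fin n → Polynomial ℂ) (H : Polynomial ℂ) (Q Q₁ : BiPoly)
    {M C ε : ℝ} (hC : 0 ≤ C) (hε : 0 ≤ ε)
    (hz : dz Q = Q₁ * dz (sumSq f)) (hw : dw Q = Q₁ * dw (sumSq f)) (z : ℂ)
    (hM : ∀ l, ‖(f l).eval z‖ ≤ M) (hHt : ‖H.eval z‖ ≤ C * ∑ l, ‖(f l).eval z‖ ^ 2)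
    (h2 : ‖bev z (Q + sumSq f * Q₁)‖ ≤ ε)
    (h3 : (∑ l, ‖(f l).eval z‖ ^ 2) * ‖bev z Q‖ ≤ 2)
    (h4 : (∑ l, ‖(f l).eval z‖ ^ 2) ^ 2 * ‖bev z Q₁‖ ≤ 3) :
    (∀ j, ‖bev z (hol H * (cj (hol (f j)) * Q))‖ ≤ 2 * C * M) ∧
    (∀ j, ‖bev z (hol H * dz (cj (hol (f j)) * Q))‖ ≤
      3 * C * ∑ l, ‖(Polynomial.derivative (f l)).eval z‖) ∧
    (∀ j, ‖bev z (hol H * dw (cj (hol (f j)) * Q))‖ ≤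
      5 * C * ∑ l, ‖(Polynomial.derivative (f l)).eval z‖) ∧
    ‖bev z (dz (sumSq f * Q))‖ ≤ ε * M * ∑ l, ‖(Polynomial.derivative (f l)).eval z‖ ∧
    ‖bev z (dw (sumSq f * Q))‖ ≤ ε * M * ∑ l, ‖(Polynomial.derivative (f l)).eval z‖ := by
  set t := ∑ l, ‖(f l).eval z‖ ^ 2 with ht
  set σ := ∑ l, ‖(Polynomial.derivative (f l)).eval z‖ with hσ
  have ht0 : 0 ≤ t := Finset.sum_nonneg fun _ _ => sq_nonneg _
  have hσ0 : 0 ≤ σ := Finset.sum_nonneg fun _ _ => norm_nonneg _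
  have hsq : ∀ l, ‖(f l).eval z‖ ^ 2 ≤ t := fun l =>
    Finset.single_le_sum (f := fun l => ‖(f l).eval z‖ ^ 2) (fun _ _ => sq_nonneg _)
      (Finset.mem_univ l)
  have hd1 : ∀ j, ‖(f j).eval z‖ * ‖bev z (dz (sumSq f))‖ ≤ t * σ := fun j =>
    norm_bev_dz_sumSq_mul_le f z _ _ (norm_nonneg _) fun l => by
      nlinarith [hsq j, hsq l, sq_nonneg (‖(f j).eval z‖ - ‖(f l).eval z‖)]
  have hd2 : ‖bev z (dz (sumSq f))‖ ≤ M * σ := by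
    simpa using norm_bev_dz_sumSq_mul_le f z 1 M zero_le_one (by simpa using hM)
  have hder : ∀ j, ‖H.eval z‖ * (‖(f j).eval z‖ * (‖bev z Q₁‖ * ‖bev z (dz (sumSq f))‖)) ≤
      3 * C * σ := by
    intro j
    calc _ = ‖H.eval z‖ * ‖bev z Q₁‖ * (‖(f j).eval z‖ * ‖bev z (dz (sumSq f))‖) := by ring
      _ ≤ (C * t) * ‖bev z Q₁‖ * (t * σ) := by
        refine mul_le_mul (mul_le_mul_of_nonneg_right hHt (norm_nonneg _)) (hd1 j) ?_ ?_ <;>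
          positivity
      _ = C * σ * (t ^ 2 * ‖bev z Q₁‖) := by ring
      _ ≤ C * σ * 3 := mul_le_mul_of_nonneg_left h4 (by positivity)
      _ = _ := by ring
  refine ⟨fun j => ?_, fun j => ?_, fun j => ?_, ?_, ?_⟩
  · rw [map_mul, map_mul, bev_cj, bev_hol, bev_hol, norm_mul, norm_mul, RCLike.norm_conj]
    have hM0 : 0 ≤ M := (norm_nonneg _).trans (hM j)
    calc _ ≤ (C * t) * (M * ‖bev z Q‖) := by
          refine mul_le_mul hHt (mul_le_mul_of_nonneg_right (hM j) (norm_nonneg _)) ?_ ?_ <;>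
            positivity
      _ = C * M * (t * ‖bev z Q‖) := by ring
      _ ≤ C * M * 2 := mul_le_mul_of_nonneg_left h3 (by positivity)
      _ = _ := by ring
  · rw [Derivation.leibniz, dz_cj_hol, smul_zero, add_zero, smul_eq_mul, hz]
    simp only [map_mul, bev_cj, bev_hol, norm_mul, RCLike.norm_conj]
    exact hder j
  · rw [Derivation.leibniz, dw_cj_hol, smul_eq_mul, smul_eq_mul, hw, mul_add, map_add]
    simp only [map_mul, bev_cj, bev_hol]
    refine (norm_add_le _ _).trans ?_
    simp only [norm_mul, RCLike.norm_conj, norm_bev_dw_sumSq]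
    have h5 : ‖H.eval z‖ * (‖bev z Q‖ * ‖(Polynomial.derivative (f j)).eval z‖) ≤ 2 * C * σ := by
      have h6 : ‖(Polynomial.derivative (f j)).eval z‖ ≤ σ :=
        Finset.single_le_sum (f := fun l => ‖(Polynomial.derivative (f l)).eval z‖)
          (fun _ _ => norm_nonneg _) (Finset.mem_univ j)
      calc _ ≤ (C * t) * (‖bev z Q‖ * σ) := by
            refine mul_le_mul hHt (mul_le_mul_of_nonneg_left h6 (norm_nonneg _)) ?_ ?_ <;>
              positivity
        _ = C * σ * (t * ‖bev z Q‖) := by ring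
        _ ≤ C * σ * 2 := mul_le_mul_of_nonneg_left h3 (by positivity)
        _ = _ := by ring
    linarith [hder j]
  · have h5 : dz (sumSq f * Q) = (Q + sumSq f * Q₁) * dz (sumSq f) := by
      rw [Derivation.leibniz, hz, smul_eq_mul, smul_eq_mul]; ring
    rw [h5, map_mul, norm_mul, mul_assoc]
    exact mul_le_mul h2 hd2 (norm_nonneg _) hε
  · have h5 : dw (sumSq f * Q) = (Q + sumSq f * Q₁) * dw (sumSq f) := by
      rw [Derivation.leibniz, hw, smul_eq_mul, smul_eq_mul]; ring
    rw [h5, map_mul, norm_mul, mul_assoc, norm_bev_dw_sumSq]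
    exact mul_le_mul h2 hd2 (norm_nonneg _) hε

lemma nrm_mul_hol_le_of_le_sum {n : ℕ} {f : Fin n → Polynomial ℂ} {M : ℝ}
    (hf : ∀ l, MulBd (f l : PowerSeries ℂ) M) (h : Polynomial ℂ) {c : ℝ} (hc : 0 ≤ c) (g : BiPoly)
    (hg : ∀ z : ℂ, ‖z‖ ≤ 1 → ‖bev z g‖ ≤ c * ∑ l, ‖(Polynomial.derivative (f l)).eval z‖) :
    nrm (g * hol h) ≤ c * (2 * n * M) * dirNorm h := by
  have h1 := nrm_le_sum Finset.univ (g * hol h)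
    (fun l => hol (Polynomial.derivative (f l)) * hol h) c hc fun z hz => by
      simp only [map_mul, bev_hol, norm_mul]
      rw [← Finset.sum_mul, ← mul_assoc]
      exact mul_le_mul_of_nonneg_right (hg z hz) (norm_nonneg _)
  refine h1.trans ?_
  have h2 : ∑ l, nrm (hol (Polynomial.derivative (f l)) * hol h) ≤
      ∑ _l : Fin n, 2 * M * dirNorm h := Finset.sum_le_sum fun l _ => nrm_derivative_mul_le (hf l) h
  rw [Finset.sum_const, Finset.card_univ, Fintype.card_fin, nsmul_eq_mul] at h2
  calc _ ≤ c * (n * (2 * M * dirNorm h)) := mul_le_mul_of_nonneg_left h2 hc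
    _ = _ := by ring

/-- The bound for the `∂̄` data of the Koszul correction. -/
noncomputable def koszulConst (n : ℕ) (M C : ℝ) : ℝ := 10 * C ^ 2 * M ^ 2 * (2 * n * M)

/-- The bound for the `∂̄` data of the final correction. -/
noncomputable def errorConst (n : ℕ) (M C : ℝ) : ℝ := (5 * C * M ^ 2 + 2 * C * M ^ 4) * (2 * n * M)

/-- The constant in the approximate division theorem. -/
noncomputable def divConst (n : ℕ) (M C : ℝ) : ℝ :=
  (2 * C * M ^ 3 + n * (M * (8 * koszulConst n M C)) + 4 * errorConst n M C) +
  2 * (12 * C * M ^ 3 + 2 * C * M ^ 3 + 3 * C * M ^ 2 * (2 * n * M) +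
    n * (16 * M * koszulConst n M C + M * (2 * koszulConst n M C)) + errorConst n M C) +
  (M ^ 3 + n * (M * (4 * errorConst n M C))) +
  2 * (6 * M ^ 3 + M ^ 3 + M ^ 4 * (2 * n * M) +
    n * (8 * M * errorConst n M C + M * errorConst n M C))

end DirichletRadical

namespace DirichletRadical

open PowerSeries

/-- Approximate division: `H ^ 3 * h` is nearly in the ideal generated by the `f l`, with bounds
independent of the lower bound for `∑ |f l|²`. -/
theorem exists_approx_division {n : ℕ} (f : Fin n → Polynomial ℂ) (H : Polynomial ℂ)
    {M C δ ε : ℝ} (hf : ∀ l, MulBd (f l : PowerSeries ℂ) M) (hH : MulBd (H : PowerSeries ℂ) M)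
    (hC : 0 ≤ C) (hδ : 0 < δ) (hδt : ∀ z : ℂ, ‖z‖ ≤ 1 → δ ≤ ∑ l, ‖(f l).eval z‖ ^ 2)
    (hHt : ∀ z : ℂ, ‖z‖ ≤ 1 → ‖H.eval z‖ ≤ C * ∑ l, ‖(f l).eval z‖ ^ 2)
    (hε : 0 < ε) (hε1 : ε ≤ 1) (h : Polynomial ℂ) :
    ∃ g : Fin n → Polynomial ℂ, (∀ j, dirNorm (g j) ≤ divConst n M C * dirNorm h) ∧
      dirNorm (H ^ 3 * h - ∑ j, f j * g j) ≤ ε * divConst n M C * dirNorm h := by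
  obtain ⟨Q, Q₁, hz, hw, hQ⟩ := exists_reciprocal_sumSq f hf hδ hδt hε hε1
  have hM : 0 ≤ M := hH.1
  have hS : 0 ≤ dirNorm h := dirNorm_nonneg h
  choose B hB1 hB2 hB3 hB4 using exists_dbar
  set ψ : Fin n → BiPoly := fun j => cj (hol (f j)) * Q with hψ
  have hpt : ∀ z : ℂ, ‖z‖ ≤ 1 →
      (∀ j, ‖bev z (hol H * ψ j)‖ ≤ 2 * C * M) ∧
      (∀ j, ‖bev z (hol H * dz (ψ j))‖ ≤
        3 * C * ∑ l, ‖(Polynomial.derivative (f l)).eval z‖) ∧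
      (∀ j, ‖bev z (hol H * dw (ψ j))‖ ≤
        5 * C * ∑ l, ‖(Polynomial.derivative (f l)).eval z‖) ∧
      ‖bev z (dz (sumSq f * Q))‖ ≤ ε * M * ∑ l, ‖(Polynomial.derivative (f l)).eval z‖ ∧
      ‖bev z (dw (sumSq f * Q))‖ ≤ ε * M * ∑ l, ‖(Polynomial.derivative (f l)).eval z‖ :=
    fun z hz1 => norm_bev_mul_quotient_le f H Q Q₁ hC hε.le hz hw z
      (fun l => norm_eval_le_of_mulBd (hf l) hz1) (hHt z hz1) (hQ z hz1).2.1 (hQ z hz1).2.2.1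
      (hQ z hz1).2.2.2
  have hHM : ∀ z : ℂ, ‖z‖ ≤ 1 → ‖bev z (hol H)‖ ≤ M := fun z hz1 => by
    rw [bev_hol]; exact norm_eval_le_of_mulBd hH hz1
  have hFM : ∀ l, ∀ z : ℂ, ‖z‖ ≤ 1 → ‖bev z (hol (f l))‖ ≤ M := fun l z hz1 => by
    rw [bev_hol]; exact norm_eval_le_of_mulBd (hf l) hz1
  have hF : ∀ l p, nrm (hol (f l) * p) ≤ M * nrm p := fun l p =>
    nrm_mul_le_of_bev_le _ _ M hM (hFM l)
  have flat : ∀ (c : ℝ) (g : BiPoly) (k : Polynomial ℂ), 0 ≤ c → nrm (hol k) ≤ dirNorm h →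
      (∀ z : ℂ, ‖z‖ ≤ 1 → ‖bev z g‖ ≤ c) → nrm (g * hol k) ≤ c * dirNorm h :=
    fun c g k hc hk hg => (nrm_mul_le_of_bev_le _ _ c hc hg).trans (mul_le_mul_of_nonneg_left hk hc)
  have flatH : ∀ (c : ℝ) (g : BiPoly), 0 ≤ c → (∀ z : ℂ, ‖z‖ ≤ 1 → ‖bev z g‖ ≤ c) →
      nrm (g * (hol (Polynomial.derivative H) * hol h)) ≤ c * (2 * M * dirNorm h) :=
    fun c g hc hg => (nrm_mul_le_of_bev_le _ _ c hc hg).trans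
      (mul_le_mul_of_nonneg_left (nrm_derivative_mul_le hH h) hc)
  set V := koszulConst n M C with hVdef
  set U := errorConst n M C with hUdef
  have hV0 : 0 ≤ V := by rw [hVdef, koszulConst]; positivity
  have hU0 : 0 ≤ U := by rw [hUdef, errorConst]; positivity
  -- the Koszul data
  set v : Fin n → Fin n → BiPoly := fun j k => hol H ^ 3 * ψ k * dw (ψ j) * hol h with hv
  have hvN : ∀ j k, nrm (v j k) ≤ V * dirNorm h := by
    intro j k
    refine nrm_mul_hol_le_of_le_sum hf h (by positivity) _ fun z hz1 => ?_
    obtain ⟨h1, -, h3, -, -⟩ := hpt z hz1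
    have e : hol H ^ 3 * ψ k * dw (ψ j) = hol H * (hol H * ψ k) * (hol H * dw (ψ j)) := by ring
    rw [e, map_mul, map_mul _ (hol H) (hol H * ψ k), norm_mul, norm_mul]
    calc _ ≤ M * (2 * C * M) * (5 * C * ∑ l, ‖(Polynomial.derivative (f l)).eval z‖) :=
          mul_le_mul (mul_le_mul (hHM z hz1) (h1 k) (norm_nonneg _) hM) (h3 j) (norm_nonneg _)
            (by positivity)
      _ = _ := by ring
  set b : Fin n → Fin n → BiPoly := fun j k => B (v j k) - B (v k j) with hb
  have hbdw : ∀ j k, dw (b j k) = v j k - v k j := fun j k => by rw [map_sub, hB1, hB1]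
  have hbN : ∀ j k, nrm (b j k) ≤ 8 * V * dirNorm h := fun j k =>
    (nrm_sub_le _ _).trans (by linarith [hB3 (v j k), hB3 (v k j), hvN j k, hvN k j])
  have hbdz : ∀ j k, nrm (dz (b j k)) ≤ 2 * V * dirNorm h := fun j k => by
    rw [map_sub]
    exact (nrm_sub_le _ _).trans (by linarith [hB2 (v j k), hB2 (v k j), hvN j k, hvN k j])
  have hbF : ∀ j k, nrm (hol (Polynomial.derivative (f k)) * b j k) ≤ 16 * M * V * dirNorm h := by
    intro j k
    rw [mul_sub]
    refine (nrm_sub_le _ _).trans ?_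
    have h1 := hB4 (v j k) (f k) M (hf k)
    have h2 := hB4 (v k j) (f k) M (hf k)
    have h3 := mul_le_mul_of_nonneg_left (hvN j k) hM
    have h4 := mul_le_mul_of_nonneg_left (hvN k j) hM
    linarith
  -- the corrected quotients
  set g : Fin n → BiPoly := fun j => hol H ^ 3 * ψ j * hol h - ∑ k, hol (f k) * b j k with hg
  have hFψ : ∑ k, hol (f k) * ψ k = sumSq f * Q := by
    rw [sumSq, Finset.sum_mul]
    exact Finset.sum_congr rfl fun k _ => by simp only [hψ]; ring
  have hFdψ : ∑ k, hol (f k) * dw (ψ k) = dw (sumSq f * Q) := by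
    rw [← hFψ, map_sum]
    refine Finset.sum_congr rfl fun k _ => ?_
    rw [Derivation.leibniz dw (hol (f k)) (ψ k), dw_hol, smul_zero, add_zero, smul_eq_mul]
  have hdwg : ∀ j, dw (g j) = hol H ^ 3 * ((1 - sumSq f * Q) * dw (ψ j) +
      ψ j * dw (sumSq f * Q)) * hol h := by
    intro j
    have e1 : ∑ k, dw (hol (f k) * b j k) = ∑ k, (hol H ^ 3 * hol h * dw (ψ j) *
        (hol (f k) * ψ k) - hol H ^ 3 * hol h * ψ j * (hol (f k) * dw (ψ k))) := by
      refine Finset.sum_congr rfl fun k _ => ?_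
      rw [Derivation.leibniz, dw_hol, smul_zero, add_zero, smul_eq_mul, hbdw]
      simp only [hv]
      ring
    have e2 : dw (hol H ^ 3 * ψ j * hol h) = hol H ^ 3 * hol h * dw (ψ j) := by
      rw [Derivation.leibniz, Derivation.leibniz, ← map_pow, dw_hol, dw_hol]
      simp only [smul_eq_mul]
      ring
    simp only [hg]
    rw [map_sub, map_sum, e1, e2, Finset.sum_sub_distrib, ← Finset.mul_sum, ← Finset.mul_sum,
      hFψ, hFdψ]
    ring
  have hdwgN : ∀ j, nrm (dw (g j)) ≤ ε * U * dirNorm h := by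
    intro j
    rw [hdwg]
    have h5 := nrm_mul_hol_le_of_le_sum hf h (c := ε * (5 * C * M ^ 2 + 2 * C * M ^ 4))
      (by positivity) (hol H ^ 3 * ((1 - sumSq f * Q) * dw (ψ j) + ψ j * dw (sumSq f * Q)))
      fun z hz1 => ?_
    · refine h5.trans_eq ?_
      rw [hUdef, errorConst]
      ring
    obtain ⟨h1, -, h3, -, h4⟩ := hpt z hz1
    have e : hol H ^ 3 * ((1 - sumSq f * Q) * dw (ψ j) + ψ j * dw (sumSq f * Q)) =
        hol H * (hol H * ((1 - sumSq f * Q) * (hol H * dw (ψ j)))) +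
        hol H * (hol H * ((hol H * ψ j) * dw (sumSq f * Q))) := by ring
    rw [e, map_add]
    refine (norm_add_le _ _).trans ?_
    set σ := ∑ l, ‖(Polynomial.derivative (f l)).eval z‖ with hσ
    have hσ0 : 0 ≤ σ := Finset.sum_nonneg fun _ _ => norm_nonneg _
    have hHH : ∀ (p : BiPoly) (c : ℝ), ‖bev z p‖ ≤ c → ‖bev z (hol H * (hol H * p))‖ ≤
        M * (M * c) := by
      intro p c hp
      rw [map_mul, map_mul, norm_mul, norm_mul]
      exact mul_le_mul (hHM z hz1) (mul_le_mul (hHM z hz1) hp (norm_nonneg _) hM) (by positivity) hM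
    have h6 := hHH ((1 - sumSq f * Q) * (hol H * dw (ψ j))) (ε * (5 * C * σ)) (by
      rw [map_mul, norm_mul]
      exact mul_le_mul (hQ z hz1).1 (h3 j) (norm_nonneg _) hε.le)
    have h7 := hHH ((hol H * ψ j) * dw (sumSq f * Q)) ((2 * C * M) * (ε * M * σ)) (by
      rw [map_mul, norm_mul]
      exact mul_le_mul (h1 j) h4 (norm_nonneg _) (by positivity))
    calc _ ≤ _ := add_le_add h6 h7
      _ = _ := by ring
  have hdwgN' : ∀ j, nrm (dw (g j)) ≤ U * dirNorm h := fun j =>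
    (hdwgN j).trans (mul_le_mul_of_nonneg_right (mul_le_of_le_one_left hU0 hε1) hS)
  have hgN : ∀ j, nrm (g j) ≤ (2 * C * M ^ 3 + n * (M * (8 * V))) * dirNorm h := by
    intro j
    have h1 : nrm (hol H ^ 3 * ψ j * hol h) ≤ 2 * C * M ^ 3 * dirNorm h := by
      refine flat _ _ _ (by positivity) (nrm_hol_le h) fun z hz1 => ?_
      have e : hol H ^ 3 * ψ j = hol H * hol H * (hol H * ψ j) := by ring
      rw [e, map_mul, map_mul _ (hol H) (hol H), norm_mul, norm_mul]
      calc _ ≤ M * M * (2 * C * M) := mul_le_mul (mul_le_mul (hHM z hz1) (hHM z hz1)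
            (norm_nonneg _) hM) ((hpt z hz1).1 j) (norm_nonneg _) (by positivity)
        _ = _ := by ring
    have h2 : ∑ k, nrm (hol (f k) * b j k) ≤ ∑ _k : Fin n, M * (8 * V * dirNorm h) :=
      Finset.sum_le_sum fun k _ => (hF k _).trans (mul_le_mul_of_nonneg_left (hbN j k) hM)
    rw [Finset.sum_const, Finset.card_univ, Fintype.card_fin, nsmul_eq_mul] at h2
    have h3 := nrm_sum_le Finset.univ fun k => hol (f k) * b j k
    refine (nrm_sub_le _ _).trans ?_
    linarith
  have hgdz : ∀ j, nrm (dz (g j)) ≤ (12 * C * M ^ 3 + 2 * C * M ^ 3 +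
      3 * C * M ^ 2 * (2 * n * M) + n * (16 * M * V + M * (2 * V))) * dirNorm h := by
    intro j
    have e : dz (g j) = (3 * hol H * (hol H * ψ j)) * (hol (Polynomial.derivative H) * hol h) +
        (hol H * hol H * (hol H * ψ j)) * hol (Polynomial.derivative h) +
        (hol H * hol H * (hol H * dz (ψ j))) * hol h -
        ∑ k, (hol (Polynomial.derivative (f k)) * b j k + hol (f k) * dz (b j k)) := by
      simp only [hg]
      rw [map_sub, map_sum, Derivation.leibniz, Derivation.leibniz, dz_hol, Derivation.leibniz_pow,
        dz_hol]
      have e1 : ∀ k, dz (hol (f k) * b j k) =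
          hol (Polynomial.derivative (f k)) * b j k + hol (f k) * dz (b j k) := by
        intro k
        rw [Derivation.leibniz, dz_hol, smul_eq_mul, smul_eq_mul]
        ring
      simp only [e1, smul_eq_mul, nsmul_eq_mul]
      push_cast
      ring
    have h1 := flatH (6 * C * M ^ 2) (3 * hol H * (hol H * ψ j)) (by positivity) fun z hz1 => by
      have h3 : bev z 3 = 3 := map_ofNat _ 3
      rw [map_mul, map_mul _ (3 : BiPoly), norm_mul, norm_mul, h3]
      calc _ ≤ 3 * M * (2 * C * M) := by
            refine mul_le_mul ?_ ((hpt z hz1).1 j) (norm_nonneg _) (by positivity)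
            rw [Complex.norm_ofNat]
            exact mul_le_mul_of_nonneg_left (hHM z hz1) (by norm_num)
        _ = _ := by ring
    have hHH : ∀ (z : ℂ) (p : BiPoly) (c : ℝ), ‖z‖ ≤ 1 → ‖bev z p‖ ≤ c →
        ‖bev z (hol H * hol H * p)‖ ≤ M * M * c := by
      intro z p c hz1 hp
      rw [map_mul, map_mul, norm_mul, norm_mul]
      exact mul_le_mul (mul_le_mul (hHM z hz1) (hHM z hz1) (norm_nonneg _) hM) hp (norm_nonneg _)
        (by positivity)
    have h2 := flat (M * M * (2 * C * M)) (hol H * hol H * (hol H * ψ j)) _ (by positivity)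
      (nrm_hol_derivative_le h) fun z hz1 => hHH z _ _ hz1 ((hpt z hz1).1 j)
    have h3 := nrm_mul_hol_le_of_le_sum hf h (c := M * M * (3 * C)) (by positivity)
      (hol H * hol H * (hol H * dz (ψ j))) fun z hz1 => by
        rw [mul_assoc (M * M)]
        exact hHH z _ _ hz1 ((hpt z hz1).2.1 j)
    have h4 : ∑ k, nrm (hol (Polynomial.derivative (f k)) * b j k + hol (f k) * dz (b j k)) ≤
        ∑ _k : Fin n, (16 * M * V * dirNorm h + M * (2 * V * dirNorm h)) :=
      Finset.sum_le_sum fun k _ => (nrm_add_le _ _).trans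
        (add_le_add (hbF j k) ((hF k _).trans (mul_le_mul_of_nonneg_left (hbdz j k) hM)))
    rw [Finset.sum_const, Finset.card_univ, Fintype.card_fin, nsmul_eq_mul] at h4
    have h5 := nrm_sum_le Finset.univ fun k =>
      hol (Polynomial.derivative (f k)) * b j k + hol (f k) * dz (b j k)
    rw [e]
    refine (nrm_sub_le _ _).trans ?_
    refine (add_le_add ((nrm_add_le _ _).trans (add_le_add ((nrm_add_le _ _).trans
      (add_le_add h1 h2)) h3)) (h5.trans h4)).trans_eq ?_
    ring
  -- the holomorphic quotients
  have hhol : ∀ j, ∃ gp : Polynomial ℂ, hol gp = g j - B (dw (g j)) := fun j =>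
    exists_hol_of_dw_eq_zero _ (by rw [map_sub, hB1, sub_self])
  choose gp hgp using hhol
  have hFg : ∑ j, hol (f j) * g j = hol H ^ 3 * hol h * (sumSq f * Q) := by
    have e1 : ∑ j, ∑ k, hol (f j) * (hol (f k) * b j k) = 0 := by
      have e2 : ∑ j, ∑ k, hol (f j) * (hol (f k) * b j k) =
          -∑ j, ∑ k, hol (f j) * (hol (f k) * b j k) := by
        conv_lhs => rw [Finset.sum_comm]
        simp only [← Finset.sum_neg_distrib]
        refine Finset.sum_congr rfl fun k _ => Finset.sum_congr rfl fun j _ => ?_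
        simp only [hb]
        ring
      exact self_eq_neg.mp e2
    rw [← hFψ]
    simp only [hg, mul_sub, Finset.mul_sum, Finset.sum_sub_distrib]
    rw [e1, sub_zero]
    exact Finset.sum_congr rfl fun j _ => by ring
  have hE : hol (H ^ 3 * h - ∑ j, f j * gp j) = hol H ^ 3 * (1 - sumSq f * Q) * hol h +
      ∑ j, hol (f j) * B (dw (g j)) := by
    simp only [map_sub, map_mul, map_pow, map_sum, hgp, mul_sub, Finset.sum_sub_distrib, hFg]
    ring
  have hdz : ∀ p : Polynomial ℂ, hol (Polynomial.derivative p) = dz (hol p) := fun p =>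
    (dz_hol p).symm
  refine ⟨gp, fun j => ?_, ?_⟩
  · have h1 := dirNorm_le (gp j)
    rw [hdz, hgp, map_sub dz (g j) (B (dw (g j)))] at h1
    have h2 := nrm_sub_le (g j) (B (dw (g j)))
    have h3 := nrm_sub_le (dz (g j)) (dz (B (dw (g j))))
    have h4 := hB3 (dw (g j))
    have h5 := hB2 (dw (g j))
    have h6 := hdwgN' j
    have h7 := hgN j
    have h8 := hgdz j
    have h9 : 0 ≤ ((M ^ 3 + n * (M * (4 * U))) + 2 * (6 * M ^ 3 + M ^ 3 + M ^ 4 * (2 * n * M) +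
      n * (8 * M * U + M * U))) * dirNorm h := by positivity
    rw [divConst, ← hVdef, ← hUdef]
    linarith
  · have h1 := dirNorm_le (H ^ 3 * h - ∑ j, f j * gp j)
    have h2 : nrm (hol (H ^ 3 * h - ∑ j, f j * gp j)) ≤
        ε * (M ^ 3 + n * (M * (4 * U))) * dirNorm h := by
      rw [hE]
      have h3 := flat (M ^ 3 * ε) (hol H ^ 3 * (1 - sumSq f * Q)) h (by positivity) (nrm_hol_le h)
        fun z hz1 => by
          rw [map_mul, map_pow, norm_mul, norm_pow]
          exact mul_le_mul (pow_le_pow_left₀ (norm_nonneg _) (hHM z hz1) 3) (hQ z hz1).1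
            (norm_nonneg _) (by positivity)
      have h4 : ∑ j, nrm (hol (f j) * B (dw (g j))) ≤
          ∑ _j : Fin n, M * (4 * (ε * U * dirNorm h)) := Finset.sum_le_sum fun j _ =>
        (hF j _).trans (mul_le_mul_of_nonneg_left
          ((hB3 _).trans (mul_le_mul_of_nonneg_left (hdwgN j) (by norm_num))) hM)
      rw [Finset.sum_const, Finset.card_univ, Fintype.card_fin, nsmul_eq_mul] at h4
      refine ((nrm_add_le _ _).trans (add_le_add h3 ((nrm_sum_le _ _).trans h4))).trans_eq ?_
      ring
    have h3 : nrm (hol (Polynomial.derivative (H ^ 3 * h - ∑ j, f j * gp j))) ≤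
        ε * (6 * M ^ 3 + M ^ 3 + M ^ 4 * (2 * n * M) + n * (8 * M * U + M * U)) * dirNorm h := by
      have e : hol (Polynomial.derivative (H ^ 3 * h - ∑ j, f j * gp j)) =
          (3 * hol H ^ 2 * (1 - sumSq f * Q)) * (hol (Polynomial.derivative H) * hol h) +
          (hol H ^ 3 * (1 - sumSq f * Q)) * hol (Polynomial.derivative h) +
          (hol H ^ 3 * -dz (sumSq f * Q)) * hol h +
          ∑ k, (hol (Polynomial.derivative (f k)) * B (dw (g k)) +
            hol (f k) * dz (B (dw (g k)))) := by
        have e1 : ∀ k, dz (hol (f k) * B (dw (g k))) =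
            hol (Polynomial.derivative (f k)) * B (dw (g k)) + hol (f k) * dz (B (dw (g k))) := by
          intro k
          rw [Derivation.leibniz, dz_hol, smul_eq_mul, smul_eq_mul]
          ring
        rw [hdz, hE, map_add, map_sum, Derivation.leibniz, Derivation.leibniz, dz_hol,
          Derivation.leibniz_pow, dz_hol, map_sub, Derivation.map_one_eq_zero]
        simp only [e1, smul_eq_mul, nsmul_eq_mul]
        push_cast
        ring
      have h4 := flatH (3 * M ^ 2 * ε) (3 * hol H ^ 2 * (1 - sumSq f * Q)) (by positivity)
        fun z hz1 => by
          have h3 : bev z 3 = 3 := map_ofNat _ 3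
          rw [map_mul, map_mul _ (3 : BiPoly), map_pow, norm_mul, norm_mul, norm_pow, h3,
            Complex.norm_ofNat]
          exact mul_le_mul (mul_le_mul_of_nonneg_left
            (pow_le_pow_left₀ (norm_nonneg _) (hHM z hz1) 2) (by norm_num)) (hQ z hz1).1
            (norm_nonneg _) (by positivity)
      have h5 := flat (M ^ 3 * ε) (hol H ^ 3 * (1 - sumSq f * Q)) _ (by positivity)
        (nrm_hol_derivative_le h) fun z hz1 => by
          rw [map_mul, map_pow, norm_mul, norm_pow]
          exact mul_le_mul (pow_le_pow_left₀ (norm_nonneg _) (hHM z hz1) 3) (hQ z hz1).1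
            (norm_nonneg _) (by positivity)
      have h6 := nrm_mul_hol_le_of_le_sum hf h (c := M ^ 3 * (ε * M)) (by positivity)
        (hol H ^ 3 * -dz (sumSq f * Q)) fun z hz1 => by
          rw [map_mul, map_pow, map_neg, norm_mul, norm_neg, norm_pow, mul_assoc (M ^ 3)]
          exact mul_le_mul (pow_le_pow_left₀ (norm_nonneg _) (hHM z hz1) 3)
            (hpt z hz1).2.2.2.1 (norm_nonneg _) (by positivity)
      have h7 : ∑ k, nrm (hol (Polynomial.derivative (f k)) * B (dw (g k)) +
            hol (f k) * dz (B (dw (g k)))) ≤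
          ∑ _k : Fin n, (8 * M * (ε * U * dirNorm h) + M * (ε * U * dirNorm h)) :=
        Finset.sum_le_sum fun k _ => (nrm_add_le _ _).trans (add_le_add
          ((hB4 _ _ M (hf k)).trans (mul_le_mul_of_nonneg_left (hdwgN k) (by positivity)))
          ((hF k _).trans (mul_le_mul_of_nonneg_left ((hB2 _).trans (hdwgN k)) hM)))
      rw [Finset.sum_const, Finset.card_univ, Fintype.card_fin, nsmul_eq_mul] at h7
      rw [e]
      refine ((nrm_add_le _ _).trans (add_le_add ((nrm_add_le _ _).trans (add_le_add
        ((nrm_add_le _ _).trans (add_le_add h4 h5)) h6)) ((nrm_sum_le _ _).trans h7))).trans_eq ?_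
      ring
    have h9 : 0 ≤ ε * ((2 * C * M ^ 3 + n * (M * (8 * V)) + 4 * U) +
      2 * (12 * C * M ^ 3 + 2 * C * M ^ 3 + 3 * C * M ^ 2 * (2 * n * M) +
      n * (16 * M * V + M * (2 * V)) + U)) * dirNorm h := by positivity
    rw [divConst, ← hVdef, ← hUdef]
    linarith


theorem divConst_nonneg (n : ℕ) {M C : ℝ} (hM : 0 ≤ M) (hC : 0 ≤ C) : 0 ≤ divConst n M C := by
  rw [divConst, koszulConst, errorConst]
  positivity

theorem coeff_trunc_mul (L : ℕ) (h x : PowerSeries ℂ) :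
    coeff L ((trunc (L + 1) h : PowerSeries ℂ) * x) = coeff L (h * x) := by
  rw [coeff_mul, coeff_mul]
  refine Finset.sum_congr rfl fun p hp => ?_
  rw [Polynomial.coeff_coe, coeff_trunc, if_pos]
  have := Finset.HasAntidiagonal.mem_antidiagonal.mp hp
  omega

theorem dirPart_trunc (L : ℕ) (h : PowerSeries ℂ) :
    dirPart L (trunc (L + 1) h : PowerSeries ℂ) = dirPart L h := by
  unfold dirPart
  refine Finset.sum_congr rfl fun i hi => ?_
  rw [Polynomial.coeff_coe, coeff_trunc, if_pos (Finset.mem_range.mp hi)]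

/-- The dual norm estimate expressing bounded divisibility of `H ^ 3` by the polynomials `f l`. -/
theorem dualPart_pow_three_mul_le {n : ℕ} (f : Fin n → Polynomial ℂ) (H : Polynomial ℂ)
    {M C δ : ℝ} (hf : ∀ l, MulBd (f l : PowerSeries ℂ) M) (hH : MulBd (H : PowerSeries ℂ) M)
    (hC : 0 ≤ C) (hδ : 0 < δ) (hδt : ∀ z : ℂ, ‖z‖ ≤ 1 → δ ≤ ∑ l, ‖(f l).eval z‖ ^ 2)
    (hHt : ∀ z : ℂ, ‖z‖ ≤ 1 → ‖H.eval z‖ ≤ C * ∑ l, ‖(f l).eval z‖ ^ 2)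
    (L : ℕ) (x : PowerSeries ℂ) :
    dualPart L ((H : PowerSeries ℂ) ^ 3 * x) ≤
      divConst n M C ^ 2 * n * ∑ l, dualPart L ((f l : PowerSeries ℂ) * x) := by
  set K := divConst n M C with hK
  have hK0 : 0 ≤ K := divConst_nonneg n hH.1 hC
  set y := (H : PowerSeries ℂ) ^ 3 * x with hy
  set h : Polynomial ℂ := trunc (L + 1) (dualVec L y) with hh
  have hhn : dirNorm h = √(dualPart L y) := by
    rw [dirNorm_eq (L := L), hh, dirPart_trunc, dirPart_dualVec]
    exact Nat.lt_succ_iff.mp (natDegree_trunc_lt _ _)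
  have hhy : coeff L ((h : PowerSeries ℂ) * y) = (dualPart L y : ℂ) := by
    rw [hh, coeff_trunc_mul, coeff_mul_dualVec]
  have key : ∀ ε : ℝ, 0 < ε → ε ≤ 1 → √(dualPart L y) ≤
      K * ∑ l, √(dualPart L ((f l : PowerSeries ℂ) * x)) + ε * (K * √(dualPart L x)) := by
    intro ε hε hε1
    rcases (Real.sqrt_nonneg (dualPart L y)).eq_or_lt with h0 | h0
    · rw [← h0]
      exact add_nonneg (mul_nonneg hK0 (Finset.sum_nonneg fun _ _ => Real.sqrt_nonneg _))
        (mul_nonneg hε.le (mul_nonneg hK0 (Real.sqrt_nonneg _)))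
    obtain ⟨g, hg, hE⟩ := exists_approx_division f H hf hH hC hδ hδt hHt hε hε1 h
    have e : (h : PowerSeries ℂ) * y = ∑ l, (g l : PowerSeries ℂ) * ((f l : PowerSeries ℂ) * x) +
        ((H ^ 3 * h - ∑ j, f j * g j : Polynomial ℂ) : PowerSeries ℂ) * x := by
      have e1 : ((∑ j, f j * g j : Polynomial ℂ) : PowerSeries ℂ) =
          ∑ j, (f j : PowerSeries ℂ) * (g j : PowerSeries ℂ) := by
        have e3 := map_sum (Polynomial.coeToPowerSeries.ringHom (R := ℂ)) (fun j => f j * g j)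
          Finset.univ
        exact e3.trans (Finset.sum_congr rfl fun j _ => Polynomial.coe_mul (f j) (g j))
      rw [Polynomial.coe_sub, Polynomial.coe_mul, Polynomial.coe_pow, e1, sub_mul, Finset.sum_mul,
        hy]
      have e2 : ∑ l, (g l : PowerSeries ℂ) * ((f l : PowerSeries ℂ) * x) =
        ∑ l, (f l : PowerSeries ℂ) * (g l : PowerSeries ℂ) * x :=
        Finset.sum_congr rfl fun l _ => by ring
      rw [e2]
      ring
    have b : √(dualPart L y) * √(dualPart L y) ≤
        (K * ∑ l, √(dualPart L ((f l : PowerSeries ℂ) * x)) + ε * (K * √(dualPart L x))) *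
          √(dualPart L y) := by
      have e3 : √(dualPart L y) * √(dualPart L y) = ‖coeff L ((h : PowerSeries ℂ) * y)‖ := by
        rw [hhy, Real.mul_self_sqrt (dualPart_nonneg _ _), Complex.norm_real, Real.norm_of_nonneg
          (dualPart_nonneg _ _)]
      rw [e3, e, map_add, map_sum]
      refine (norm_add_le _ _).trans ?_
      have b1 : ‖∑ l, coeff L ((g l : PowerSeries ℂ) * ((f l : PowerSeries ℂ) * x))‖ ≤
          ∑ l, K * dirNorm h * √(dualPart L ((f l : PowerSeries ℂ) * x)) := by
        refine (norm_sum_le _ _).trans (Finset.sum_le_sum fun l _ => ?_)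
        refine (norm_coeff_mul_le _ _ _).trans (mul_le_mul_of_nonneg_right ?_ (Real.sqrt_nonneg _))
        exact (sqrt_dirPart_le_dirNorm _ _).trans (hg l)
      have b2 := (norm_coeff_mul_le L ((H ^ 3 * h - ∑ j, f j * g j : Polynomial ℂ) :
        PowerSeries ℂ) x).trans (mul_le_mul_of_nonneg_right
          ((sqrt_dirPart_le_dirNorm _ _).trans hE) (Real.sqrt_nonneg _))
      refine (add_le_add b1 b2).trans_eq ?_
      rw [← Finset.mul_sum, hhn]
      ring
    exact le_of_mul_le_mul_right b h0
  have lim : √(dualPart L y) ≤ K * ∑ l, √(dualPart L ((f l : PowerSeries ℂ) * x)) := by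
    refine le_of_forall_pos_le_add fun η hη => ?_
    set R := K * √(dualPart L x) with hR
    have hR0 : 0 ≤ R := mul_nonneg hK0 (Real.sqrt_nonneg _)
    have hpos : 0 < min 1 (η / (R + 1)) := lt_min one_pos (by positivity)
    refine (key _ hpos (min_le_left _ _)).trans (by
      gcongr
      calc _ ≤ η / (R + 1) * R := mul_le_mul_of_nonneg_right (min_le_right _ _) hR0
        _ ≤ η / (R + 1) * (R + 1) := by gcongr; linarith
        _ = η := by field_simp)
  have sq := pow_le_pow_left₀ (Real.sqrt_nonneg _) lim 2
  rw [Real.sq_sqrt (dualPart_nonneg _ _), mul_pow] at sq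
  have cs := sq_sum_le_card_mul_sum_sq (s := Finset.univ)
    (f := fun l => √(dualPart L ((f l : PowerSeries ℂ) * x)))
  simp only [Real.sq_sqrt (dualPart_nonneg _ _), Finset.card_univ, Fintype.card_fin] at cs
  refine sq.trans ?_
  rw [mul_assoc]
  exact mul_le_mul_of_nonneg_left cs (sq_nonneg _)


/-- The Taylor series at the origin as a formal power series. -/
noncomputable def taylor (φ : ℂ → ℂ) : PowerSeries ℂ := PowerSeries.mk (dirCoeff φ)

lemma coeff_taylor (φ : ℂ → ℂ) (n : ℕ) : coeff n (taylor φ) = dirCoeff φ n := coeff_mk _ _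

/-- Absolute convergence on the open unit disk. -/
def ConvDisk (a : PowerSeries ℂ) : Prop := ∀ z : ℂ, ‖z‖ < 1 → Summable fun n => ‖coeff n a * z ^ n‖

lemma MulBd.convDisk {a : PowerSeries ℂ} {M : ℝ} (ha : MulBd a M) : ConvDisk a :=
  fun _ hz => ha.summable hz

lemma ConvDisk.mul {a b : PowerSeries ℂ} (ha : ConvDisk a) (hb : ConvDisk b) : ConvDisk (a * b) :=
  fun z hz => summable_mul (ha z hz) (hb z hz)

lemma convDisk_of_summable {a : PowerSeries ℂ}
    (h : Summable fun n : ℕ => ((n : ℝ) + 1) * ‖coeff n a‖ ^ 2) : ConvDisk a := by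
  intro z hz
  have h2 : Summable fun n : ℕ => (‖z‖ ^ 2) ^ n :=
    summable_geometric_of_lt_one (by positivity) (by nlinarith [norm_nonneg z])
  refine Summable.of_nonneg_of_le (fun _ => norm_nonneg _) (fun n => ?_) (h.add h2)
  rw [norm_mul, norm_pow, ← pow_mul, mul_comm 2 n, pow_mul]
  have : (0 : ℝ) ≤ n * ‖coeff n a‖ ^ 2 := by positivity
  nlinarith [sq_nonneg (‖coeff n a‖ - ‖z‖ ^ n), sq_nonneg (‖coeff n a‖), sq_nonneg (‖z‖ ^ n)]

lemma ConvDisk.differentiableOn {a : PowerSeries ℂ} (ha : ConvDisk a) :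
    DifferentiableOn ℂ (val a) (ball (0 : ℂ) 1) := by
  intro z hz
  rw [mem_ball_zero_iff] at hz
  obtain ⟨r, hzr, hr⟩ := exists_between hz
  have hr0 : 0 ≤ r := (norm_nonneg z).trans hzr.le
  have hn : ‖(r : ℂ)‖ = r := by rw [Complex.norm_real, Real.norm_of_nonneg hr0]
  have h := Complex.differentiableOn_tsum_of_summable_norm (U := ball (0 : ℂ) r)
    (F := fun n w => coeff n a * w ^ n) (ha (r : ℂ) (by rwa [hn]))
    (fun i => by fun_prop) isOpen_ball fun i w hw => by
      rw [mem_ball_zero_iff] at hw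
      rw [norm_mul, norm_mul, norm_pow, norm_pow, hn]
      gcongr
  exact (h.differentiableAt (isOpen_ball.mem_nhds (by rwa [mem_ball_zero_iff]))).differentiableWithinAt

lemma hasSum_taylor {φ : ℂ → ℂ} (h : DifferentiableOn ℂ φ (ball (0 : ℂ) 1)) {z : ℂ} (hz : ‖z‖ < 1) :
    HasSum (fun n => coeff n (taylor φ) * z ^ n) (φ z) := by
  have := Complex.hasSum_taylorSeries_on_ball h (mem_ball_zero_iff.mpr hz)
  refine this.congr_fun fun n => ?_
  rw [coeff_taylor, dirCoeff, sub_zero, smul_eq_mul, smul_eq_mul]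
  ring

lemma convDisk_taylor {φ : ℂ → ℂ} (h : DifferentiableOn ℂ φ (ball (0 : ℂ) 1)) :
    ConvDisk (taylor φ) := fun _ hz => summable_norm_iff.mpr (hasSum_taylor h hz).summable

lemma val_taylor {φ : ℂ → ℂ} (h : DifferentiableOn ℂ φ (ball (0 : ℂ) 1)) {z : ℂ} (hz : ‖z‖ < 1) :
    val (taylor φ) z = φ z := (hasSum_taylor h hz).tsum_eq

lemma taylor_eq {φ : ℂ → ℂ} (h : DifferentiableOn ℂ φ (ball (0 : ℂ) 1)) {a : PowerSeries ℂ}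
    (ha : ConvDisk a) (he : ∀ z : ℂ, ‖z‖ < 1 → φ z = val a z) : taylor φ = a := by
  have key : ∀ b : PowerSeries ℂ, (∀ z : ℂ, ‖z‖ < 1 → HasSum (fun n => coeff n b * z ^ n) (φ z)) →
      HasFPowerSeriesAt φ (FormalMultilinearSeries.ofScalars ℂ fun n => coeff n b) 0 := by
    intro b hb
    rw [hasFPowerSeriesAt_iff]
    filter_upwards [ball_mem_nhds (0 : ℂ) one_pos] with z hz
    rw [mem_ball_zero_iff] at hz
    simpa [FormalMultilinearSeries.coeff_ofScalars, mul_comm] using hb z hz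
  have e := (key _ fun z hz => hasSum_taylor h hz).eq_formalMultilinearSeries
    (key a fun z hz => by
      rw [he z hz]
      exact (summable_norm_iff.mp (ha z hz)).hasSum)
  ext n
  have := congrArg (fun p => p.coeff n) e
  simpa [FormalMultilinearSeries.coeff_ofScalars] using this

lemma memDirichlet_iff {φ : ℂ → ℂ} {a : PowerSeries ℂ}
    (ha : ConvDisk a) (he : ∀ z : ℂ, ‖z‖ < 1 → φ z = val a z) :
    MemDirichlet φ ↔ Summable fun n : ℕ => ((n : ℝ) + 1) * ‖coeff n a‖ ^ 2 := by
  have hd : DifferentiableOn ℂ φ (ball (0 : ℂ) 1) :=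
    ha.differentiableOn.congr fun z hz => he z (mem_ball_zero_iff.mp hz)
  rw [← taylor_eq hd ha he]
  simp only [MemDirichlet, hd, true_and, coeff_taylor]

lemma MulBd.summable_mul {a : PowerSeries ℂ} {M : ℝ} (ha : MulBd a M) {x : PowerSeries ℂ}
    (hx : Summable fun n : ℕ => ((n : ℝ) + 1) * ‖coeff n x‖ ^ 2) :
    Summable fun n : ℕ => ((n : ℝ) + 1) * ‖coeff n (a * x)‖ ^ 2 := by
  refine summable_of_sum_range_le (c := M ^ 2 * ∑' n : ℕ, ((n : ℝ) + 1) * ‖coeff n x‖ ^ 2)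
    (fun _ => by positivity) fun n => ?_
  have h1 := pow_le_pow_left₀ (Real.sqrt_nonneg _) (ha.dir_le n x) 2
  rw [mul_pow, Real.sq_sqrt (dirPart_nonneg _ _), Real.sq_sqrt (dirPart_nonneg _ _)] at h1
  calc _ ≤ dirPart n (a * x) := Finset.sum_le_sum_of_subset_of_nonneg
        (Finset.range_subset_range.mpr n.le_succ) fun _ _ _ => by positivity
    _ ≤ M ^ 2 * dirPart n x := h1
    _ ≤ _ := mul_le_mul_of_nonneg_left (hx.sum_le_tsum _ fun _ _ => by positivity) (sq_nonneg M)

theorem MulBd.isMultiplier {a : PowerSeries ℂ} {M : ℝ} (ha : MulBd a M) : IsMultiplier (val a) := by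
  refine ⟨ha.convDisk.differentiableOn, fun f hf => ?_⟩
  have hc := convDisk_taylor hf.1
  rw [memDirichlet_iff (ha.convDisk.mul hc) fun z hz => by
    rw [val_mul (ha.convDisk z hz) (hc z hz), val_taylor hf.1 hz]]
  refine ha.summable_mul ?_
  simpa only [coeff_taylor] using hf.2

/-- The power series whose weighted coefficient sequence is `u`. -/
noncomputable def unweight (u : ℕ → ℂ) : PowerSeries ℂ :=
  PowerSeries.mk fun n => u n / (√((n : ℝ) + 1) : ℝ)

lemma coeff_unweight (u : ℕ → ℂ) (n : ℕ) : coeff n (unweight u) = u n / (√((n : ℝ) + 1) : ℝ) :=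
  coeff_mk _ _

lemma unweight_add (u v : ℕ → ℂ) : unweight (u + v) = unweight u + unweight v := by
  ext n
  simp only [map_add, coeff_unweight, Pi.add_apply, add_div]

lemma unweight_smul (c : ℂ) (u : ℕ → ℂ) : unweight (c • u) = c • unweight u := by
  ext n
  simp only [map_smul, coeff_unweight, Pi.smul_apply, smul_eq_mul, mul_div_assoc]

lemma norm_weight_mul_sq (n : ℕ) (c : ℂ) :
    ‖((√((n : ℝ) + 1) : ℝ) : ℂ) * c‖ ^ 2 = ((n : ℝ) + 1) * ‖c‖ ^ 2 := by
  rw [norm_mul, mul_pow, Complex.norm_real, Real.norm_of_nonneg (Real.sqrt_nonneg _),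
    Real.sq_sqrt (by positivity)]

lemma weight_mul_coeff_unweight (u : ℕ → ℂ) (n : ℕ) :
    ((√((n : ℝ) + 1) : ℝ) : ℂ) * coeff n (unweight u) = u n := by
  have : ((√((n : ℝ) + 1) : ℝ) : ℂ) ≠ 0 := Complex.ofReal_ne_zero.mpr (by positivity)
  rw [coeff_unweight]
  field_simp

lemma memlp_two_iff (u : ℕ → ℂ) : Memℓp u 2 ↔ Summable fun n => ‖u n‖ ^ 2 := by
  rw [memℓp_gen_iff (by norm_num)]
  simp

lemma IsMultiplier.summable_mul {φ : ℂ → ℂ} (hφ : IsMultiplier φ) {x : PowerSeries ℂ}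
    (hx : Summable fun n : ℕ => ((n : ℝ) + 1) * ‖coeff n x‖ ^ 2) :
    Summable fun n : ℕ => ((n : ℝ) + 1) * ‖coeff n (taylor φ * x)‖ ^ 2 := by
  have hc := convDisk_of_summable hx
  have h := hφ.2 _ ((memDirichlet_iff hc fun _ _ => rfl).mpr hx)
  refine (memDirichlet_iff ((convDisk_taylor hφ.1).mul hc) fun z hz => ?_).mp h
  rw [val_mul (convDisk_taylor hφ.1 z hz) (hc z hz), val_taylor hφ.1 hz]

lemma memlp_weighted_mul {φ : ℂ → ℂ} (hφ : IsMultiplier φ) (u : lp (fun _ : ℕ => ℂ) 2) :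
    Memℓp (fun n : ℕ => ((√((n : ℝ) + 1) : ℝ) : ℂ) * coeff n (taylor φ * unweight u)) 2 := by
  rw [memlp_two_iff]
  simp only [norm_weight_mul_sq]
  refine IsMultiplier.summable_mul hφ ?_
  simp only [← norm_weight_mul_sq, weight_mul_coeff_unweight]
  exact (memlp_two_iff _).mp (lp.memℓp u)

/-- Multiplication by `φ` on the weighted coefficient sequences. -/
noncomputable def weightedMul {φ : ℂ → ℂ} (hφ : IsMultiplier φ) :
    lp (fun _ : ℕ => ℂ) 2 →ₗ[ℂ] lp (fun _ : ℕ => ℂ) 2 where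
  toFun u := ⟨_, memlp_weighted_mul hφ u⟩
  map_add' u v := by
    ext n
    change ((√((n : ℝ) + 1) : ℝ) : ℂ) * coeff n (taylor φ * unweight (u + v)) =
      ((√((n : ℝ) + 1) : ℝ) : ℂ) * coeff n (taylor φ * unweight u) +
        ((√((n : ℝ) + 1) : ℝ) : ℂ) * coeff n (taylor φ * unweight v)
    rw [unweight_add, mul_add, map_add, mul_add]
  map_smul' c u := by
    ext n
    change ((√((n : ℝ) + 1) : ℝ) : ℂ) * coeff n (taylor φ * unweight (c • u)) =
      c * (((√((n : ℝ) + 1) : ℝ) : ℂ) * coeff n (taylor φ * unweight u))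
    rw [unweight_smul, mul_smul_comm, map_smul, smul_eq_mul, mul_left_comm]

lemma weightedMul_apply {φ : ℂ → ℂ} (hφ : IsMultiplier φ) (u : lp (fun _ : ℕ => ℂ) 2) (n : ℕ) :
    weightedMul hφ u n = ((√((n : ℝ) + 1) : ℝ) : ℂ) * coeff n (taylor φ * unweight u) := rfl

lemma continuous_lp_apply (n : ℕ) : Continuous fun u : lp (fun _ : ℕ => ℂ) 2 => u n :=
  (lp.evalCLM ℂ (fun _ : ℕ => ℂ) 2 n).continuous

lemma continuous_weightedMul {φ : ℂ → ℂ} (hφ : IsMultiplier φ) : Continuous (weightedMul hφ) := by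
  refine (weightedMul hφ).continuous_of_seq_closed_graph fun u x y hu hy => ?_
  ext n
  have h1 := ((continuous_lp_apply n).tendsto y).comp hy
  have hc : Continuous fun v : lp (fun _ : ℕ => ℂ) 2 => weightedMul hφ v n := by
    simp only [weightedMul_apply, coeff_mul, coeff_unweight]
    exact continuous_const.mul (continuous_finsetSum _ fun p _ =>
      continuous_const.mul ((continuous_lp_apply p.2).div_const _))
  exact tendsto_nhds_unique h1 ((hc.tendsto x).comp hu)

theorem IsMultiplier.exists_mulBd {φ : ℂ → ℂ} (hφ : IsMultiplier φ) : ∃ M, MulBd (taylor φ) M := by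
  set T : lp (fun _ : ℕ => ℂ) 2 →L[ℂ] lp (fun _ : ℕ => ℂ) 2 :=
    ⟨weightedMul hφ, continuous_weightedMul hφ⟩ with hT
  refine ⟨‖T‖, mulBd_of_dir_le (norm_nonneg _) fun L x => ?_⟩
  set u : ℕ → ℂ := fun n => if n ≤ L then ((√((n : ℝ) + 1) : ℝ) : ℂ) * coeff n x else 0 with hu
  have hmem : Memℓp u 2 := by
    rw [memlp_two_iff]
    refine summable_of_ne_finset_zero (s := Finset.range (L + 1)) fun n hn => ?_
    rw [hu]
    simp only [Finset.mem_range] at hn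
    simp [show ¬ n ≤ L by omega]
  set U : lp (fun _ : ℕ => ℂ) 2 := ⟨u, hmem⟩ with hU
  have hUn : ‖U‖ = √(dirPart L x) := by
    have h1 := lp.norm_rpow_eq_tsum (p := 2) (by norm_num) U
    rw [tsum_eq_sum (s := Finset.range (L + 1))] at h1
    · have h2 : dirPart L x = ‖U‖ ^ 2 := by
        simp only [ENNReal.toReal_ofNat, Real.rpow_ofNat] at h1
        rw [h1, dirPart]
        refine Finset.sum_congr rfl fun i hi => ?_
        have : i ≤ L := Nat.lt_succ_iff.mp (Finset.mem_range.mp hi)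
        change _ = ‖u i‖ ^ 2
        rw [hu]
        simp only [if_pos this, norm_weight_mul_sq]
      rw [h2, Real.sqrt_sq (norm_nonneg _)]
    · intro n hn
      simp only [Finset.mem_range] at hn
      change ‖u n‖ ^ _ = (0 : ℝ)
      simp [hu, show ¬ n ≤ L by omega]
  have hco : ∀ i ≤ L, coeff i (unweight u) = coeff i x := by
    intro i hi
    have : ((√((i : ℝ) + 1) : ℝ) : ℂ) ≠ 0 := Complex.ofReal_ne_zero.mpr (by positivity)
    rw [coeff_unweight, hu]
    simp only [if_pos hi]
    field_simp
  have hle : √(dirPart L (taylor φ * x)) ≤ ‖T U‖ := by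
    refine Real.sqrt_le_iff.mpr ⟨norm_nonneg _, ?_⟩
    have h1 := lp.sum_rpow_le_norm_rpow (p := 2) (by norm_num) (T U) (Finset.range (L + 1))
    simp only [ENNReal.toReal_ofNat, Real.rpow_ofNat] at h1
    refine le_trans (le_of_eq ?_) h1
    rw [dirPart]
    refine Finset.sum_congr rfl fun i hi => ?_
    have hi' : i ≤ L := Nat.lt_succ_iff.mp (Finset.mem_range.mp hi)
    change _ = ‖((√((i : ℝ) + 1) : ℝ) : ℂ) * coeff i (taylor φ * unweight u)‖ ^ 2
    rw [norm_weight_mul_sq]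
    have e : coeff i (taylor φ * unweight u) = coeff i (taylor φ * x) := by
      rw [coeff_mul, coeff_mul]
      refine Finset.sum_congr rfl fun p hp => ?_
      have := Finset.HasAntidiagonal.mem_antidiagonal.mp hp
      rw [hco _ (by omega)]
    rw [e]
  exact hle.trans ((T.le_opNorm U).trans_eq (by rw [hUn]))


lemma tendsto_fejer_weight (k : ℕ) :
    Filter.Tendsto (fun K : ℕ => ((K + 1 - k : ℕ) : ℝ) / (K + 1)) Filter.atTop (nhds 1) := by
  have h : Filter.Tendsto (fun K : ℕ => 1 - (k : ℝ) * (1 / ((K : ℝ) + 1))) Filter.atTop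
      (nhds (1 - k * 0)) :=
    tendsto_const_nhds.sub (tendsto_const_nhds.mul tendsto_one_div_add_atTop_nhds_zero_nat)
  rw [mul_zero, sub_zero] at h
  refine h.congr' ?_
  filter_upwards [Filter.eventually_ge_atTop k] with K hK
  rw [Nat.cast_sub (by omega)]
  push_cast
  field_simp

lemma coeffTendsto_approx (a : PowerSeries ℂ) {r : ℕ → ℝ} {K : ℕ → ℕ}
    (hr : Filter.Tendsto r Filter.atTop (nhds 1)) (hK : Filter.Tendsto K Filter.atTop Filter.atTop) :
    CoeffTendsto (fun N => (approx (r N) (K N) a : PowerSeries ℂ)) Filter.atTop a := by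
  intro s
  simp only [Polynomial.coeff_coe, coeff_approx]
  have h1 := (Complex.continuous_ofReal.tendsto _).comp ((tendsto_fejer_weight s).comp hK)
  have h2 := (Complex.continuous_ofReal.tendsto _).comp (hr.pow s)
  have h3 := h1.mul (h2.mul (tendsto_const_nhds (x := coeff s a)))
  simpa using h3

lemma exists_approx_index {M r η : ℝ} (hη : 0 < η) (N : ℕ) :
    ∃ K : ℕ, N ≤ K ∧ M * (∑' k : ℕ, (k : ℝ) * r ^ k) / (K + 1) ≤ η := by
  obtain ⟨k, hk⟩ := exists_nat_gt (M * (∑' k : ℕ, (k : ℝ) * r ^ k) / η)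
  refine ⟨max N k, le_max_left _ _, ?_⟩
  rw [div_le_iff₀ (by positivity), ← div_le_iff₀' hη]
  have : (k : ℝ) ≤ (max N k : ℕ) := Nat.cast_le.mpr (le_max_right _ _)
  linarith

lemma norm_sq_le_of_norm_sub_le {a b : ℂ} {η : ℝ} (h : ‖a - b‖ ≤ η) :
    ‖b‖ ^ 2 ≤ 2 * ‖a‖ ^ 2 + 2 * η ^ 2 := by
  have h1 : ‖b‖ ≤ ‖a‖ + η := by
    have := norm_sub_norm_le b a
    rw [norm_sub_rev] at this
    linarith
  nlinarith [norm_nonneg b, norm_nonneg a, sq_nonneg (‖a‖ - η), norm_nonneg (a - b)]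

theorem dualPart_pow_three_mul_le_of_val_le {n : ℕ} (f : Fin n → PowerSeries ℂ) (Ψ : PowerSeries ℂ)
    {M C : ℝ} (hf : ∀ l, MulBd (f l) M) (hΨ : MulBd Ψ M) (hM1 : 1 ≤ M) (hC : 0 ≤ C)
    (hle : ∀ z : ℂ, ‖z‖ < 1 → ‖val Ψ z‖ ≤ C * ∑ l, ‖val (f l) z‖ ^ 2)
    (L : ℕ) (x : PowerSeries ℂ) :
    dualPart L (Ψ ^ 3 * x) ≤ divConst (n + 1) M (2 * C + 1) ^ 2 * (n + 1 : ℕ) *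
      ∑ l, dualPart L (f l * x) := by
  set δ : ℕ → ℝ := fun N => 1 / ((N : ℝ) + 1) with hδ
  have hδ0 : ∀ N, 0 < δ N := fun N => by positivity
  have hδ1 : ∀ N, δ N ≤ 1 := fun N => by
    rw [hδ]
    simp only
    rw [div_le_one (by positivity)]
    linarith [N.cast_nonneg (α := ℝ)]
  have hδt : Filter.Tendsto δ Filter.atTop (nhds 0) := tendsto_one_div_add_atTop_nhds_zero_nat
  set A : ℝ := 2 * C * n + 1 with hA
  have hA1 : 1 ≤ A := by
    have : 0 ≤ 2 * C * n := by positivity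
    linarith
  choose K hNK hK using fun N => exists_approx_index (M := M) (r := 1 - δ N)
    (η := δ N ^ 2 / A) (by have := hδ0 N; positivity) N
  have hKt : Filter.Tendsto K Filter.atTop Filter.atTop := Filter.tendsto_atTop_mono hNK Filter.tendsto_id
  have hrt : Filter.Tendsto (fun N => 1 - δ N) Filter.atTop (nhds 1) := by
    simpa using (tendsto_const_nhds (x := (1 : ℝ))).sub hδt
  have hr0 : ∀ N, 0 ≤ 1 - δ N := fun N => by linarith [hδ1 N]
  have hr1 : ∀ N, 1 - δ N < 1 := fun N => by linarith [hδ0 N]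
  have step : ∀ N, dualPart L ((approx (1 - δ N) (K N) Ψ : PowerSeries ℂ) ^ 3 * x) ≤
      divConst (n + 1) M (2 * C + 1) ^ 2 * (n + 1 : ℕ) * (δ N ^ 2 * dualPart L x +
        ∑ l, dualPart L ((approx (1 - δ N) (K N) (f l) : PowerSeries ℂ) * x)) := by
    intro N
    set p : Fin (n + 1) → Polynomial ℂ :=
      Fin.cons (Polynomial.C (δ N : ℂ)) fun l => approx (1 - δ N) (K N) (f l) with hp
    have hδn : ‖(δ N : ℂ)‖ = δ N := by rw [Complex.norm_real, Real.norm_of_nonneg (hδ0 N).le]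
    have hsum : ∀ z : ℂ, ∑ l, ‖(p l).eval z‖ ^ 2 =
        δ N ^ 2 + ∑ l, ‖(approx (1 - δ N) (K N) (f l)).eval z‖ ^ 2 := by
      intro z
      rw [Fin.sum_univ_succ]
      simp only [hp, Fin.cons_zero, Fin.cons_succ, Polynomial.eval_C, hδn]
    have hpM : ∀ l, MulBd (p l : PowerSeries ℂ) M := by
      intro l
      refine Fin.cases ?_ (fun l => ?_) l
      · rw [hp, Fin.cons_zero, Polynomial.coe_C]
        exact (mulBd_C _).mono (by rw [hδn]; exact (hδ1 N).trans hM1)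
      · rw [hp, Fin.cons_succ]
        exact (hf l).approx (hr0 N) (hr1 N).le _
    have main := dualPart_pow_three_mul_le p (approx (1 - δ N) (K N) Ψ) (C := 2 * C + 1)
      (δ := δ N ^ 2) hpM (hΨ.approx (hr0 N) (hr1 N).le _) (by positivity) (pow_pos (hδ0 N) 2)
      (fun z _ => by
        rw [hsum]
        exact le_add_of_nonneg_right (Finset.sum_nonneg fun _ _ => sq_nonneg _))
      (fun z hz => by
        set η := δ N ^ 2 / A with hη
        have hη0 : 0 ≤ η := by positivity
        have hη1 : η ≤ 1 := by
          rw [hη, div_le_one (by positivity)]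
          exact (pow_le_one₀ (hδ0 N).le (hδ1 N)).trans hA1
        have hηA : A * η = δ N ^ 2 := by rw [hη]; field_simp
        have hrz : ‖((1 - δ N : ℝ) : ℂ) * z‖ < 1 := by
          rw [norm_mul, Complex.norm_real, Real.norm_of_nonneg (hr0 N)]
          nlinarith [norm_nonneg z, hr1 N, hr0 N]
        have e0 := (norm_eval_approx_sub_val_le hΨ (hr0 N) (hr1 N) (K N) hz).trans (hK N)
        have e1 : ∀ l, ‖val (f l) (((1 - δ N : ℝ) : ℂ) * z)‖ ^ 2 ≤
            2 * ‖(approx (1 - δ N) (K N) (f l)).eval z‖ ^ 2 + 2 * η ^ 2 := fun l =>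
          norm_sq_le_of_norm_sub_le
            ((norm_eval_approx_sub_val_le (hf l) (hr0 N) (hr1 N) (K N) hz).trans (hK N))
        have e2 := Finset.sum_le_sum fun l (_ : l ∈ Finset.univ) => e1 l
        rw [Finset.sum_add_distrib, ← Finset.mul_sum, Finset.sum_const, Finset.card_univ,
          Fintype.card_fin, nsmul_eq_mul] at e2
        have e3 := mul_le_mul_of_nonneg_left e2 hC
        have e4 := hle _ hrz
        have e5 := norm_le_norm_add_norm_sub' ((approx (1 - δ N) (K N) Ψ).eval z)
          (val Ψ (((1 - δ N : ℝ) : ℂ) * z))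
        rw [hsum]
        set S := ∑ l, ‖(approx (1 - δ N) (K N) (f l)).eval z‖ ^ 2 with hS
        have hS0 : 0 ≤ S := Finset.sum_nonneg fun _ _ => sq_nonneg _
        have e6 : η ^ 2 ≤ η := by nlinarith
        have e7 : C * (n * (2 * η ^ 2)) ≤ C * (n * (2 * η)) := by gcongr
        have e8 : C * (n * (2 * η)) + η = δ N ^ 2 := by rw [← hηA, hA]; ring
        have e9 : 0 ≤ 2 * C * δ N ^ 2 := by positivity
        calc _ ≤ _ := e5
          _ ≤ C * (2 * S + n * (2 * η ^ 2)) + η := add_le_add (e4.trans e3) e0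
          _ ≤ _ := by linarith) L x
    refine main.trans_eq ?_
    rw [Fin.sum_univ_succ]
    simp only [hp, Fin.cons_zero, Fin.cons_succ, Polynomial.coe_C, dualPart_C_mul, hδn]
  have lim1 := (((coeffTendsto_approx Ψ hrt hKt).pow 3).mul (CoeffTendsto.const x)).dualPart L
  have lim2 : Filter.Tendsto (fun N => divConst (n + 1) M (2 * C + 1) ^ 2 * (n + 1 : ℕ) *
      (δ N ^ 2 * dualPart L x +
        ∑ l, dualPart L ((approx (1 - δ N) (K N) (f l) : PowerSeries ℂ) * x))) Filter.atTop
      (nhds (divConst (n + 1) M (2 * C + 1) ^ 2 * (n + 1 : ℕ) *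
        (0 ^ 2 * dualPart L x + ∑ l, dualPart L (f l * x)))) :=
    tendsto_const_nhds.mul (((hδt.pow 2).mul tendsto_const_nhds).add
      (tendsto_finsetSum _ fun l _ =>
        ((coeffTendsto_approx (f l) hrt hKt).mul (CoeffTendsto.const x)).dualPart L))
  refine (le_of_tendsto_of_tendsto' lim1 lim2 step).trans_eq ?_
  rw [zero_pow two_ne_zero, zero_mul, zero_add]

theorem exists_division {n : ℕ} (f : Fin n → PowerSeries ℂ) (Ψ : PowerSeries ℂ)
    {M C : ℝ} (hf : ∀ l, MulBd (f l) M) (hΨ : MulBd Ψ M) (hM1 : 1 ≤ M) (hC : 0 ≤ C)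
    (hle : ∀ z : ℂ, ‖z‖ < 1 → ‖val Ψ z‖ ≤ C * ∑ l, ‖val (f l) z‖ ^ 2) :
    ∃ g : Fin n → PowerSeries ℂ, ∑ l, f l * g l = Ψ ^ 3 ∧ ∀ l, ∃ M, MulBd (g l) M := by
  refine exists_symbols_of_const f (Ψ ^ 3) (√(divConst (n + 1) M (2 * C + 1) ^ 2 * (n + 1 : ℕ)))
    fun L x => ?_
  rw [Real.sq_sqrt (by positivity)]
  exact dualPart_pow_three_mul_le_of_val_le f Ψ hf hΨ hM1 hC hle L x

lemma val_sum {ι : Type*} (S : Finset ι) (a : ι → PowerSeries ℂ) (ha : ∀ i, ConvDisk (a i))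
    {z : ℂ} (hz : ‖z‖ < 1) : val (∑ i ∈ S, a i) z = ∑ i ∈ S, val (a i) z := by
  unfold val
  rw [← Summable.tsum_finsetSum fun i _ => summable_norm_iff.mp (ha i z hz)]
  simp only [map_sum, Finset.sum_mul]

end DirichletRadical

open DirichletRadical in
/-- Characterization of membership in the radical of a finitely generated
ideal of the multiplier algebra of the Dirichlet space. -/
theorem radical_membership_dirichlet
    (n : ℕ) (H : ℂ → ℂ) (f : Fin n → ℂ → ℂ)
    (hH : IsMultiplier H) (hf : ∀ j, IsMultiplier (f j)) :
    (∃ m : ℕ, 0 < m ∧ ∃ g : Fin n → ℂ → ℂ, (∀ j, IsMultiplier (g j)) ∧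
        ∀ z ∈ ball (0:ℂ) 1, (H z) ^ m = ∑ j : Fin n, f j z * g j z) ↔
    (∃ C₀ : ℝ, ∃ m : ℕ, 0 < m ∧
        ∀ z ∈ ball (0:ℂ) 1, ‖H z‖ ^ m ≤ C₀ * ∑ j : Fin n, ‖f j z‖ ^ 2) := by
  obtain ⟨MH, hMH⟩ := DirichletRadical.IsMultiplier.exists_mulBd hH
  choose Mf hMf using fun j => DirichletRadical.IsMultiplier.exists_mulBd (hf j)
  constructor
  · rintro ⟨m, hm, g, hg, hHg⟩
    choose Mg hMg using fun j => DirichletRadical.IsMultiplier.exists_mulBd (hg j)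
    refine ⟨∑ j, Mg j ^ 2, m * 2, by omega, fun z hz => ?_⟩
    have hz1 : ‖z‖ < 1 := mem_ball_zero_iff.mp hz
    have hgb : ∀ j, ‖g j z‖ ≤ Mg j := fun j => by
      rw [← val_taylor (hg j).1 hz1]
      exact (hMg j).norm_val_le hz1
    rw [pow_mul, ← norm_pow, hHg z hz]
    have h1 : ‖∑ j, f j z * g j z‖ ≤ ∑ j, Mg j * ‖f j z‖ :=
      (norm_sum_le _ _).trans (Finset.sum_le_sum fun j _ => by
        rw [norm_mul, mul_comm]
        exact mul_le_mul_of_nonneg_right (hgb j) (norm_nonneg _))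
    exact (pow_le_pow_left₀ (norm_nonneg _) h1 2).trans (Finset.sum_mul_sq_le_sq_mul_sq _ _ _)
  · rintro ⟨C, m, hm, hC⟩
    set M : ℝ := 1 + MH ^ m + ∑ j, Mf j with hM
    have hMf0 : ∀ j, 0 ≤ Mf j := fun j => (hMf j).1
    have hS0 : 0 ≤ ∑ j, Mf j := Finset.sum_nonneg fun j _ => hMf0 j
    have hMH0 : 0 ≤ MH ^ m := pow_nonneg hMH.1 m
    obtain ⟨g, hgs, hg⟩ := exists_division (M := M) (C := max C 0) (fun j => taylor (f j))
      (taylor H ^ m)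
      (fun j => (hMf j).mono (by
        have := Finset.single_le_sum (f := Mf) (fun j _ => hMf0 j) (Finset.mem_univ j)
        linarith))
      ((hMH.pow m).mono (by linarith)) (by linarith) (le_max_right _ _) fun z hz => by
        rw [hMH.val_pow hz, norm_pow, val_taylor hH.1 hz]
        refine (hC z (mem_ball_zero_iff.mpr hz)).trans ?_
        simp only [fun j => val_taylor (hf j).1 hz]
        exact mul_le_mul_of_nonneg_right (le_max_left _ _)
          (Finset.sum_nonneg fun _ _ => sq_nonneg _)
    choose Mg hMg using hg
    refine ⟨m * 3, by omega, fun j => val (g j), fun j => (hMg j).isMultiplier, fun z hz => ?_⟩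
    have hz1 : ‖z‖ < 1 := mem_ball_zero_iff.mp hz
    have e := congrArg (fun a => val a z) hgs
    rw [val_sum _ _ (fun j => ((hMf j).convDisk).mul (hMg j).convDisk) hz1,
      (hMH.pow m).val_pow hz1, hMH.val_pow hz1, val_taylor hH.1 hz1, ← pow_mul] at e
    rw [← e]
    exact Finset.sum_congr rfl fun j _ => by
      rw [val_mul ((hMf j).convDisk z hz1) ((hMg j).convDisk z hz1), val_taylor (hf j).1 hz1]
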